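/- There exists an absolute constant ε > 0 such that the following holds. For every finite field F_q of odd characteristic there is a constant C = C(q) such that for every n ≥ 1, every symmetric Hankel matrix M ∈ F_q^{n×n} (i.e. a matrix whose (i,j)-entry depends only on i + j), every affine-linear map ℓ : F_q^n → F_q, and every additive character χ of F_q, one has |∑_{x ∈ F_q^n} μ(∑_{i<n} x_i t^i) · χ(xᵀ M x + ℓ(x))| ≤ C · q^{(1−ε)n}. -/

import Mathlib

open Polynomial Matrix

/- The Möbius function on `F_q[t]`. -/
open scoped Classical in
noncomputable def polyMu {F : Type*} [Field F] (f : Polynomial F) : ℤ :=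
  if Squarefree f then (-1) ^ (UniqueFactorizationMonoid.normalizedFactors f).card else 0

/-- The polynomial of degree `< n` with coefficient vector `x ∈ F_q^n`. -/
noncomputable def lowPoly (F : Type*) [Field F] (n : ℕ) (x : Fin n → F) : Polynomial F :=
  ∑ i : Fin n, C (x i) * X ^ (i : ℕ)

section Monics

theorem coeff_lowPoly {F : Type*} [Field F] {m : ℕ} (x : Fin m →
    F) (i : Fin m) : (lowPoly F m x).coeff i = x i := by
  rw [lowPoly, finsetSum_coeff, Finset.sum_eq_single i]
  · simp
  · intro j _ hj
    rw [coeff_C_mul_X_pow, if_neg]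
    exact fun h => hj (Fin.ext h.symm)
  · simp

theorem lowPoly_injective {F : Type*} [Field F] (m : ℕ) : Function.Injective (lowPoly F m) :=
    fun x y h =>
  funext fun i => by rw [← coeff_lowPoly x, h, coeff_lowPoly]

theorem degree_lowPoly_lt {F : Type*} [Field F] {m : ℕ} (x : Fin m →
    F) : (lowPoly F m x).degree < m := by
  rw [← mem_degreeLT]
  refine Submodule.sum_mem _ fun i _ => mem_degreeLT.2 ?_
  exact (degree_C_mul_X_pow_le _ _).trans_lt (by exact_mod_cast i.2)

variable (F : Type*) [Field F] [Fintype F]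

open scoped Classical in
/-- The polynomials of degree less than `m`. -/
noncomputable def lows (m : ℕ) : Finset F[X] := Finset.univ.image (lowPoly F m)

open scoped Classical in
/-- The monic polynomials of degree `m`. -/
noncomputable def monics (m : ℕ) : Finset F[X] := (lows F m).image fun v => X ^ m + v

variable {F}

theorem mem_lows {m : ℕ} {f : F[X]} : f ∈ lows F m ↔ f.degree < m := by
  classical
  rw [lows, Finset.mem_image]
  constructor
  · rintro ⟨x, _, rfl⟩
    exact degree_lowPoly_lt x
  · intro h
    refine ⟨fun i => f.coeff i, Finset.mem_univ _, ?_⟩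
    ext i
    by_cases hi : i < m
    · exact coeff_lowPoly _ ⟨i, hi⟩
    · rw [coeff_eq_zero_of_degree_lt ((degree_lowPoly_lt _).trans_le (by exact_mod_cast not_lt.1 hi)),
        coeff_eq_zero_of_degree_lt (h.trans_le (by exact_mod_cast not_lt.1 hi))]

theorem card_lows (m : ℕ) : (lows F m).card = Fintype.card F ^ m := by
  classical
  rw [lows, Finset.card_image_of_injective _ (lowPoly_injective m), Finset.card_univ]
  simp

theorem mem_monics {m : ℕ} {f : F[X]} : f ∈ monics F m ↔ f.Monic ∧ f.natDegree = m := by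
  classical
  rw [monics, Finset.mem_image]
  constructor
  · rintro ⟨v, hv, rfl⟩
    refine ⟨monic_X_pow_add (mem_lows.1 hv), ?_⟩
    rw [natDegree_add_eq_left_of_degree_lt (by rw [degree_X_pow]; exact mem_lows.1 hv),
      natDegree_X_pow]
  · rintro ⟨hf, rfl⟩
    refine ⟨f - X ^ f.natDegree, mem_lows.2 ?_, by ring⟩
    by_cases h : f.natDegree = 0
    · rw [hf.natDegree_eq_zero.1 h]
      simp
    · rw [← degree_eq_natDegree hf.ne_zero]
      refine degree_sub_lt_left ?_ hf.ne_zero ?_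
      · rw [degree_X_pow, degree_eq_natDegree hf.ne_zero]
      · rw [leadingCoeff_X_pow, hf.leadingCoeff]

theorem card_monics (m : ℕ) : (monics F m).card = Fintype.card F ^ m := by
  classical
  rw [monics, Finset.card_image_of_injective _ (add_right_injective _), card_lows]

theorem sum_monics {M : Type*} [AddCommMonoid M] (m : ℕ) (f : F[X] → M) :
    ∑ w ∈ monics F m, f w = ∑ v ∈ lows F m, f (X ^ m + v) := by
  classical
  rw [monics, Finset.sum_image fun _ _ _ _ h => add_right_injective _ h]

theorem monics_zero : monics F 0 = {1} := by
  ext f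
  rw [mem_monics, Finset.mem_singleton]
  exact ⟨fun h => h.1.natDegree_eq_zero.1 h.2, by rintro rfl; exact ⟨monic_one, natDegree_one⟩⟩

theorem mul_mem_monics {i j : ℕ} {a w : F[X]} (ha : a ∈ monics F i) (hw : w ∈ monics F j) :
    a * w ∈ monics F (i + j) := by
  rw [mem_monics] at *
  exact ⟨ha.1.mul hw.1, by rw [ha.1.natDegree_mul hw.1, ha.2, hw.2]⟩

open scoped Classical in
/-- The factorisations of `f` as a product of two monic polynomials. -/
noncomputable def monicPairs (f : F[X]) : Finset (F[X] × F[X]) :=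
  ((Finset.HasAntidiagonal.antidiagonal f.natDegree).biUnion fun k => monics F k.1 ×ˢ monics F k.2).filter
    fun k => k.1 * k.2 = f

theorem mem_monicPairs {f : F[X]} {k : F[X] × F[X]} :
    k ∈ monicPairs f ↔ k.1.Monic ∧ k.2.Monic ∧ k.1 * k.2 = f := by
  classical
  rw [monicPairs, Finset.mem_filter, Finset.mem_biUnion]
  constructor
  · rintro ⟨⟨_, _, h⟩, h2⟩
    rw [Finset.mem_product, mem_monics, mem_monics] at h
    exact ⟨h.1.1, h.2.1, h2⟩
  · rintro ⟨h1, h2, rfl⟩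
    exact ⟨⟨(k.1.natDegree, k.2.natDegree), by simp [h1.natDegree_mul h2],
      Finset.mem_product.2 ⟨mem_monics.2 ⟨h1, rfl⟩, mem_monics.2 ⟨h2, rfl⟩⟩⟩, rfl⟩

theorem sum_monics_monicPairs {M : Type*} [AddCommMonoid M] (m : ℕ) (g : F[X] → F[X] → M) :
    ∑ f ∈ monics F m, ∑ k ∈ monicPairs f, g k.1 k.2 =
      ∑ ij ∈ Finset.HasAntidiagonal.antidiagonal m, ∑ a ∈ monics F ij.1, ∑ w ∈ monics F ij.2,
          g a w := by
  classical
  have h1 : ∀ ij ∈ Finset.HasAntidiagonal.antidiagonal m, ∑ a ∈ monics F ij.1, ∑ w ∈ monics F ij.2,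
      g a w =
      ∑ k ∈ monics F ij.1 ×ˢ monics F ij.2, g k.1 k.2 := fun ij _ => by rw [Finset.sum_product]
  rw [Finset.sum_congr rfl h1, ← Finset.sum_biUnion (s := Finset.HasAntidiagonal.antidiagonal m)
    (t := fun ij => monics F ij.1 ×ˢ monics F ij.2) (f := fun k => g k.1 k.2)]
  · rw [← Finset.sum_fiberwise_of_maps_to (t := monics F m) (g := fun k : F[X] × F[X] => k.1 * k.2)]
    · refine Finset.sum_congr rfl fun f hf => Finset.sum_congr ?_ fun _ _ => rfl
      rw [monicPairs, (mem_monics.1 hf).2]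
    · intro k hk
      obtain ⟨ij, hij, hk⟩ := Finset.mem_biUnion.1 hk
      rw [← Finset.HasAntidiagonal.mem_antidiagonal.1 hij]
      exact mul_mem_monics (Finset.mem_product.1 hk).1 (Finset.mem_product.1 hk).2
  · intro ij _ ij' _ h
    rw [Function.onFun, Finset.disjoint_left]
    intro k hk hk'
    rw [Finset.mem_product, mem_monics, mem_monics] at hk hk'
    exact h (Prod.ext (hk.1.2.symm.trans hk'.1.2) (hk.2.2.symm.trans hk'.2.2))

end Monics

section Moebius

variable {F : Type*} [Field F]

theorem polyMu_one : polyMu (1 : F[X]) = 1 := by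
  simp [polyMu]

theorem polyMu_mul {a b : F[X]} (h : IsCoprime a b) : polyMu (a * b) = polyMu a * polyMu b := by
  classical
  have h1 : Squarefree (a * b) ↔ Squarefree a ∧ Squarefree b := by
    rw [squarefree_mul_iff]
    exact ⟨fun h => h.2, fun h' => ⟨h.isRelPrime, h'⟩⟩
  by_cases ha : Squarefree a
  · by_cases hb : Squarefree b
    · rw [polyMu, if_pos (h1.2 ⟨ha, hb⟩), polyMu, if_pos ha, polyMu, if_pos hb,
        UniqueFactorizationMonoid.normalizedFactors_mul ha.ne_zero hb.ne_zero, Multiset.card_add,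
        pow_add]
    · rw [polyMu, if_neg fun h' => hb (h1.1 h').2, polyMu.eq_1 b, if_neg hb, mul_zero]
  · rw [polyMu, if_neg fun h' => ha (h1.1 h').1, polyMu, if_neg ha, zero_mul]

theorem polyMu_of_not_squarefree {f : F[X]} (h : ¬ Squarefree f) : polyMu f = 0 := if_neg h

theorem abs_polyMu_le (f : F[X]) : |polyMu f| ≤ 1 := by
  rw [polyMu]
  split_ifs <;> simp

theorem polyMu_irreducible {P : F[X]} (h : Irreducible P) : polyMu P = -1 := by
  classical
  rw [polyMu, if_pos h.squarefree, UniqueFactorizationMonoid.normalizedFactors_irreducible h]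
  simp

theorem polyMu_C_mul {c : F} (hc : c ≠ 0) (f : F[X]) : polyMu (C c * f) = polyMu f := by
  classical
  have hu : Associated (C c * f) f :=
    associated_unit_mul_left _ _ (isUnit_C.2 (isUnit_iff_ne_zero.2 hc))
  have h1 : Squarefree (C c * f) ↔ Squarefree f := hu.squarefree_iff
  rw [polyMu, polyMu]
  by_cases h : Squarefree f
  · rw [if_pos h, if_pos (h1.2 h),
      (UniqueFactorizationMonoid.associated_iff_normalizedFactors_eq_normalizedFactors
        (h1.2 h).ne_zero h.ne_zero).1 hu]
  · rw [if_neg h, if_neg fun h' => h (h1.1 h')]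

variable [Fintype F]

theorem sum_monicPairs_polyMu {f : F[X]} (hf : f.Monic) (h1 : f ≠ 1) :
    ∑ k ∈ monicPairs f, polyMu k.1 = 0 := by
  classical
  obtain ⟨P, hPm, hP, hPf⟩ := exists_monic_irreducible_factor f
    (fun h => h1 (hf.isUnit_iff.1 h))
  rw [← Finset.sum_filter_add_sum_filter_not _ fun k : F[X] × F[X] => P ∣ k.1]
  have h2 : ∑ k ∈ (monicPairs f).filter (fun k => P ∣ k.1), polyMu k.1 =
      ∑ k ∈ (monicPairs f).filter (fun k => ¬ P ∣ k.1), - polyMu k.1 := by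
    symm
    refine Finset.sum_bij_ne_zero (fun k _ _ => (P * k.1, k.2 / P)) ?_ ?_ ?_ ?_
    · intro k hk _
      obtain ⟨hk, hkP⟩ := Finset.mem_filter.1 hk
      obtain ⟨ha, hw, hk⟩ := mem_monicPairs.1 hk
      obtain ⟨w, hw'⟩ : P ∣ k.2 := ((hP.prime.dvd_or_dvd (hk ▸ hPf)).resolve_left hkP)
      refine Finset.mem_filter.2 ⟨mem_monicPairs.2 ⟨hPm.mul ha, ?_, ?_⟩, dvd_mul_right _ _⟩
      · rw [hw', mul_div_cancel_left₀ _ hP.ne_zero]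
        rw [hw'] at hw
        exact hPm.of_mul_monic_left hw
      · simp only
        rw [← hk, hw', mul_div_cancel_left₀ _ hP.ne_zero]
        ring
    · intro k hk _ k' hk' _ h
      have e := Prod.ext_iff.1 h
      have e1 : k.1 = k'.1 := mul_left_cancel₀ hP.ne_zero e.1
      have hk1 := (mem_monicPairs.1 (Finset.mem_filter.1 hk).1)
      have hk2 := (mem_monicPairs.1 (Finset.mem_filter.1 hk').1)
      refine Prod.ext e1 (mul_left_cancel₀ hk1.1.ne_zero ?_)
      rw [hk1.2.2, e1, hk2.2.2]
    · intro k hk h0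
      obtain ⟨hk, d, hd⟩ := Finset.mem_filter.1 hk
      obtain ⟨ha, hw, hk⟩ := mem_monicPairs.1 hk
      have hsq : Squarefree k.1 := by
        by_contra h
        exact h0 (polyMu_of_not_squarefree h)
      have hPd : ¬ P ∣ d := by
        rintro ⟨d', rfl⟩
        exact hP.not_isUnit (hsq P ⟨d', by rw [hd, mul_assoc]⟩)
      have hdm : d.Monic := hPm.of_mul_monic_left (hd ▸ ha)
      refine ⟨(d, P * k.2), Finset.mem_filter.2 ⟨mem_monicPairs.2 ⟨hdm, hPm.mul hw, ?_⟩, hPd⟩, ?_,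
          ?_⟩
      · simp only
        rw [← hk, hd]
        ring
      · simp only [ne_eq, neg_eq_zero]
        intro h
        apply h0
        rw [hd, polyMu_mul ((hP.coprime_iff_not_dvd).2 hPd), h, mul_zero]
      · refine Prod.ext hd.symm ?_
        simp only
        rw [mul_div_cancel_left₀ _ hP.ne_zero]
    · intro k hk _
      obtain ⟨hk, hkP⟩ := Finset.mem_filter.1 hk
      simp only
      rw [polyMu_mul ((hP.coprime_iff_not_dvd).2 hkP), polyMu_irreducible hP]
      ring
  rw [h2, Finset.sum_neg_distrib, neg_add_cancel]

end Moebius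

section CoordDegree

variable {E : Type*} [Field E] {B : Type*} [CommRing B] [Algebra E[X] B]
  {ι : Type*}

/-- All coordinates of `x` in the basis `b` have degree at most `w`. -/
def CoordDegLE (b : Module.Basis ι E[X] B) (x : B) (w : ℕ) : Prop :=
  ∀ i, (b.repr x i).natDegree ≤ w

theorem CoordDegLE.mono {b : Module.Basis ι E[X] B} {x : B} {w w' : ℕ} (h : CoordDegLE b x w)
    (hw : w ≤ w') : CoordDegLE b x w' := fun i => (h i).trans hw

theorem CoordDegLE.sum {b : Module.Basis ι E[X] B} {κ : Type*} {s : Finset κ} {f : κ → B} {w : ℕ}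
    (h : ∀ k ∈ s, CoordDegLE b (f k) w) : CoordDegLE b (∑ k ∈ s, f k) w := by
  intro i
  rw [map_sum, Finsupp.finsetSum_apply]
  exact natDegree_sum_le_of_forall_le _ _ fun k hk => h k hk i

theorem CoordDegLE.smul {b : Module.Basis ι E[X] B} {x : B} {w v : ℕ} (h : CoordDegLE b x w)
    {p : E[X]} (hp : p.natDegree ≤ v) : CoordDegLE b (p • x) (v + w) := by
  intro i
  rw [map_smul, Finsupp.smul_apply, smul_eq_mul]
  exact natDegree_mul_le.trans (add_le_add hp (h i))

theorem CoordDegLE.basis (b : Module.Basis ι E[X] B) (i : ι) : CoordDegLE b (b i) 0 := by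
  intro j
  classical
  rw [b.repr_self, Finsupp.single_apply]
  split_ifs <;> simp

theorem CoordDegLE.pow {b : Module.Basis ι E[X] B} {c : ℕ}
    (hc : ∀ x y w v, CoordDegLE b x w → CoordDegLE b y v → CoordDegLE b (x * y) (w + v + c))
    {x : B} {w : ℕ} (hx : CoordDegLE b x w) {n : ℕ} (hn : 1 ≤ n) :
    CoordDegLE b (x ^ n) (n * (w + c)) := by
  induction n, hn using Nat.le_induction with
  | base => simpa using hx.mono (by omega)
  | succ n hn ih =>
    rw [pow_succ]
    refine ((hc _ _ _ _ ih hx)).mono ?_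
    rw [add_mul]; omega

variable [Fintype ι]

theorem exists_coordDegLE (b : Module.Basis ι E[X] B) (x : B) : ∃ w, CoordDegLE b x w :=
  ⟨Finset.univ.sup fun i => (b.repr x i).natDegree, fun i =>
    Finset.le_sup (f := fun i => (b.repr x i).natDegree) (Finset.mem_univ i)⟩

theorem exists_coordDegLE_mul (b : Module.Basis ι E[X] B) :
    ∃ c, ∀ x y w v, CoordDegLE b x w → CoordDegLE b y v → CoordDegLE b (x * y) (w + v + c) := by
  choose f hf using fun p : ι × ι => exists_coordDegLE b (b p.1 * b p.2)
  refine ⟨Finset.univ.sup f, fun x y w v hx hy => ?_⟩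
  have key : x * y = ∑ i, ∑ j, (b.repr x i * b.repr y j) • (b i * b j) := by
    conv_lhs => rw [← b.sum_repr x, ← b.sum_repr y]
    rw [Finset.sum_mul_sum]
    simp_rw [smul_mul_smul_comm]
  rw [key]
  refine CoordDegLE.sum fun i _ => CoordDegLE.sum fun j _ => ?_
  refine CoordDegLE.smul ((hf (i, j)).mono (Finset.le_sup (Finset.mem_univ _))) ?_
  exact natDegree_mul_le.trans (add_le_add (hx i) (hy j))

theorem natDegree_norm_le {b : Module.Basis ι E[X] B} {c : ℕ}
    (hc : ∀ x y w v, CoordDegLE b x w → CoordDegLE b y v → CoordDegLE b (x * y) (w + v + c))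
    {x : B} {w : ℕ} (hx : CoordDegLE b x w) :
    (Algebra.norm E[X] x).natDegree ≤ Fintype.card ι * (w + c) := by
  classical
  rw [Algebra.norm_eq_matrix_det b, Matrix.det_apply]
  refine natDegree_sum_le_of_forall_le _ _ fun σ _ => ?_
  rw [Units.smul_def]
  refine (natDegree_smul_le _ _).trans ((natDegree_prod_le _ _).trans ?_)
  rw [← smul_eq_mul, ← Finset.card_univ]
  refine Finset.sum_le_card_nsmul _ _ _ fun i _ => ?_
  rw [Algebra.leftMulMatrix_eq_repr_mul]
  have := hc _ _ _ _ hx (CoordDegLE.basis b i)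
  simpa using this (σ i)

end CoordDegree

section ZeroCount

variable {E : Type*} [Field E] {B : Type*} [CommRing B] [IsDomain B] [Algebra E B] [Algebra E[X] B]
  [IsScalarTower E E[X] B] {ι : Type*} [Finite ι]

theorem finite_quotient_span_of_ne_zero (b : Module.Basis ι E[X] B) {G : B} (hG : G ≠ 0) :
    Module.Finite E (B ⧸ Ideal.span {G}) := by
  classical
  have := Fintype.ofFinite ι
  exact Module.Finite.equiv
    (Ideal.quotientEquivDirectSum E b (mt Ideal.span_singleton_eq_bot.1 hG)).symm

/-- The number of points of `B` at which a nonzero `G` vanishes is bounded by the degree of its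
norm. -/
theorem card_zeros_le_natDegree_norm (b : Module.Basis ι E[X] B) {K : Type*} [Field K] [Algebra E K]
    {G : B} (hG : G ≠ 0) (Z : Finset (B →ₐ[E] K)) (hZ : ∀ φ ∈ Z, φ G = 0) :
    Z.card ≤ (Algebra.norm E[X] G).natDegree := by
  rw [← finrank_quotient_span_eq_natDegree_norm (F := E) b hG]
  have hfin := finite_quotient_span_of_ne_zero b hG
  refine le_trans ?_ (card_algHom_le_finrank E (B ⧸ Ideal.span {G}) K)
  have hk : ∀ φ : Z, ∀ a ∈ Ideal.span {G}, φ.1 a = 0 := fun φ a ha => by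
    obtain ⟨c, rfl⟩ := Ideal.mem_span_singleton.1 ha
    rw [map_mul, hZ _ φ.2, zero_mul]
  rw [← Fintype.card_coe, ← Nat.card_eq_fintype_card]
  refine Nat.card_le_card_of_injective
    (fun φ : Z => Ideal.Quotient.liftₐ (Ideal.span {G}) φ.1 (hk φ)) fun φ ψ h => ?_
  refine Subtype.ext (AlgHom.ext fun x => ?_)
  exact congrArg (fun g => g (Ideal.Quotient.mk _ x)) h

/-- A nonzero element of a finite free `E[X]`-subalgebra of `E⟦X⟧` vanishes at the origin to order
at most the degree of its norm. -/
theorem le_natDegree_norm_of_X_pow_dvd (b : Module.Basis ι E[X] B) (j : B →ₐ[E[X]] PowerSeries E)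
    {s : B} (hs : s ≠ 0) {n : ℕ} (h : PowerSeries.X ^ n ∣ j s) :
    n ≤ (Algebra.norm E[X] s).natDegree := by
  rw [← finrank_quotient_span_eq_natDegree_norm (F := E) b hs]
  have hfin := finite_quotient_span_of_ne_zero b hs
  have hli : LinearIndependent E fun i : Fin n =>
      Ideal.Quotient.mk (Ideal.span {s}) (algebraMap E[X] B (X ^ (i : ℕ))) := by
    rw [Fintype.linearIndependent_iff]
    intro g hg i
    have h1 : Ideal.Quotient.mk (Ideal.span {s})
        (algebraMap E[X] B (∑ i : Fin n, g i • X ^ (i : ℕ))) = 0 := by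
      rw [← hg, map_sum, map_sum]
      refine Finset.sum_congr rfl fun i _ => ?_
      rw [← Ideal.Quotient.mkₐ_eq_mk E, ← IsScalarTower.coe_toAlgHom' E E[X] B, map_smul, map_smul]
    rw [Ideal.Quotient.eq_zero_iff_mem, Ideal.mem_span_singleton] at h1
    have h2 := h.trans (map_dvd j h1)
    rw [AlgHom.commutes] at h2
    have h3 := (PowerSeries.X_pow_dvd_iff.1 h2) i i.2
    rw [PowerSeries.algebraMap_apply'] at h3
    simpa [coeff_X_pow, Fin.val_inj, eq_comm] using h3
  simpa using hli.fintype_card_le_finrank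

end ZeroCount

section BombieriStepanov

/-- If no nontrivial constant combination of the `v k` vanishes to order `M`, a power of the
characteristic, then the `v k` are linearly independent over the `M`-th powers. -/
theorem eq_zero_of_sum_mul_pow_eq_zero {E : Type*} [Field E] {p : ℕ} [hp : Fact p.Prime]
    [CharP E p] {κ : Type*} [Fintype κ] {a : ℕ} {v w : κ → PowerSeries E}
    (hv : ∀ c : κ → E, PowerSeries.X ^ p ^ a ∣ ∑ k, PowerSeries.C (c k) * v k → c = 0)
    (hw : ∑ k, v k * w k ^ p ^ a = 0) : w = 0 := by
  have key : ∀ n k, PowerSeries.X ^ n ∣ w k := by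
    intro n
    induction n with
    | zero => simp
    | succ n ih =>
      choose u hu using ih
      have h1 : ∑ k, v k * u k ^ p ^ a = 0 := by
        have : (PowerSeries.X ^ n) ^ p ^ a * ∑ k, v k * u k ^ p ^ a = 0 := by
          rw [← hw, Finset.mul_sum]
          exact Finset.sum_congr rfl fun k _ => by rw [hu, mul_pow]; ring
        exact (mul_eq_zero.1 this).resolve_left (pow_ne_zero _ (pow_ne_zero _ PowerSeries.X_ne_zero))
      have hd : ∀ k, PowerSeries.X ∣ u k - PowerSeries.C (PowerSeries.constantCoeff (u k)) := by
        intro k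
        rw [PowerSeries.X_dvd_iff]; simp
      choose z hz using hd
      have hu2 : ∀ k, u k ^ p ^ a = PowerSeries.C ((PowerSeries.constantCoeff (u k)) ^ p ^ a)
          + PowerSeries.X ^ p ^ a * z k ^ p ^ a := by
        intro k
        have : CharP (PowerSeries E) p := charP_of_injective_ringHom PowerSeries.C_injective p
        rw [← mul_pow, ← hz k, map_pow, ← add_pow_char_pow]
        ring
      have h2 := hv (fun k => (PowerSeries.constantCoeff (u k)) ^ p ^ a) (by
        refine ⟨-∑ k, v k * z k ^ p ^ a, ?_⟩
        rw [mul_neg, Finset.mul_sum, ← sub_eq_zero, sub_neg_eq_add, ← Finset.sum_add_distrib, ← h1]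
        refine Finset.sum_congr rfl fun k _ => ?_
        rw [hu2]; ring)
      intro k
      have h3 : PowerSeries.constantCoeff (u k) = 0 := by
        have := congrFun h2 k
        simpa using eq_zero_of_pow_eq_zero this
      obtain ⟨y, hy⟩ := PowerSeries.X_dvd_iff.2 h3
      exact ⟨y, by rw [hu, hy]; ring⟩
  funext k
  ext n
  exact PowerSeries.X_pow_dvd_iff.1 (key (n + 1) k) n (Nat.lt_succ_self n)

end BombieriStepanov

section BombieriStepanov

variable {E : Type*} [Field E] {B : Type*} [CommRing B] [Algebra E B] [Algebra E[X] B]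
  [IsScalarTower E E[X] B] {ι : Type*} [Fintype ι]

/-- Vectors of coordinate degree at most `D` satisfy no more than `card ι * (D + 1)` linear
conditions, so a longer family of them has a nontrivial relation. -/
theorem exists_relation_of_coordDegLE (b : Module.Basis ι E[X] B) {κ : Type*} [Fintype κ]
    (f : κ → B) {D : ℕ} (hf : ∀ k, CoordDegLE b (f k) D)
    (hD : Fintype.card ι * (D + 1) < Fintype.card κ) :
    ∃ c : κ → E, c ≠ 0 ∧ ∑ k, c k • f k = 0 := by
  classical
  let T : (κ → E) →ₗ[E] (ι × Fin (D + 1) → E) :=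
    (LinearMap.pi fun q : ι × Fin (D + 1) =>
      (Polynomial.lcoeff E (q.2 : ℕ)) ∘ₗ ((b.coord q.1).restrictScalars E)) ∘ₗ
      Fintype.linearCombination E f
  have hker : LinearMap.ker T ≠ ⊥ := LinearMap.ker_ne_bot_of_finrank_lt (by simpa using hD)
  obtain ⟨c, hc, hc0⟩ := (Submodule.ne_bot_iff _).1 hker
  refine ⟨c, hc0, ?_⟩
  have hdeg : CoordDegLE b (∑ k, c k • f k) D := CoordDegLE.sum fun k _ => by
    rw [← algebraMap_smul E[X] (c k)]
    simpa using (hf k).smul (p := algebraMap E E[X] (c k)) (v := 0) (by simp)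
  rw [← b.repr.map_eq_zero_iff]
  ext i n
  by_cases hn : n ≤ D
  · have := congrFun hc (i, ⟨n, Nat.lt_succ_of_le hn⟩)
    simpa [T, Fintype.linearCombination_apply, ← algebraMap_smul E[X] (c _)] using this
  · rw [Finsupp.zero_apply, coeff_zero]
    exact coeff_eq_zero_of_natDegree_lt ((hdeg i).trans_lt (not_le.1 hn))

theorem linearIndependent_X_pow_smul (b : Module.Basis ι E[X] B) (n : ℕ) :
    LinearIndependent E fun k : ι × Fin n => (X ^ (k.2 : ℕ) : E[X]) • b k.1 := by
  classical
  rw [Fintype.linearIndependent_iff]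
  intro e he k
  have h1 := congrArg (fun x => (b.repr x k.1).coeff k.2) he
  simp only [← algebraMap_smul E[X] (e _), map_sum, map_smul, b.repr_self, Finsupp.finsetSum_apply,
    Finsupp.smul_apply, Finsupp.single_apply, finsetSum_coeff, smul_eq_mul, algebraMap_eq,
    mul_ite, mul_one, mul_zero, map_zero, Finsupp.zero_apply, coeff_zero] at h1
  rw [← h1, Finset.sum_eq_single k]
  · simp
  · intro u _ hu
    by_cases h : u.1 = k.1
    · have : (k.2 : ℕ) ≠ u.2 := fun h' => hu (Prod.ext h (Fin.ext h'.symm))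
      simp [h, coeff_X_pow, this]
    · simp [h]
  · simp

variable [IsDomain B]

/-- The auxiliary function in the Bombieri–Stepanov method. -/
theorem exists_auxiliary_function {p : ℕ} [Fact p.Prime] [CharP E p] (b : Module.Basis ι E[X] B)
    (j : B →ₐ[E[X]] PowerSeries E) (hj : Function.Injective j) (σ : B →ₐ[E[X]] B)
    {c₁ c₂ : ℕ}
    (hc₁ : ∀ x y w v, CoordDegLE b x w → CoordDegLE b y v → CoordDegLE b (x * y) (w + v + c₁))
    (hc₂ : ∀ i, CoordDegLE b (σ (b i)) c₂) {a l t : ℕ} (hE : ∀ x : E, x ^ p ^ a = x)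
    (hl : Fintype.card ι * (l + c₁) < p ^ a)
    (ht : p ^ a * (l + c₁) + c₂ + t + c₁ + 1 < Fintype.card ι * (l + 1) * t)
    {K : Type*} [Field K] [Algebra E K] :
    ∃ G : B, G ≠ 0 ∧ CoordDegLE b G (l + p ^ a * (t + c₁) + c₁) ∧
      ∀ φ : B →ₐ[E] K, (∀ x, φ x ^ (p ^ a * p ^ a) = φ (σ x)) → φ G = 0 := by
  classical
  have hM : 1 ≤ p ^ a := Nat.one_le_pow _ _ (Fact.out : p.Prime).pos
  have hcharB : CharP B p := charP_of_injective_algebraMap (algebraMap E B).injective p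
  have hcharK : CharP K p := charP_of_injective_algebraMap (algebraMap E K).injective p
  set M := p ^ a with hMdef
  have hι : 0 < Fintype.card ι := by
    by_contra h
    simp [Nat.eq_zero_of_not_pos h] at ht
  let m₁ : ι × Fin (l + 1) → B := fun k => (X ^ (k.2 : ℕ) : E[X]) • b k.1
  let m₂ : ι × Fin t → B := fun k => (X ^ (k.2 : ℕ) : E[X]) • b k.1
  have hm₁ : ∀ k, CoordDegLE b (m₁ k) l := fun k => by
    simpa using ((CoordDegLE.basis b k.1).smul (p := X ^ (k.2 : ℕ)) (v := l)
      (by rw [natDegree_X_pow]; omega))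
  have hm₂ : ∀ k, CoordDegLE b (m₂ k) t := fun k => by
    simpa using ((CoordDegLE.basis b k.1).smul (p := X ^ (k.2 : ℕ)) (v := t)
      (by rw [natDegree_X_pow]; omega))
  have hσ : ∀ k, CoordDegLE b (σ (m₂ k)) (t + c₂) := fun k => by
    simp only [m₂, map_smul]
    exact (hc₂ _).smul (by rw [natDegree_X_pow]; omega)
  obtain ⟨c, hc0, hc⟩ := exists_relation_of_coordDegLE b
    (fun k : (ι × Fin (l + 1)) × (ι × Fin t) => m₁ k.1 ^ M * σ (m₂ k.2))
    (D := M * (l + c₁) + (t + c₂) + c₁)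
    (fun k => hc₁ _ _ _ _ (CoordDegLE.pow hc₁ (hm₁ _) hM) (hσ _)) (by
      simp only [Fintype.card_prod, Fintype.card_fin]
      have := Nat.mul_lt_mul_of_pos_left ht hι
      calc _ = Fintype.card ι * (M * (l + c₁) + c₂ + t + c₁ + 1) := by ring
        _ < _ := this
        _ = _ := by ring)
  let w : ι × Fin (l + 1) → B := fun k => ∑ u, c (k, u) • m₂ u
  have hwM : ∀ k, w k ^ M = ∑ u, c (k, u) • m₂ u ^ M := fun k => by
    rw [hMdef, sum_pow_char_pow]
    refine Finset.sum_congr rfl fun u _ => ?_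
    rw [_root_.smul_pow, ← hMdef, hE]
  refine ⟨∑ k, m₁ k * w k ^ M, fun h0 => hc0 ?_, ?_, ?_⟩
  · have hw : (fun k => j (w k)) = 0 := by
      refine eq_zero_of_sum_mul_pow_eq_zero (p := p) (a := a) (v := fun k => j (m₁ k))
        (fun e he => ?_) ?_
      · by_contra hne
        have hs : j (∑ k, (C (e k) : E[X]) • m₁ k) = ∑ k, PowerSeries.C (e k) * j (m₁ k) := by
          rw [map_sum]
          refine Finset.sum_congr rfl fun k _ => ?_
          rw [map_smul, Algebra.smul_def, PowerSeries.algebraMap_apply']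
          simp
        rw [← hs] at he
        have hs0 : ∑ k, (C (e k) : E[X]) • m₁ k ≠ 0 := by
          refine fun h => hne (funext fun k => ?_)
          refine Fintype.linearIndependent_iff.1 (linearIndependent_X_pow_smul b (l + 1)) e ?_ k
          rw [← h]
          exact Finset.sum_congr rfl fun k _ => by rw [← algebraMap_smul E[X] (e k)]; rfl
        have h1 := le_natDegree_norm_of_X_pow_dvd b j hs0 he
        have h2 := natDegree_norm_le hc₁ (x := ∑ k, (C (e k) : E[X]) • m₁ k) (w := l)
          (CoordDegLE.sum fun k _ => by
            simpa using (hm₁ k).smul (p := C (e k)) (v := 0) (by simp))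
        omega
      · rw [← map_zero j, ← h0, map_sum]
        exact Finset.sum_congr rfl fun k _ => by rw [map_mul, map_pow]
    funext k
    refine Fintype.linearIndependent_iff.1 (linearIndependent_X_pow_smul b t)
      (fun u => c (k.1, u)) (hj ?_) k.2
    rw [map_zero]
    exact congrFun hw k.1
  · refine CoordDegLE.sum fun k _ => ?_
    refine hc₁ _ _ _ _ (hm₁ k) (CoordDegLE.pow hc₁ (CoordDegLE.sum fun u _ => ?_) hM)
    rw [← algebraMap_smul E[X] (c (k, u))]
    simpa using (hm₂ u).smul (p := algebraMap E E[X] (c (k, u))) (v := 0) (by simp)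
  · intro φ hφ
    refine eq_zero_of_pow_eq_zero (n := M) ?_
    rw [← map_zero φ, ← (Fintype.sum_prod_type _).symm.trans hc, ← map_pow,
      hMdef, sum_pow_char_pow, ← hMdef, map_sum, map_sum]
    refine Finset.sum_congr rfl fun k _ => ?_
    rw [mul_pow, hwM, hMdef, sum_pow_char_pow, ← hMdef, Finset.mul_sum, map_sum, map_sum]
    refine Finset.sum_congr rfl fun u _ => ?_
    have hcu : (c (k, u) • m₂ u ^ M) ^ M = c (k, u) • m₂ u ^ (M * M) := by
      rw [_root_.smul_pow, hE, ← pow_mul]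
    rw [hcu, mul_smul_comm, map_smul, map_smul, map_mul, map_mul, map_pow _ (m₂ u), hφ]

end BombieriStepanov

section BombieriStepanov

variable {E : Type*} [Field E] {B : Type*} [CommRing B] [Algebra E B] [Algebra E[X] B]
  [IsScalarTower E E[X] B] {ι : Type*} [Fintype ι] [IsDomain B]

/-- **Bombieri–Stepanov bound.** A curve `B` over `E` with a formal point at the origin has at most
`Q + O(Q ^ (3 / 4))` points on which the `Q`-Frobenius acts as `σ`. -/
theorem exists_card_frobenius_points_le {p : ℕ} [hp : Fact p.Prime] [CharP E p]
    (b : Module.Basis ι E[X] B) (j : B →ₐ[E[X]] PowerSeries E) (hj : Function.Injective j)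
    (σ : B →ₐ[E[X]] B) (K : Type*) [Field K] [Algebra E K] :
    ∃ C N : ℕ, ∀ a, N ≤ p ^ a → (∀ x : E, x ^ p ^ a = x) → ∀ Z : Finset (B →ₐ[E] K),
      (∀ φ ∈ Z, ∀ x, φ x ^ (p ^ a) ^ 4 = φ (σ x)) → Z.card ≤ (p ^ a) ^ 4 + C * (p ^ a) ^ 3 := by
  obtain ⟨c₁, hc₁⟩ := exists_coordDegLE_mul b
  choose f hf using fun i => exists_coordDegLE b (σ (b i))
  set c₂ := Finset.univ.sup f
  have hc₂ : ∀ i, CoordDegLE b (σ (b i)) c₂ := fun i =>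
    (hf i).mono (Finset.le_sup (Finset.mem_univ i))
  set r := Fintype.card ι with hr
  have hr0 : 0 < r := by
    have : Nonempty ι := b.index_nonempty
    exact Fintype.card_pos
  set d := c₂ + c₁ + 2 with hd
  refine ⟨c₁ + d + 2 * r + 3 * r * c₁, r * (c₁ + 1) + 1, fun a ha hE Z hZ => ?_⟩
  have hl1 : 1 ≤ p ^ a := Nat.one_le_pow _ _ hp.out.pos
  have hsq : p ^ (2 * a) = (p ^ a) ^ 2 := by rw [mul_comm, pow_mul]
  set l := p ^ a with hl
  obtain ⟨t, ht1, ht2⟩ : ∃ t, l ^ 2 + c₁ * l + d + 1 ≤ r * t ∧ r * t ≤ l ^ 2 + c₁ * l + d + r :=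
    ⟨(l ^ 2 + c₁ * l + d) / r + 1, Nat.lt_mul_div_succ _ hr0, by
      rw [mul_add, mul_one]; exact Nat.add_le_add_right (Nat.mul_div_le _ _) _⟩
  obtain ⟨G, hG0, hG, hGφ⟩ := exists_auxiliary_function (a := 2 * a) (l := l) (t := t) b j hj σ hc₁
    hc₂ (fun x => by rw [hsq, sq, pow_mul, hE, hE]) (by
      rw [hsq, ← hr]
      have h1 := Nat.mul_le_mul_left l ha
      have h2 : r * c₁ ≤ l * (r * c₁) := Nat.le_mul_of_pos_left _ hl1
      nlinarith) (by
      rw [hsq, ← hr]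
      have h1 := Nat.mul_le_mul_left l ht1
      have h2 : t ≤ r * t := Nat.le_mul_of_pos_left _ hr0
      nlinarith) (K := K)
  have h1 := card_zeros_le_natDegree_norm b hG0 Z fun φ hφ => hGφ φ fun x => by
    rw [← hZ φ hφ x, hsq]; ring_nf
  have h2 := natDegree_norm_le hc₁ hG
  rw [hsq, ← hr] at h2
  refine h1.trans (h2.trans ?_)
  have h3 := Nat.mul_le_mul_left (l ^ 2) ht2
  have h4 : l ^ 2 ≤ l ^ 3 := Nat.pow_le_pow_right hl1 (by norm_num)
  have h5 : l ≤ l ^ 3 := Nat.le_self_pow (by norm_num) _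
  have h6 : 1 ≤ l ^ 3 := Nat.one_le_pow _ _ hl1
  have e1 := Nat.mul_le_mul_left (d + r) h4
  have e2 := Nat.mul_le_mul_left r h5
  have e3 := Nat.mul_le_mul_left (r * c₁) h4
  have e4 := Nat.mul_le_mul_left (2 * r * c₁) h6
  nlinarith

end BombieriStepanov

section Points

/-- A nonzero finite free algebra over `E[X]` has a point over every element of an algebraically
closed field. -/
theorem exists_algHom_over {E : Type*} [Field E] {B : Type*} [CommRing B] [Algebra E B]
    [Algebra E[X] B] [IsScalarTower E E[X] B] [Nontrivial B] [Module.Finite E[X] B]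
    [Module.Free E[X] B] {K : Type*} [Field K] [Algebra E K] [IsAlgClosed K] (x : K) :
    ∃ φ : B →ₐ[E] K, ∀ f : E[X], φ (algebraMap E[X] B f) = aeval x f := by
  let : Algebra E[X] K := (aeval x : E[X] →ₐ[E] K).toRingHom.toAlgebra
  have : Nontrivial (TensorProduct E[X] K B) := by
    rw [← Module.finrank_pos_iff (R := K), Module.finrank_baseChange]
    exact Module.finrank_pos
  obtain ⟨m, hm⟩ := Ideal.exists_maximal (TensorProduct E[X] K B)
  let : Field (TensorProduct E[X] K B ⧸ m) := Ideal.Quotient.field m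
  have : Module.Finite K (TensorProduct E[X] K B ⧸ m) := inferInstance
  let e := RingEquiv.ofBijective _
    (IsAlgClosed.algebraMap_bijective_of_isIntegral (k := K) (K := TensorProduct E[X] K B ⧸ m))
  let ψ : B →+* TensorProduct E[X] K B ⧸ m :=
    (Ideal.Quotient.mk m).comp
      (Algebra.TensorProduct.includeRight : B →ₐ[E[X]] TensorProduct E[X] K B).toRingHom
  have hψ : ∀ f : E[X], ψ (algebraMap E[X] B f) = e (aeval x f) := by
    intro f
    have h1 : (Algebra.TensorProduct.includeRight : B →ₐ[E[X]] TensorProduct E[X] K B)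
        (algebraMap E[X] B f) = algebraMap K _ (aeval x f) := by
      rw [AlgHom.commutes]
      exact IsScalarTower.algebraMap_apply E[X] K _ f
    change Ideal.Quotient.mk m _ = _
    exact congrArg (Ideal.Quotient.mk m) h1
  have hφ : ∀ f : E[X], (e.symm.toRingHom.comp ψ) (algebraMap E[X] B f) = aeval x f := fun f => by
    change e.symm (ψ _) = _
    rw [hψ, e.symm_apply_apply]
  refine ⟨{ e.symm.toRingHom.comp ψ with commutes' := fun c => ?_ }, hφ⟩
  have := hφ (C c)
  rw [aeval_C] at this
  rw [← this, IsScalarTower.algebraMap_apply E E[X] B]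
  rfl

end Points

section Lang

variable {E : Type*} [Field E] {d : Type*} [Fintype d] [DecidableEq d]

/-- Coefficients of the solution of `Y(X ^ q) = Θ Y` with `Y 0 = 1`. -/
noncomputable def langCoeff (Θ : ℕ → Matrix d d E) (q : ℕ) : ℕ → Matrix d d E
  | 0 => 1
  | n + 1 => (if h : 2 ≤ q ∧ q ∣ n + 1 then langCoeff Θ q ((n + 1) / q) else 0) -
      ∑ i : Fin (n + 1), Θ (n + 1 - i) * langCoeff Θ q i
  decreasing_by
    · exact Nat.div_lt_self (Nat.succ_pos n) h.1
    · exact i.2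

theorem exists_lang_solution (Θ : Matrix d d E[X]) (hΘ : ∀ i j, (Θ i j).coeff 0 =
    (1 : Matrix d d E) i j)
    {p a : ℕ} [hp : Fact p.Prime] [CharP E p] (ha : 2 ≤ p ^ a) (hE : ∀ x : E, x ^ p ^ a = x) :
    ∃ Y : Matrix d d (PowerSeries E),
      (∀ i j, PowerSeries.constantCoeff (Y i j) = (1 : Matrix d d E) i j) ∧
      ∀ i j, Y i j ^ p ^ a = ∑ l, (Θ i l : PowerSeries E) * Y l j := by
  set T : ℕ → Matrix d d E := fun n => Matrix.of fun i j => (Θ i j).coeff n with hT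
  have hT0 : T 0 = 1 := Matrix.ext hΘ
  set c := langCoeff T (p ^ a) with hc
  refine ⟨fun i j => PowerSeries.mk fun n => c n i j, fun i j => ?_, fun i j => ?_⟩
  · rw [← PowerSeries.coeff_zero_eq_constantCoeff_apply, PowerSeries.coeff_mk, hc, langCoeff]
  · have hpow : ∀ f : PowerSeries E, f ^ p ^ a = PowerSeries.expand (p ^ a) (by omega) f := by
      intro f
      have h1 : iterateFrobenius E p a = RingHom.id E := RingHom.ext fun x => by
        rw [iterateFrobenius_def, hE, RingHom.id_apply]
      have h2 := MvPowerSeries.map_iterateFrobenius_expand p hp.out.ne_zero f a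
      rw [h1, MvPowerSeries.map_id] at h2
      exact h2.symm
    have hmul : ∀ n, PowerSeries.coeff n
        (∑ l, (Θ i l : PowerSeries E) * PowerSeries.mk (fun n => c n l j)) =
        ∑ m ∈ Finset.range (n + 1), (T (n - m) * c m) i j := fun n => by
      rw [map_sum]
      simp_rw [PowerSeries.coeff_mul, PowerSeries.coeff_mk, Polynomial.coeff_coe]
      rw [Finset.sum_comm, ← Finset.Nat.sum_antidiagonal_swap,
        Finset.Nat.sum_antidiagonal_eq_sum_range_succ_mk]
      rfl
    rw [hpow]
    ext n
    rw [hmul, PowerSeries.coeff_expand, PowerSeries.coeff_mk]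
    rcases n with _ | n
    · simp [hc, langCoeff, hT0]
    · have hrec : c (n + 1) = (if h : 2 ≤ p ^ a ∧ p ^ a ∣ n + 1 then c ((n + 1) / p ^ a) else 0) -
          ∑ i : Fin (n + 1), T (n + 1 - i) * c i := by rw [hc, langCoeff]
      rw [Finset.sum_range_succ, Nat.sub_self, hT0, one_mul, hrec, Matrix.sub_apply,
        Matrix.sum_apply, Finset.sum_range (fun m => (T (n + 1 - m) * c m) i j)]
      by_cases h : p ^ a ∣ n + 1 <;> simp [h, ha]

end Lang

section Integrality

/-- If the iterated `q`-th powers of `y` stay in a finitely generated module, `y` is integral. -/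
theorem isIntegral_of_pow_pow_mem {R A : Type*} [CommRing R] [IsNoetherianRing R] [CommRing A]
    [Algebra R A] {W : Submodule R A} (hW : W.FG) {y : A} {q : ℕ} (hq : 2 ≤ q)
    (h : ∀ t, y ^ q ^ t ∈ W) : IsIntegral R y := by
  nontriviality R
  have : Module.Finite R W := Module.Finite.iff_fg.2 hW
  let w : ℕ → W := fun t => ⟨y ^ q ^ t, h t⟩
  let f : ℕ →o Submodule R W :=
    ⟨fun t => Submodule.span R (w '' (Finset.range t : Set ℕ)), fun s t hst =>
      Submodule.span_mono (Set.image_mono (by simpa using hst))⟩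
  obtain ⟨T, hT⟩ := monotone_stabilizes_iff_noetherian.2 (inferInstance : IsNoetherian R W) f
  have h1 : w T ∈ f T := by
    rw [hT (T + 1) (Nat.le_succ T)]
    exact Submodule.subset_span ⟨T, by simp, rfl⟩
  obtain ⟨c, hc⟩ := Submodule.mem_span_image_finset_iff_exists_fun R |>.1 h1
  have h2 : ∑ s ∈ (Finset.range T).attach, c s • y ^ q ^ (s : ℕ) = y ^ q ^ T := by
    have := congrArg (Subtype.val) hc
    simpa [w, ← Finset.attach_eq_univ] using this
  refine ⟨X ^ q ^ T - ∑ s ∈ (Finset.range T).attach, C (c s) * X ^ q ^ (s : ℕ),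
    monic_X_pow_sub ?_, ?_⟩
  · refine (degree_sum_le _ _).trans_lt ((Finset.sup_lt_iff (WithBot.bot_lt_coe _)).2 fun s _ => ?_)
    refine (degree_C_mul_X_pow_le _ _).trans_lt ?_
    exact_mod_cast Nat.pow_lt_pow_right (by omega) (Finset.mem_range.1 s.2)
  · simp [eval₂_finsetSum, ← h2, Algebra.smul_def]

variable {R A : Type*} [CommRing R] [CommRing A] [Algebra R A] {d : Type*} [Fintype d]

theorem finite_adjoin_of_lang [IsNoetherianRing R] {p a : ℕ} [hp : Fact p.Prime] [CharP A p] (ha : 2 ≤ p ^ a) (Θ : Matrix d d R) (Y : Matrix d d A)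
    (hY : ∀ i j, Y i j ^ p ^ a = ∑ l, Θ i l • Y l j) :
    Module.Finite R (Algebra.adjoin R (Set.range fun k : d × d => Y k.1 k.2)) := by
  refine Module.Finite.iff_fg.2 (fg_adjoin_of_finite (Set.finite_range _) ?_)
  have key : ∀ t i j, Y i j ^ (p ^ a) ^ t ∈
      Submodule.span R (Set.range fun k : d × d => Y k.1 k.2) := by
    intro t
    induction t with
    | zero => exact fun i j => Submodule.subset_span ⟨(i, j), by simp⟩
    | succ t ih =>
      intro i j
      rw [pow_succ', pow_mul, hY, ← pow_mul, sum_pow_char_pow]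
      refine Submodule.sum_mem _ fun l _ => ?_
      rw [_root_.smul_pow]
      refine Submodule.smul_mem _ _ ?_
      rw [pow_mul]
      exact ih l j
  rintro _ ⟨k, rfl⟩
  exact isIntegral_of_pow_pow_mem (Submodule.fg_span (Set.finite_range _)) ha
    fun t => key t k.1 k.2

end Integrality

section LangTorsor

theorem exists_lift_or_relation {R B d : Type*} [CommRing R] [CommRing B] [Algebra R B]
    {y : Matrix d d B} (hgen : Algebra.adjoin R (Set.range fun k : d × d => y k.1 k.2) = ⊤)
    (z : Matrix d d B) :
    (∃ σ : B →ₐ[R] B, ∀ i j, σ (y i j) = z i j) ∨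
    ∃ P : MvPolynomial (d × d) R, MvPolynomial.aeval (fun k => y k.1 k.2) P = 0 ∧
      MvPolynomial.aeval (fun k => z k.1 k.2) P ≠ 0 := by
  by_contra! h
  obtain ⟨h1, h2⟩ := h
  have hsurj : Function.Surjective (MvPolynomial.aeval (R := R) fun k : d × d => y k.1 k.2) := by
    rw [← AlgHom.range_eq_top, ← Algebra.adjoin_range_eq_range_aeval, hgen]
  obtain ⟨i, j, hij⟩ := h1 (AlgHom.liftOfSurjective _ hsurj
    (MvPolynomial.aeval (R := R) fun k : d × d => z k.1 k.2) fun P hP => h2 P hP)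
  refine hij ?_
  have := AlgHom.liftOfSurjective_apply _ hsurj
    (MvPolynomial.aeval (R := R) fun k : d × d => z k.1 k.2) (fun P hP => h2 P hP)
    (MvPolynomial.X (i, j))
  simpa using this

/-- The product `Θ (x ^ q ^ (n - 1)) ⋯ Θ (x ^ q) Θ x`. -/
noncomputable def frobProd {E K d : Type*} [CommRing E] [CommRing K] [Algebra E K] [Fintype d]
    [DecidableEq d] (Θ : Matrix d d E[X]) (q : ℕ) (x : K) : ℕ → Matrix d d K
  | 0 => 1
  | n + 1 => Θ.map (aeval (x ^ q ^ n)) * frobProd Θ q x n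

variable {E : Type*} [Field E] {K : Type*} [Field K] [Algebra E K] {d : Type*} [Fintype d]
  [DecidableEq d]

variable {B : Type*} [CommRing B] [Algebra E B] [Algebra E[X] B]
  {Θ : Matrix d d E[X]} {y : Matrix d d B} {p a : ℕ} [hp : Fact p.Prime] [CharP E p] {n : ℕ}
  {x : K} {φ : B →ₐ[E] K}

theorem pow_pow_eq_self {M : Type*} [Monoid M] {x : M} {q : ℕ} (h : x ^ q = x) (n : ℕ) :
    x ^ q ^ n = x := by
  induction n with
  | zero => simp
  | succ n ih => rw [pow_succ, pow_mul, ih, h]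

theorem aeval_pow_frobenius (hE : ∀ c : E, c ^ p ^ a = c) (n : ℕ) (x : K) (f : E[X]) :
    aeval x f ^ (p ^ a) ^ n = aeval (x ^ (p ^ a) ^ n) f := by
  have hcharK : CharP K p := charP_of_injective_algebraMap (algebraMap E K).injective p
  rw [← pow_mul p, ← iterateFrobenius_def, ← iterateFrobenius_def, aeval_def, aeval_def, hom_eval₂]
  congr 1
  ext c
  rw [RingHom.comp_apply, iterateFrobenius_def, ← map_pow, pow_mul, pow_pow_eq_self (hE c)]

theorem point_pow_eq (hE : ∀ c : E, c ^ p ^ a = c)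
    (hy : ∀ i j, y i j ^ p ^ a = ∑ l, Θ i l • y l j)
    (hφ : ∀ f : E[X], φ (algebraMap E[X] B f) = aeval x f) (n : ℕ) (i j : d) :
    φ (y i j) ^ (p ^ a) ^ n = ∑ l, frobProd Θ (p ^ a) x n i l * φ (y l j) := by
  have hcharK : CharP K p := charP_of_injective_algebraMap (algebraMap E K).injective p
  induction n generalizing i j with
  | zero => simp [frobProd, Matrix.one_apply]
  | succ n ih =>
    rw [pow_succ', pow_mul, ← map_pow, hy, map_sum, ← pow_mul, sum_pow_char_pow, pow_mul]
    simp_rw [Algebra.smul_def, map_mul, hφ, mul_pow, ih, aeval_pow_frobenius hE]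
    simp_rw [frobProd, Matrix.mul_apply, Matrix.map_apply, Finset.mul_sum, Finset.sum_mul]
    rw [Finset.sum_comm]
    simp_rw [mul_assoc]

theorem point_pow_eq_of_class [IsScalarTower E E[X] B] (hE : ∀ c : E, c ^ p ^ a = c)
    (hy : ∀ i j, y i j ^ p ^ a = ∑ l, Θ i l • y l j)
    (hgen : Algebra.adjoin E[X] (Set.range fun k : d × d => y k.1 k.2) = ⊤)
    (hφ : ∀ f : E[X], φ (algebraMap E[X] B f) = aeval x f) {A : Matrix d d E}
    (hx : x ^ (p ^ a) ^ n = x) (hA : frobProd Θ (p ^ a) x n = A.map (algebraMap E K))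
    {σ : B →ₐ[E[X]] B} (hσ : ∀ i j, σ (y i j) = ∑ l, A i l • y l j) (b : B) :
    φ b ^ (p ^ a) ^ n = φ (σ b) := by
  have hcharK : CharP K p := charP_of_injective_algebraMap (algebraMap E K).injective p
  have hb : b ∈ Algebra.adjoin E[X] (Set.range fun k : d × d => y k.1 k.2) := hgen ▸ Algebra.mem_top
  induction hb using Algebra.adjoin_induction with
  | mem b hb =>
    obtain ⟨k, rfl⟩ := hb
    rw [point_pow_eq hE hy hφ, hA, hσ, map_sum]
    simp [Algebra.smul_def]
  | algebraMap f => rw [AlgHom.commutes, hφ, aeval_pow_frobenius hE, hx]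
  | add b c _ _ hb hc =>
    rw [map_add, map_add, map_add, ← hb, ← hc, ← pow_mul, add_pow_char_pow]
  | mul b c _ _ hb hc => rw [map_mul, map_mul, map_mul, mul_pow, hb, hc]

theorem point_twist_eq_zero [IsScalarTower E E[X] B] (hE : ∀ c : E, c ^ p ^ a = c)
    (hy : ∀ i j, y i j ^ p ^ a = ∑ l, Θ i l • y l j)
    (hφ : ∀ f : E[X], φ (algebraMap E[X] B f) = aeval x f) {A : Matrix d d E}
    (hx : x ^ (p ^ a) ^ n = x) (hA : frobProd Θ (p ^ a) x n = A.map (algebraMap E K))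
    {P : MvPolynomial (d × d) E[X]} (hP : MvPolynomial.aeval (fun k => y k.1 k.2) P = 0) :
    φ (MvPolynomial.aeval (fun k : d × d => ∑ l, A k.1 l • y l k.2) P) = 0 := by
  have hcharK : CharP K p := charP_of_injective_algebraMap (algebraMap E K).injective p
  have h1 : iterateFrobenius K p (a * n) (φ (MvPolynomial.aeval (fun k => y k.1 k.2) P)) = 0 := by
    rw [hP, map_zero, map_zero]
  rw [← h1, MvPolynomial.aeval_def, MvPolynomial.aeval_def, ← AlgHom.coe_toRingHom,
    MvPolynomial.hom_eval₂, MvPolynomial.hom_eval₂, MvPolynomial.hom_eval₂]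
  refine congrArg₂ (fun f g => MvPolynomial.eval₂ f g P) (RingHom.ext fun f => ?_)
    (funext fun k => ?_)
  · change φ _ = iterateFrobenius K p (a * n) (φ _)
    rw [hφ, iterateFrobenius_def, pow_mul, aeval_pow_frobenius hE, hx]
  · change φ _ = iterateFrobenius K p (a * n) (φ _)
    rw [iterateFrobenius_def, pow_mul, point_pow_eq hE hy hφ, hA]
    simp [Algebra.smul_def]

end LangTorsor

section LangTorsor

variable {E : Type*} [Field E] {K : Type*} [Field K] [Algebra E K] [IsAlgClosed K] {d : Type*}
  [Fintype d] [DecidableEq d] {B : Type*} [CommRing B] [IsDomain B] [Algebra E B] [Algebra E[X] B]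
  [IsScalarTower E E[X] B] [Module.Finite E[X] B] [Module.Free E[X] B]
  {Θ : Matrix d d E[X]} {y : Matrix d d B} {p a : ℕ} [hp : Fact p.Prime] [CharP E p]

theorem exists_card_class_le_of_relation (hE : ∀ c : E, c ^ p ^ a = c)
    (hy : ∀ i j, y i j ^ p ^ a = ∑ l, Θ i l • y l j) {A : Matrix d d E}
    {P : MvPolynomial (d × d) E[X]} (hP : MvPolynomial.aeval (fun k => y k.1 k.2) P = 0)
    (hP' : MvPolynomial.aeval (fun k : d × d => ∑ l, A k.1 l • y l k.2) P ≠ 0) :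
    ∃ C : ℕ, ∀ n, ∀ S : Finset K, (∀ x ∈ S, x ^ (p ^ a) ^ n = x ∧
      frobProd Θ (p ^ a) x n = A.map (algebraMap E K)) → S.card ≤ C := by
  classical
  let b := Module.Free.chooseBasis E[X] B
  refine ⟨(Algebra.norm E[X] (MvPolynomial.aeval
    (fun k : d × d => ∑ l, A k.1 l • y l k.2) P)).natDegree, fun n S hS => ?_⟩
  choose φ hφ using fun x : K => exists_algHom_over (E := E) (B := B) x
  have hinj : Function.Injective φ := fun x x' h => by
    have h1 := hφ x X
    rw [h, hφ x' X] at h1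
    simpa using h1.symm
  rw [← Finset.card_image_of_injective S hinj]
  refine card_zeros_le_natDegree_norm b hP' _ fun ψ hψ => ?_
  obtain ⟨x, hx, rfl⟩ := Finset.mem_image.1 hψ
  exact point_twist_eq_zero hE hy (hφ x) (hS x hx).1 (hS x hx).2 hP

theorem exists_card_class_le_of_automorphism {𝒢 : Type*} [CommGroup 𝒢] (H : Subgroup 𝒢) [Finite H]
    (ρ : 𝒢 →* Matrix d d E) (hρ : Function.Injective ρ) (hE : ∀ c : E, c ^ p ^ a = c)
    (hy : ∀ i j, y i j ^ p ^ a = ∑ l, Θ i l • y l j)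
    (hgen : Algebra.adjoin E[X] (Set.range fun k : d × d => y k.1 k.2) = ⊤) (hdet : y.det ≠ 0)
    (j : B →ₐ[E[X]] PowerSeries E) (hj : Function.Injective j)
    (σ : 𝒢 → B →ₐ[E[X]] B) (hσ : ∀ g ∈ H, ∀ i j, σ g (y i j) = ∑ l, ρ g i l • y l j)
    {g : 𝒢} (hg : g ∈ H) :
    ∃ C N : ℕ, ∀ s, N ≤ (p ^ a) ^ s → ∀ S : Finset K, (∀ x ∈ S, x ^ (p ^ a) ^ (s * 4) = x ∧
      frobProd Θ (p ^ a) x (s * 4) = (ρ g).map (algebraMap E K)) →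
      Nat.card H * S.card ≤ (p ^ a) ^ (s * 4) + C * (p ^ a) ^ (s * 3) := by
  classical
  have := Fintype.ofFinite H
  let b := Module.Free.chooseBasis E[X] B
  obtain ⟨C, N, hCN⟩ := exists_card_frobenius_points_le (p := p) b j hj (σ g) K
  choose φ hφ using fun x : K => exists_algHom_over (E := E) (B := B) x
  have hinj : Function.Injective φ := fun x x' h => by
    have h1 := hφ x X
    rw [h, hφ x' X] at h1
    simpa using h1.symm
  refine ⟨C + Nat.card H * (Algebra.norm E[X] y.det).natDegree, N, fun s hs S hS => ?_⟩
  set S₀ := S.filter fun x => φ x y.det = 0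
  set S₁ := S.filter fun x => φ x y.det ≠ 0
  have h0 : S₀.card ≤ (Algebra.norm E[X] y.det).natDegree := by
    rw [← Finset.card_image_of_injective S₀ hinj]
    refine card_zeros_le_natDegree_norm b hdet _ fun ψ hψ => ?_
    obtain ⟨x, hx, rfl⟩ := Finset.mem_image.1 hψ
    exact (Finset.mem_filter.1 hx).2
  let Φ : H × K → (B →ₐ[E] K) := fun k => (φ k.2).comp ((σ k.1).restrictScalars E)
  have hΦ : ∀ k, ∀ f : E[X], Φ k (algebraMap E[X] B f) = aeval k.2 f := fun k f => by
    change φ k.2 (σ k.1 _) = _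
    rw [AlgHom.commutes, hφ]
  have hΦy : ∀ k : H × K, ∀ i j, Φ k (y i j) = (((ρ k.1).map (algebraMap E K)) *
      (y.map (φ k.2))) i j := fun k i j => by
    change φ k.2 (σ k.1 _) = _
    rw [hσ _ k.1.2, map_sum, Matrix.mul_apply]
    simp [Algebra.smul_def]
  have hΦinj : Set.InjOn Φ (Finset.univ ×ˢ S₁ : Finset (H × K)) := by
    rintro ⟨h, x⟩ hx ⟨h', x'⟩ hx' he
    have hxx : x = x' := by
      have h1 := hΦ (h, x) X
      rw [he, hΦ (h', x') X] at h1
      simpa using h1.symm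
    subst hxx
    have h1 : ((ρ h).map (algebraMap E K)) * (y.map (φ x)) =
        ((ρ h').map (algebraMap E K)) * (y.map (φ x)) := by
      ext i j
      rw [← hΦy (h, x), ← hΦy (h', x), he]
    have hunit : IsUnit (y.map (φ x)) := by
      rw [Matrix.isUnit_iff_isUnit_det, isUnit_iff_ne_zero]
      have h2 : (y.map (φ x)).det = φ x y.det := ((φ x).toRingHom.map_det y).symm
      rw [h2]
      simp only [S₁, Finset.coe_product, Set.mem_prod, Finset.mem_coe, Finset.mem_filter] at hx
      exact hx.2.2
    have h2 := hunit.mul_right_cancel h1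
    have h3 : ρ h = ρ h' := by
      ext i j
      exact (algebraMap E K).injective (congrFun (congrFun h2 i) j)
    exact Prod.ext (Subtype.ext (hρ h3)) rfl
  have h1 : Nat.card H * S₁.card ≤ (p ^ (a * s)) ^ 4 + C * (p ^ (a * s)) ^ 3 := by
    have h2 : ((Finset.univ ×ˢ S₁ : Finset (H × K)).image Φ).card = Nat.card H * S₁.card := by
      rw [Finset.card_image_of_injOn hΦinj, Finset.card_product, Finset.card_univ,
        Nat.card_eq_fintype_card]
    rw [← h2]
    refine hCN (a * s) (by rwa [pow_mul]) (fun c => by rw [pow_mul, pow_pow_eq_self (hE c)]) _ ?_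
    intro ψ hψ u
    obtain ⟨⟨h, x⟩, hx, rfl⟩ := Finset.mem_image.1 hψ
    have hxS : x ∈ S := (Finset.mem_filter.1 (Finset.mem_product.1 hx).2).1
    rw [pow_mul p, ← pow_mul (p ^ a)]
    exact point_pow_eq_of_class hE hy hgen (hΦ (h, x)) (hS x hxS).1 (hS x hxS).2 (hσ g hg) u
  have h2 : S.card = S₀.card + S₁.card :=
    (Finset.card_filter_add_card_filter_not _).symm
  have h3 : 1 ≤ (p ^ a) ^ (s * 3) := Nat.one_le_pow _ _ (Nat.pow_pos hp.out.pos)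
  rw [pow_mul p, ← pow_mul (p ^ a), ← pow_mul (p ^ a)] at h1
  rw [h2, mul_add, add_mul]
  have h4 := Nat.mul_le_mul_left (Nat.card H) h0
  have h5 := Nat.le_mul_of_pos_right (Nat.card H * (Algebra.norm E[X] y.det).natDegree) h3
  omega

end LangTorsor

section LangTorsor

variable {E : Type*} [Field E] {d : Type*} [Fintype d] [DecidableEq d] {p a : ℕ}
  [hp : Fact p.Prime] [CharP E p]

/-- Equidistribution of the twisted Frobenius products in the cosets of a subgroup. -/
theorem exists_subgroup_card_class_le {𝒢 : Type*} [CommGroup 𝒢] [Finite 𝒢]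
    (ρ : 𝒢 →* Matrix d d E) (hρ : Function.Injective ρ) (hE : ∀ c : E, c ^ p ^ a = c)
    (ha : 2 ≤ p ^ a) (Θ : Matrix d d E[X]) (hΘ : ∀ i j, (Θ i j).coeff 0 = (1 : Matrix d d E) i j)
    (K : Type*) [Field K] [Algebra E K] [IsAlgClosed K] :
    ∃ H : Subgroup 𝒢, ∃ C N : ℕ, ∀ s, N ≤ (p ^ a) ^ s → ∀ g, ∀ S : Finset K,
      (∀ x ∈ S, x ^ (p ^ a) ^ (s * 4) = x ∧
        frobProd Θ (p ^ a) x (s * 4) = (ρ g).map (algebraMap E K)) →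
      (g ∈ H → Nat.card H * S.card ≤ (p ^ a) ^ (s * 4) + C * (p ^ a) ^ (s * 3)) ∧
      (g ∉ H → S.card ≤ C) := by
  classical
  obtain ⟨Y, hY1, hY⟩ := exists_lang_solution Θ hΘ ha hE
  let 𝓑 := Algebra.adjoin E[X] (Set.range fun k : d × d => Y k.1 k.2)
  have hcharY : CharP (PowerSeries E) p :=
    charP_of_injective_algebraMap (algebraMap E (PowerSeries E)).injective p
  have hY' : ∀ i j, Y i j ^ p ^ a = ∑ l, Θ i l • Y l j := fun i j => by
    rw [hY]
    refine Finset.sum_congr rfl fun l _ => ?_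
    rw [Algebra.smul_def]
    rfl
  have hfin : Module.Finite E[X] 𝓑 := finite_adjoin_of_lang ha Θ Y hY'
  have hinj : Function.Injective (algebraMap E[X] (PowerSeries E)) := Polynomial.coe_injective E
  have : IsDomain 𝓑 := inferInstance
  have htf : Module.IsTorsionFree E[X] 𝓑 := by
    have : FaithfulSMul E[X] (PowerSeries E) := (faithfulSMul_iff_algebraMap_injective _ _).2 hinj
    infer_instance
  have hfree : Module.Free E[X] 𝓑 := inferInstance
  let y : Matrix d d 𝓑 := fun i j => ⟨Y i j, Algebra.subset_adjoin ⟨(i, j), rfl⟩⟩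
  have hy : ∀ i j, y i j ^ p ^ a = ∑ l, Θ i l • y l j := fun i j => by
    apply Subtype.ext
    simpa [y] using hY' i j
  have hgen : Algebra.adjoin E[X] (Set.range fun k : d × d => y k.1 k.2) = ⊤ := by
    have h := Algebra.adjoin_adjoin_coe_preimage (R := E[X])
      (s := Set.range fun k : d × d => Y k.1 k.2)
    rw [← h]
    congr 1
    ext b
    constructor
    · rintro ⟨k, rfl⟩
      exact ⟨k, rfl⟩
    · rintro ⟨k, hk⟩
      exact ⟨k, Subtype.ext hk⟩
  have hdet : y.det ≠ 0 := by
    intro h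
    have h1 : (PowerSeries.constantCoeff (R := E)).comp 𝓑.val.toRingHom y.det = 0 := by
      rw [h, map_zero]
    rw [RingHom.map_det] at h1
    have h2 : ((PowerSeries.constantCoeff (R := E)).comp 𝓑.val.toRingHom).mapMatrix y = 1 := by
      ext i j
      exact hY1 i j
    rw [h2, Matrix.det_one] at h1
    exact one_ne_zero h1
  let IsAut : 𝒢 → (𝓑 →ₐ[E[X]] 𝓑) → Prop := fun g σ =>
    ∀ i j, σ (y i j) = ∑ l, ρ g i l • y l j
  let Hm : Submonoid 𝒢 :=
    { carrier := {g | ∃ σ, IsAut g σ}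
      one_mem' := ⟨AlgHom.id _ _, fun i j => by simp [Matrix.one_apply]⟩
      mul_mem' := by
        rintro g h ⟨σ, hσ⟩ ⟨τ, hτ⟩
        refine ⟨τ.comp σ, fun i j => ?_⟩
        have hsm : ∀ (c : E) (b : 𝓑), τ (c • b) = c • τ b := fun c b =>
          map_smul (τ.restrictScalars E) c b
        rw [AlgHom.comp_apply, hσ, map_sum, map_mul]
        simp_rw [hsm, hτ _ _, Matrix.mul_apply, Finset.sum_smul, Finset.smul_sum, smul_smul]
        rw [Finset.sum_comm] }
  let H : Subgroup 𝒢 :=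
    { Hm with
      inv_mem' := by
        intro g hg
        have h1 : g⁻¹ = g ^ (orderOf g - 1) := by
          rw [inv_eq_iff_mul_eq_one, ← pow_succ', Nat.sub_add_cancel (orderOf_pos g),
            pow_orderOf_eq_one]
        rw [h1]
        exact Hm.pow_mem hg _ }
  have key : ∀ g, ∃ C N : ℕ, ∀ s, N ≤ (p ^ a) ^ s → ∀ S : Finset K,
      (∀ x ∈ S, x ^ (p ^ a) ^ (s * 4) = x ∧
        frobProd Θ (p ^ a) x (s * 4) = (ρ g).map (algebraMap E K)) →
      (g ∈ H → Nat.card H * S.card ≤ (p ^ a) ^ (s * 4) + C * (p ^ a) ^ (s * 3)) ∧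
      (g ∉ H → S.card ≤ C) := by
    intro g
    by_cases hg : g ∈ H
    · choose! σ hσ using fun g (hg : g ∈ H) => hg
      obtain ⟨C, N, h⟩ := exists_card_class_le_of_automorphism (K := K) H ρ hρ hE hy hgen hdet
        𝓑.val Subtype.val_injective σ hσ hg
      exact ⟨C, N, fun s hs S hS => ⟨fun _ => h s hs S hS, fun h => absurd hg h⟩⟩
    · rcases exists_lift_or_relation hgen (fun i j => ∑ l, ρ g i l • y l j) with ⟨σ, hσ⟩ | ⟨P, h1,
        h2⟩
      · exact absurd ⟨σ, hσ⟩ hg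
      · obtain ⟨C, h⟩ := exists_card_class_le_of_relation (K := K) hE hy h1 h2
        exact ⟨C, 0, fun s hs S hS => ⟨fun h => absurd h hg, fun _ => h _ S hS⟩⟩
  have := Fintype.ofFinite 𝒢
  choose C N h using key
  refine ⟨H, Finset.univ.sup C, Finset.univ.sup N, fun s hs g S hS => ?_⟩
  have hC : C g ≤ Finset.univ.sup C := Finset.le_sup (Finset.mem_univ g)
  obtain ⟨h1, h2⟩ := h g s ((Finset.le_sup (Finset.mem_univ g)).trans hs) S hS
  exact ⟨fun hg => (h1 hg).trans (by gcongr), fun hg => (h2 hg).trans hC⟩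

end LangTorsor

section FrobeniusPoints

/-- The degree `k` homogenisation of the polynomial `g`, evaluated at `(u, v)`. -/
noncomputable def homEval {K M : Type*} [CommRing K] [Ring M] [Algebra K M] (u v : M) (k : ℕ)
    (g : K[X]) : M :=
  ∑ i ∈ Finset.range (k + 1), g.coeff i • (u ^ i * v ^ (k - i))

/-- The product of the linear factors `X - x ^ q ^ i`, for `i < k`. -/
noncomputable def frobPoly {K : Type*} [CommRing K] (q : ℕ) (x : K) (k : ℕ) : K[X] :=
  ∏ i ∈ Finset.range k, (X - C (x ^ q ^ i))

theorem frobPoly_succ {K : Type*} [CommRing K] (q : ℕ) (x : K) (k : ℕ) :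
    frobPoly q x (k + 1) = (X - C (x ^ q ^ k)) * frobPoly q x k :=
  Finset.prod_range_succ_comm _ _

theorem frobPoly_monic {K : Type*} [CommRing K] (q : ℕ) (x : K) (k : ℕ) :
    (frobPoly q x k).Monic :=
  monic_prod_of_monic _ _ fun _ _ => monic_X_sub_C _

theorem natDegree_frobPoly {K : Type*} [CommRing K] [Nontrivial K] (q : ℕ) (x : K) (k : ℕ) :
    (frobPoly q x k).natDegree = k := by
  rw [frobPoly, natDegree_prod_of_monic _ _ fun _ _ => monic_X_sub_C _]
  simp only [natDegree_X_sub_C, Finset.sum_const, Finset.card_range, smul_eq_mul, mul_one]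

theorem homEval_mul_X_sub_C {K M : Type*} [CommRing K] [Ring M] [Algebra K M] {u v : M}
    (huv : Commute u v) {k : ℕ} {g : K[X]} (hg : g.natDegree ≤ k) (x : K) :
    homEval u v (k + 1) ((X - C x) * g) = (u - x • v) * homEval u v k g := by
  have h1 : homEval u v (k + 1) (X * g) = u * homEval u v k g := by
    rw [homEval, Finset.sum_range_succ', homEval, Finset.mul_sum]
    simp [pow_succ', mul_assoc]
  have h2 : homEval u v (k + 1) (C x * g) = (x • v) * homEval u v k g := by
    rw [homEval, Finset.sum_range_succ, homEval, Finset.mul_sum, coeff_C_mul,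
      coeff_eq_zero_of_natDegree_lt (Nat.lt_succ_of_le hg), mul_zero, zero_smul, add_zero]
    refine Finset.sum_congr rfl fun i hi => ?_
    rw [Nat.succ_sub (Nat.lt_succ_iff.1 (Finset.mem_range.1 hi)), coeff_C_mul, smul_mul_smul_comm,
      pow_succ', ← mul_assoc, ← mul_assoc, (huv.pow_left i).eq]
  rw [sub_mul, sub_mul, ← h1, ← h2]
  simp [homEval, sub_smul]

theorem homEval_map {F K R M : Type*} [CommRing F] [CommRing K] [Ring R] [Ring M] [Algebra F K]
    [Algebra K M] [Algebra F R] [Algebra F M] [IsScalarTower F K M] (φ : R →ₐ[F] M) (U V : R)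
    (k : ℕ) (f : F[X]) :
    homEval (φ U) (φ V) k (f.map (algebraMap F K)) = φ (homEval U V k f) := by
  simp [homEval]

section

variable {F : Type*} [CommRing F] {d : Type*} [Fintype d] [DecidableEq d]

theorem frobProd_map {K K' : Type*} [CommRing K] [CommRing K'] [Algebra F K] [Algebra F K']
    (Θ : Matrix d d F[X]) (q : ℕ) (φ : K →ₐ[F] K') (x : K) (n : ℕ) :
    (frobProd Θ q x n).map φ = frobProd Θ q (φ x) n := by
  induction n with
  | zero =>
    exact Matrix.map_one _ (map_zero φ) (map_one φ)
  | succ n ih =>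
    rw [frobProd, frobProd, Matrix.map_mul, ih]
    congr 1
    ext i j
    simp [← aeval_algHom_apply]

theorem frobProd_add {K : Type*} [CommRing K] [Algebra F K] (Θ : Matrix d d F[X]) (q : ℕ) (x : K)
    (m n : ℕ) : frobProd Θ q x (m + n) = frobProd Θ q (x ^ q ^ n) m * frobProd Θ q x n := by
  induction m with
  | zero => simp [frobProd]
  | succ m ih =>
    rw [Nat.succ_add, frobProd, frobProd, ih, Matrix.mul_assoc, ← pow_mul, ← pow_add, add_comm n]

/-- The matrix `A - X • B`. -/
noncomputable def linPencil (A B : Matrix d d F) : Matrix d d F[X] :=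
  A.map (C : F →+* F[X]) - (X : F[X]) • B.map (C : F →+* F[X])

theorem linPencil_map_aeval {K : Type*} [CommRing K] [Algebra F K] (A B : Matrix d d F) (x : K) :
    (linPencil A B).map (aeval x) = A.map (algebraMap F K) - x • B.map (algebraMap F K) := by
  ext i j
  simp [linPencil]
  exact mul_comm _ _

theorem homEval_frobPoly {K : Type*} [CommRing K] [Nontrivial K] [Algebra F K]
    {A B : Matrix d d F} (h : Commute A B) (q : ℕ) (x : K) (k : ℕ) :
    homEval (A.map (algebraMap F K)) (B.map (algebraMap F K)) k (frobPoly q x k) =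
      frobProd (linPencil A B) q x k := by
  induction k with
  | zero => simp [homEval, frobPoly, frobProd]
  | succ k ih =>
    have hAB : Commute (A.map (algebraMap F K)) (B.map (algebraMap F K)) :=
      h.map (algebraMap F K).mapMatrix
    rw [frobPoly_succ, homEval_mul_X_sub_C hAB
      (natDegree_frobPoly q x k).le, ih, frobProd, linPencil_map_aeval]

theorem frobProd_mul_of_pow_eq {K : Type*} [CommRing K] [Algebra F K] (Θ : Matrix d d F[X])
    (q : ℕ) {x : K} {e : ℕ} (hx : x ^ q ^ e = x) (n : ℕ) :
    frobProd Θ q x (e * n) = frobProd Θ q x e ^ n := by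
  induction n with
  | zero => simp [frobProd]
  | succ n ih => rw [Nat.mul_succ, frobProd_add, hx, ih, pow_succ]

end

end FrobeniusPoints

section FrobeniusPoints

theorem frobenius_pow_apply (F : Type*) [Field F] [Fintype F] {K : Type*} [CommRing K] [Algebra F K]
    (n : ℕ) (x : K) : (FiniteField.frobeniusAlgHom F K ^ n) x = x ^ Fintype.card F ^ n := by
  induction n generalizing x with
  | zero => simp
  | succ n ih =>
    rw [pow_succ, AlgHom.mul_apply, ih, FiniteField.coe_frobeniusAlgHom, ← pow_mul, ← pow_succ']

variable {F : Type*} [Field F] [Fintype F] {R : Type*} [CommRing R] [Finite R] [Algebra F R]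

theorem exists_subgroup_card_frobenius_le (U V : R) {K : Type*} [Field K] [IsAlgClosed K]
    [Algebra F K] {x₀ : K} {e : ℕ} (he : 0 < e) (hx₀ : x₀ ^ Fintype.card F ^ e = x₀) {f₀ : F[X]}
    (hf₀ : f₀.map (algebraMap F K) = frobPoly (Fintype.card F) x₀ e)
    (hu : IsUnit (homEval U V e f₀)) :
    ∃ H : Subgroup Rˣ, ∃ k₀ C s₀ : ℕ, 0 < k₀ ∧ ∀ s, s₀ ≤ s → ∀ g : Rˣ, ∀ S : Finset K,
      (∀ x ∈ S, x ^ Fintype.card F ^ (k₀ * (s * 4)) = x ∧ ∃ f : F[X],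
        f.map (algebraMap F K) = frobPoly (Fintype.card F) x (k₀ * (s * 4)) ∧
        homEval U V (k₀ * (s * 4)) f = g) →
      (g ∈ H → Nat.card H * S.card ≤
        Fintype.card F ^ (k₀ * (s * 4)) + C * Fintype.card F ^ (k₀ * (s * 3))) ∧
      (g ∉ H → S.card ≤ C) := by
  classical
  obtain ⟨p, hcharF, a, hpp, ha⟩ := FiniteField.card' F
  have hp : Fact p.Prime := ⟨hpp⟩
  set q := Fintype.card F with hq
  have hq2 : 2 ≤ q := Fintype.one_lt_card
  obtain ⟨u, hu⟩ := hu
  set k₀ := e * orderOf u with hk₀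
  have hk₀0 : 0 < k₀ := Nat.mul_pos he (orderOf_pos u)
  have hx₀k : x₀ ^ q ^ k₀ = x₀ := by
    rw [hk₀, pow_mul]
    exact pow_pow_eq_self hx₀ _
  -- the field of definition
  let E : IntermediateField F K :=
    (AlgHom.equalizer (FiniteField.frobeniusAlgHom F K ^ k₀) (AlgHom.id F K)).toIntermediateField
      fun x hx => by
        rw [AlgHom.mem_equalizer] at hx ⊢
        rw [map_inv₀, hx, map_inv₀]
  have hEmem : ∀ x : K, x ∈ E ↔ x ^ q ^ k₀ = x := fun x => by
    change x ∈ AlgHom.equalizer _ _ ↔ _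
    rw [AlgHom.mem_equalizer, frobenius_pow_apply]
    rfl
  have hE : ∀ c : E, c ^ q ^ k₀ = c := fun c => Subtype.ext ((hEmem c).1 c.2)
  have hcharE : CharP E p := by
    exact charP_of_injective_algebraMap (algebraMap F E).injective p
  let b := Module.finBasis F R
  let ρ₀ := Algebra.leftMulMatrix b
  have hρ₀ : Function.Injective ρ₀ := Algebra.leftMulMatrix_injective b
  let Θ₀ := linPencil (ρ₀ U) (ρ₀ V)
  have hcomm : Commute (ρ₀ U) (ρ₀ V) := (Commute.all U V).map ρ₀
  have hN : ∀ (x : K) (k : ℕ) (f : F[X]), f.map (algebraMap F K) = frobPoly q x k →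
      frobProd Θ₀ q x k = (ρ₀ (homEval U V k f)).map (algebraMap F K) := by
    intro x k f hf
    rw [← homEval_frobPoly hcomm, ← hf]
    exact homEval_map (((Algebra.ofId F K).mapMatrix).comp ρ₀) U V k f
  let y₀ : E := ⟨x₀, (hEmem x₀).2 hx₀k⟩
  let Θ : Matrix _ _ E[X] := frobProd Θ₀ q (X + C y₀) k₀
  have hone : frobProd Θ₀ q x₀ k₀ = 1 := by
    rw [hk₀, frobProd_mul_of_pow_eq _ _ hx₀, hN x₀ e f₀ hf₀, ← hu]
    have h1 : ((ρ₀ u).map (algebraMap F K)) ^ orderOf u =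
        (ρ₀ ((u ^ orderOf u : Rˣ) : R)).map (algebraMap F K) := by
      rw [Units.val_pow_eq_pow_val, map_pow]
      exact (map_pow (algebraMap F K).mapMatrix _ _).symm
    rw [h1, pow_orderOf_eq_one, Units.val_one, map_one]
    exact Matrix.map_one _ (map_zero _) (map_one _)
  have hΘmap : ∀ x : K, Θ.map (aeval x) = frobProd Θ₀ q (x + x₀) k₀ := fun x => by
    have h1 := frobProd_map Θ₀ q ((aeval x : E[X] →ₐ[E] K).restrictScalars F) (X + C y₀) k₀
    have h2 : ((aeval x : E[X] →ₐ[E] K).restrictScalars F) (X + C y₀) = x + x₀ := by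
      change aeval x (X + C y₀) = _
      simp [y₀]
    rw [h2] at h1
    exact h1
  have hΘ : ∀ i j, (Θ i j).coeff 0 = (1 : Matrix _ _ E) i j := fun i j => by
    have h1 := hΘmap 0
    rw [zero_add, hone] at h1
    have h2 := congrFun (congrFun h1 i) j
    apply (algebraMap E K).injective
    rw [Matrix.map_apply, ← coeff_zero_eq_aeval_zero'] at h2
    rw [h2]
    by_cases h : i = j
    · rw [h, Matrix.one_apply_eq, Matrix.one_apply_eq, map_one]
    · rw [Matrix.one_apply_ne h, Matrix.one_apply_ne h, map_zero]
  have hΘn : ∀ (x : K) (n : ℕ), frobProd Θ (q ^ k₀) x n = frobProd Θ₀ q (x + x₀) (k₀ * n) := by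
    intro x n
    induction n with
    | zero => simp [frobProd]
    | succ n ih =>
      rw [frobProd, ih, hΘmap, Nat.mul_succ, add_comm (k₀ * n), frobProd_add]
      congr 2
      rw [← frobenius_pow_apply, map_add, frobenius_pow_apply, frobenius_pow_apply]
      rw [← hq, ← pow_mul, pow_mul q, pow_pow_eq_self hx₀k]
  let ρ : Rˣ →* Matrix _ _ E :=
    ((algebraMap F E).mapMatrix.toMonoidHom.comp ρ₀.toRingHom.toMonoidHom).comp (Units.coeHom R)
  have hρ : Function.Injective ρ := by
    intro g h hgh
    apply Units.ext
    apply hρ₀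
    ext i j
    exact (algebraMap F E).injective (congrFun (congrFun hgh i) j)
  have hqa : q ^ k₀ = p ^ ((a : ℕ) * k₀) := by rw [ha, ← pow_mul p]
  have ha2 : 2 ≤ q ^ k₀ := hq2.trans (Nat.le_self_pow hk₀0.ne' q)
  rw [hqa] at ha2
  obtain ⟨H, C', N, hH⟩ := exists_subgroup_card_class_le (p := p) (a := a * k₀) ρ hρ
    (fun c => by rw [← hqa, hE]) ha2 Θ hΘ K
  rw [← hqa] at hH
  refine ⟨H, k₀, C', N, hk₀0, fun s hs g S hS => ?_⟩
  have hsN : N ≤ (q ^ k₀) ^ s := by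
    refine hs.trans ((Nat.lt_pow_self (by omega : 1 < q ^ k₀)).le)
  have hinj : Function.Injective fun x : K => x - x₀ := sub_left_injective
  have := hH s hsN g (S.image fun x => x - x₀) ?_
  · rwa [Finset.card_image_of_injective S hinj, ← pow_mul, ← pow_mul] at this
  · intro x hx
    obtain ⟨y, hy, rfl⟩ := Finset.mem_image.1 hx
    obtain ⟨h1, f, h2, h3⟩ := hS y hy
    constructor
    · rw [← pow_mul, ← frobenius_pow_apply, map_sub, frobenius_pow_apply, frobenius_pow_apply, ← hq,
        h1, pow_mul, pow_pow_eq_self hx₀k]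
    · rw [hΘn, sub_add_cancel, hN y _ f h2, h3]
      ext i j
      exact IsScalarTower.algebraMap_apply F E K _

end FrobeniusPoints

section PowerSums

open PowerSeries in
/-- The logarithmic derivation `X d/dX`. -/
noncomputable def thetaOp (f : PowerSeries ℂ) : PowerSeries ℂ :=
  PowerSeries.mk fun m => m * PowerSeries.coeff m f

theorem thetaOp_mul (f g : PowerSeries ℂ) : thetaOp (f * g) = thetaOp f * g + f * thetaOp g := by
  ext m
  simp only [thetaOp, PowerSeries.coeff_mk, PowerSeries.coeff_mul, map_add, Finset.mul_sum,
    ← Finset.sum_add_distrib]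
  refine Finset.sum_congr rfl fun ij hij => ?_
  rw [← Finset.HasAntidiagonal.mem_antidiagonal.1 hij]
  push_cast
  ring

/-- The generating series of the power sums of a multiset. -/
noncomputable def psumSeries (s : Multiset ℂ) : PowerSeries ℂ :=
  PowerSeries.mk fun k => if k = 0 then 0 else (s.map (· ^ k)).sum

theorem thetaOp_prod (s : Multiset ℂ) :
    thetaOp (s.map fun α => (1 - PowerSeries.C α * PowerSeries.X)).prod =
      -((s.map fun α => (1 - PowerSeries.C α * PowerSeries.X)).prod * psumSeries s) := by
  induction s using Multiset.induction with
  | empty =>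
    ext m
    simp [thetaOp, psumSeries, PowerSeries.coeff_one]
  | cons α s ih =>
    have h1 : psumSeries (α ::ₘ s) =
        PowerSeries.mk (fun k => if k = 0 then 0 else α ^ k) + psumSeries s := by
      ext k
      simp only [psumSeries, PowerSeries.coeff_mk, map_add, Multiset.map_cons, Multiset.sum_cons]
      split_ifs <;> simp
    have h2 : thetaOp (1 - PowerSeries.C α * PowerSeries.X) =
        -((1 - PowerSeries.C α * PowerSeries.X) *
          PowerSeries.mk (fun k => if k = 0 then 0 else α ^ k)) := by
      ext k
      rw [sub_mul, one_mul, mul_assoc]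
      rcases k with _ | k
      · simp [thetaOp]
      · simp only [thetaOp, PowerSeries.coeff_mk, map_neg, map_sub, PowerSeries.coeff_C_mul,
          PowerSeries.coeff_succ_X_mul, PowerSeries.coeff_one, PowerSeries.coeff_X]
        rcases k with _ | k
        · simp
        · simp [pow_succ']
    rw [Multiset.map_cons, Multiset.prod_cons, thetaOp_mul, ih, h1, h2]
    ring

theorem exists_prod_one_sub (P : ℂ[X]) (hP : P.coeff 0 = 1) :
    ∃ s : Multiset ℂ, s.card = P.natDegree ∧
      (P : PowerSeries ℂ) = (s.map fun α => (1 - PowerSeries.C α * PowerSeries.X)).prod := by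
  have hP0 : P ≠ 0 := fun h => by simp [h] at hP
  have hr : ∀ r ∈ P.roots, r ≠ 0 := by
    rintro r hr rfl
    rw [mem_roots hP0, IsRoot, ← coeff_zero_eq_eval_zero, hP] at hr
    exact one_ne_zero hr
  have h1 := (IsAlgClosed.splits P).eq_prod_roots
  refine ⟨P.roots.map (·⁻¹), ?_, ?_⟩
  · rw [Multiset.card_map]
    exact (IsAlgClosed.splits P).natDegree_eq_card_roots.symm
  · have h2 : P.roots.map (fun r => X - C r) =
        P.roots.map (fun r => C (-r) * (1 - C r⁻¹ * X)) := by
      refine Multiset.map_congr rfl fun r h => ?_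
      have h3 : (C (-r) * C r⁻¹ : ℂ[X]) = -1 := by
        rw [← C_mul, neg_mul, mul_inv_cancel₀ (hr r h), C_neg, C_1]
      rw [mul_sub, mul_one, ← mul_assoc, h3, C_neg]
      ring
    rw [h2, Multiset.prod_map_mul] at h1
    have h4 : (P.roots.map fun r => C (-r)).prod = C (P.roots.map fun r => -r).prod := by
      rw [map_multiset_prod, Multiset.map_map]
      rfl
    rw [h4, ← mul_assoc, ← C_mul] at h1
    set c := P.leadingCoeff * (P.roots.map fun r => -r).prod with hc
    have h5 : c = 1 := by
      have h6 := congrArg (eval 0) h1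
      rw [← coeff_zero_eq_eval_zero, hP, eval_mul, eval_C, eval_multiset_prod,
          Multiset.map_map] at h6
      simpa using h6.symm
    rw [h5, C_1, one_mul] at h1
    have h7 := congrArg (Polynomial.coeToPowerSeries.ringHom (R := ℂ)) h1
    rw [map_multiset_prod, Multiset.map_map] at h7
    rw [Multiset.map_map]
    rw [Polynomial.coeToPowerSeries.ringHom_apply] at h7
    rw [h7]
    refine congrArg Multiset.prod (Multiset.map_congr rfl fun r _ => ?_)
    simp

theorem norm_le_of_power_sums (s : Multiset ℂ) {C R : ℝ} (hR : 0 ≤ R) (s₀ : ℕ)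
    (h : ∀ k, s₀ ≤ k → ‖(s.map (· ^ k)).sum‖ ≤ C * R ^ k) : ∀ z ∈ s, ‖z‖ ≤ R := by
  classical
  intro z hz
  by_contra! hzR
  have hz0 : 0 < ‖z‖ := hR.trans_lt hzR
  set p : ℂ[X] := ∏ w ∈ s.toFinset.erase z, (X - Polynomial.C w) with hp
  have hpz : p.eval z ≠ 0 := by
    rw [hp, eval_prod, Finset.prod_ne_zero_iff]
    intro w hw
    simpa [sub_eq_zero] using (Finset.ne_of_mem_erase hw).symm
  have hpw : ∀ w ∈ s, w ≠ z → p.eval w = 0 := fun w hw hwz => by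
    rw [hp, eval_prod]
    exact Finset.prod_eq_zero (Finset.mem_erase.2 ⟨hwz, Multiset.mem_toFinset.2 hw⟩) (by simp)
  have key : ∀ k, (s.count z : ℂ) * p.eval z * z ^ k =
      ∑ j ∈ Finset.range (p.natDegree + 1), p.coeff j * (s.map (· ^ (k + j))).sum := by
    intro k
    have h1 : (s.map fun w => p.eval w * w ^ k).sum = (s.count z : ℂ) * p.eval z * z ^ k := by
      rw [Finset.sum_multiset_map_count, Finset.sum_eq_single z]
      · rw [nsmul_eq_mul, mul_assoc]
      · intro w hw hwz
        rw [hpw w (Multiset.mem_toFinset.1 hw) hwz, zero_mul, smul_zero]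
      · intro h
        exact absurd (Multiset.mem_toFinset.2 hz) h
    rw [← h1]
    have h2 : (s.map fun w => p.eval w * w ^ k) = s.map fun w =>
        ∑ j ∈ Finset.range (p.natDegree + 1), p.coeff j * w ^ (k + j) := by
      refine Multiset.map_congr rfl fun w _ => ?_
      rw [eval_eq_sum_range, Finset.sum_mul]
      exact Finset.sum_congr rfl fun j _ => by ring
    rw [h2]
    refine (Multiset.sum_map_sum_map s (Finset.range (p.natDegree + 1)).val).trans ?_
    refine Finset.sum_congr rfl fun j _ => ?_
    rw [Multiset.sum_map_mul_left]
  set A := ∑ j ∈ Finset.range (p.natDegree + 1), ‖p.coeff j‖ * (C * R ^ j) with hA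
  set c := ‖(s.count z : ℂ) * p.eval z‖ with hc
  have hc0 : 0 < c := by
    rw [hc, norm_pos_iff]
    exact mul_ne_zero (by exact_mod_cast (Multiset.count_pos.2 hz).ne') hpz
  have h3 : ∀ k, s₀ ≤ k → c * ‖z‖ ^ k ≤ A * R ^ k := by
    intro k hk
    rw [← norm_pow, hc, ← norm_mul, key, hA, Finset.sum_mul]
    refine (norm_sum_le _ _).trans (Finset.sum_le_sum fun j _ => ?_)
    rw [norm_mul]
    refine (mul_le_mul_of_nonneg_left (h (k + j) (by omega)) (norm_nonneg _)).trans (le_of_eq ?_)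
    ring
  have h4 : Filter.Tendsto (fun k : ℕ => A * (R / ‖z‖) ^ k) Filter.atTop (nhds (A * 0)) :=
    (tendsto_pow_atTop_nhds_zero_of_lt_one (by positivity) ((div_lt_one hz0).2 hzR)).const_mul A
  rw [mul_zero] at h4
  obtain ⟨k, hk, hk'⟩ := ((h4.eventually (gt_mem_nhds hc0)).and (Filter.eventually_ge_atTop s₀)).exists
  have h5 := h3 k hk'
  rw [div_pow, mul_div_assoc', div_lt_iff₀ (by positivity)] at hk
  linarith

theorem norm_coeff_le_of_prod_mul (s : Multiset ℂ) {R A : ℝ} (hR : 0 ≤ R) (hA : 0 ≤ A)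
    (hs : ∀ z ∈ s, ‖z‖ ≤ R) (g q : PowerSeries ℂ)
    (hq : ∀ m, ‖PowerSeries.coeff m q‖ ≤ A * (8 / 7 * R) ^ m)
    (h : (s.map fun α => (1 - PowerSeries.C α * PowerSeries.X)).prod * g = q) (m : ℕ) :
    ‖PowerSeries.coeff m g‖ ≤ 8 ^ s.card * A * (8 / 7 * R) ^ m := by
  induction s using Multiset.induction generalizing q A with
  | empty =>
    rw [Multiset.map_zero, Multiset.prod_zero, one_mul] at h
    simpa [h] using hq m
  | cons α s ih =>
    rw [Multiset.map_cons, Multiset.prod_cons, mul_assoc] at h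
    set b := (s.map fun α => (1 - PowerSeries.C α * PowerSeries.X)).prod * g with hb
    have hα : ‖α‖ ≤ R := hs α (Multiset.mem_cons_self _ _)
    have hrec : b = q + PowerSeries.C α * (PowerSeries.X * b) := by
      rw [← h]
      ring
    have hbm : ∀ m, ‖PowerSeries.coeff m b‖ ≤ (8 * A) * (8 / 7 * R) ^ m := by
      intro m
      induction m with
      | zero =>
        rw [hrec]
        have := hq 0
        simp at this ⊢
        linarith
      | succ m ihm =>
        rw [hrec, map_add, PowerSeries.coeff_C_mul, PowerSeries.coeff_succ_X_mul]
        calc _ ≤ ‖PowerSeries.coeff (m + 1) q‖ + ‖α‖ * ‖PowerSeries.coeff m b‖ := by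
              rw [← norm_mul]
              exact norm_add_le _ _
          _ ≤ A * (8 / 7 * R) ^ (m + 1) + R * ((8 * A) * (8 / 7 * R) ^ m) := by
              gcongr
              exact hq _
          _ = _ := by
            rw [pow_succ]
            ring
    have := ih (A := 8 * A) (by positivity) (fun z hz => hs z (Multiset.mem_cons_of_mem hz)) b hbm hb.symm
    rw [Multiset.card_cons, pow_succ]
    linarith

theorem exists_multiset_of_thetaOp {P : ℂ[X]} (hP : P.coeff 0 = 1) {S : ℕ → ℂ}
    (h : thetaOp P = P * PowerSeries.mk fun k => if k = 0 then 0 else S k) :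
    ∃ s : Multiset ℂ, s.card = P.natDegree ∧
      (P : PowerSeries ℂ) = (s.map fun α => (1 - PowerSeries.C α * PowerSeries.X)).prod ∧
      ∀ k, k ≠ 0 → S k = -(s.map (· ^ k)).sum := by
  obtain ⟨s, hs, hPs⟩ := exists_prod_one_sub P hP
  refine ⟨s, hs, hPs, fun k hk => ?_⟩
  have hP0 : (P : PowerSeries ℂ) ≠ 0 := fun h => by
    have h1 := congrArg (PowerSeries.coeff 0) h
    rw [Polynomial.coeff_coe, hP, map_zero] at h1
    exact one_ne_zero h1
  have h2 := thetaOp_prod s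
  rw [← hPs, h, ← mul_neg] at h2
  have h3 := congrArg (PowerSeries.coeff k) (mul_left_cancel₀ hP0 h2)
  simpa [psumSeries, hk] using h3

theorem norm_le_of_power_sums_mul (s : Multiset ℂ) {C R : ℝ} (hR : 0 ≤ R) (s₀ : ℕ) {k₁ : ℕ}
    (hk₁ : k₁ ≠ 0) (h : ∀ k, s₀ ≤ k → ‖(s.map (· ^ (k₁ * k))).sum‖ ≤ C * R ^ (k₁ * k)) :
    ∀ z ∈ s, ‖z‖ ≤ R := by
  intro z hz
  have h1 := norm_le_of_power_sums (s.map (· ^ k₁)) (C := C) (pow_nonneg hR k₁) s₀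
    (fun k hk => by
      simpa only [Multiset.map_map, Function.comp_def, ← pow_mul] using h k hk)
    (z ^ k₁) (Multiset.mem_map_of_mem _ hz)
  rw [norm_pow] at h1
  exact le_of_pow_le_pow_left₀ hk₁ hR h1

end PowerSums

section FrobeniusFixed

variable (F : Type*) [Field F] [Fintype F] (K : Type*) [Field K] [Algebra F K]

open scoped Classical in
/-- The points of `K` fixed by the `k`-th power of the Frobenius. -/
noncomputable def frobFix (k : ℕ) : Finset K := (X ^ Fintype.card F ^ k - X : K[X]).roots.toFinset

variable {F K}

theorem mem_frobFix {k : ℕ} (hk : k ≠ 0) {x : K} :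
    x ∈ frobFix F K k ↔ x ^ Fintype.card F ^ k = x := by
  classical
  have h1 : 1 < Fintype.card F ^ k := Nat.one_lt_pow hk Fintype.one_lt_card
  rw [frobFix, Multiset.mem_toFinset, mem_roots (FiniteField.X_pow_card_sub_X_ne_zero K h1)]
  simp [sub_eq_zero]

theorem card_frobFix [IsAlgClosed K] {k : ℕ} (hk : k ≠ 0) :
    (frobFix F K k).card = Fintype.card F ^ k := by
  classical
  obtain ⟨p, hcharF, a, hpp, ha⟩ := FiniteField.card' F
  have hcharK : CharP K p := charP_of_injective_algebraMap (algebraMap F K).injective p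
  have h1 : 1 < Fintype.card F ^ k := Nat.one_lt_pow hk Fintype.one_lt_card
  have h2 : p ∣ Fintype.card F ^ k :=
    dvd_pow (ha ▸ dvd_pow_self p a.ne_zero) hk
  rw [frobFix, Multiset.toFinset_card_of_nodup (nodup_roots (galois_poly_separable p _ h2)),
    ← (IsAlgClosed.splits _).natDegree_eq_card_roots,
    FiniteField.X_pow_card_sub_X_natDegree_eq K h1]

theorem exists_algebraMap_eq_of_pow_card {c : K} (hc : c ^ Fintype.card F = c) :
    ∃ a : F, algebraMap F K a = c := by
  classical
  have h1 : 1 < Fintype.card F := Fintype.one_lt_card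
  have h0 : (X ^ Fintype.card F - X : K[X]) ≠ 0 := FiniteField.X_pow_card_sub_X_ne_zero K h1
  have h2 : Finset.univ.image (algebraMap F K) = (X ^ Fintype.card F - X : K[X]).roots.toFinset :=
      by
    refine Finset.eq_of_subset_of_card_le ?_ ?_
    · intro x hx
      obtain ⟨a, _, rfl⟩ := Finset.mem_image.1 hx
      rw [Multiset.mem_toFinset, mem_roots h0]
      simp [← map_pow, FiniteField.pow_card]
    · rw [Finset.card_image_of_injective _ (algebraMap F K).injective, Finset.card_univ]
      refine (Multiset.toFinset_card_le _).trans ((card_roots' _).trans ?_)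
      rw [FiniteField.X_pow_card_sub_X_natDegree_eq K h1]
  have h3 : c ∈ Finset.univ.image (algebraMap F K) := by
    rw [h2, Multiset.mem_toFinset, mem_roots h0]
    simp [hc]
  obtain ⟨a, _, ha⟩ := Finset.mem_image.1 h3
  exact ⟨a, ha⟩

theorem map_frobenius_frobPoly {k : ℕ} {x : K} (hx : x ^ Fintype.card F ^ k = x) :
    (frobPoly (Fintype.card F) x k).map (FiniteField.frobeniusAlgHom F K).toRingHom =
      frobPoly (Fintype.card F) x k := by
  have h1 : (frobPoly (Fintype.card F) x k).map (FiniteField.frobeniusAlgHom F K).toRingHom =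
      ∏ i ∈ Finset.range k, (X - C (x ^ Fintype.card F ^ (i + 1))) := by
    rw [frobPoly, Polynomial.map_prod]
    refine Finset.prod_congr rfl fun i _ => ?_
    rw [Polynomial.map_sub, map_X, map_C, pow_succ, pow_mul]
    rfl
  have h2 := Finset.prod_range_succ (fun i => X - C (x ^ Fintype.card F ^ i)) k
  rw [Finset.prod_range_succ', hx, pow_zero, pow_one] at h2
  rw [h1]
  exact mul_right_cancel₀ (X_sub_C_ne_zero x) h2

theorem exists_map_eq_frobPoly {k : ℕ} {x : K} (hx : x ^ Fintype.card F ^ k = x) :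
    ∃ f : F[X], f.map (algebraMap F K) = frobPoly (Fintype.card F) x k := by
  rw [← mem_lifts, lifts_iff_coeff_lifts]
  intro n
  refine exists_algebraMap_eq_of_pow_card ?_
  conv_rhs => rw [← map_frobenius_frobPoly hx, coeff_map]
  rfl

open scoped Classical in
/-- The norm to `F[X]` of `X - x`, for `x` fixed by the `k`-th power of the Frobenius. -/
noncomputable def normPoly (F : Type*) [Field F] [Fintype F] {K : Type*} [Field K] [Algebra F K]
    (k : ℕ) (x : K) : F[X] :=
  if h : ∃ f : F[X], f.map (algebraMap F K) = frobPoly (Fintype.card F) x k then h.choose else 0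

theorem map_normPoly {k : ℕ} {x : K} (hx : x ^ Fintype.card F ^ k = x) :
    (normPoly F k x).map (algebraMap F K) = frobPoly (Fintype.card F) x k := by
  have h := exists_map_eq_frobPoly hx
  rw [normPoly, dif_pos h]
  exact h.choose_spec

theorem normPoly_mem_monics {k : ℕ} {x : K} (hx : x ^ Fintype.card F ^ k = x) :
    normPoly F k x ∈ monics F k := by
  have h := map_normPoly hx
  rw [mem_monics]
  constructor
  · have h1 := frobPoly_monic (Fintype.card F) x k
    rw [← h] at h1
    exact (monic_map_iff).1 h1
  · rw [← natDegree_map (algebraMap F K), h, natDegree_frobPoly]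

theorem exists_pow_card_pow_eq {x : K} (hx : IsIntegral F x) :
    ∃ e, e ≠ 0 ∧ x ^ Fintype.card F ^ e = x := by
  have : FiniteDimensional F (IntermediateField.adjoin F {x}) :=
    IntermediateField.adjoin.finiteDimensional hx
  have : Finite (IntermediateField.adjoin F {x}) := Module.finite_of_finite F
  have := Fintype.ofFinite (IntermediateField.adjoin F {x})
  refine ⟨Module.finrank F (IntermediateField.adjoin F {x}), Module.finrank_pos.ne', ?_⟩
  rw [← Module.card_eq_pow_finrank (V := IntermediateField.adjoin F {x})]
  have h1 := FiniteField.pow_card (IntermediateField.AdjoinSimple.gen F x)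
  exact congrArg Subtype.val h1

theorem frobPoly_mul {e : ℕ} {x : K} (hx : x ^ Fintype.card F ^ e = x) (j : ℕ) :
    frobPoly (Fintype.card F) x (e * j) = frobPoly (Fintype.card F) x e ^ j := by
  induction j with
  | zero => simp [frobPoly]
  | succ j ih =>
    rw [pow_succ, ← ih, frobPoly, Nat.mul_succ, Finset.prod_range_add, frobPoly, frobPoly]
    congr 1
    refine Finset.prod_congr rfl fun i _ => ?_
    rw [pow_add, pow_mul, pow_mul _ e, pow_pow_eq_self hx]

theorem X_sub_C_pow_dvd_frobenius {f : F[X]} {x : K} {j : ℕ}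
    (h : (X - C x) ^ j ∣ f.map (algebraMap F K)) (i : ℕ) :
    (X - C (x ^ Fintype.card F ^ i)) ^ j ∣ f.map (algebraMap F K) := by
  have h1 := Polynomial.map_dvd (FiniteField.frobeniusAlgHom F K ^ i).toRingHom h
  rw [Polynomial.map_pow, Polynomial.map_sub, map_X, map_C, Polynomial.map_map] at h1
  have h2 : (FiniteField.frobeniusAlgHom F K ^ i).toRingHom.comp (algebraMap F K) =
      algebraMap F K := (FiniteField.frobeniusAlgHom F K ^ i).comp_algebraMap
  rw [h2] at h1
  rwa [← frobenius_pow_apply]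

open scoped Classical in
theorem card_filter_normPoly_dvd {f : F[X]} (hf : f.Monic) {x : K}
    (hx : (f.map (algebraMap F K)).IsRoot x) :
    ((Finset.Icc 1 f.natDegree).filter fun k =>
      x ^ Fintype.card F ^ k = x ∧ normPoly F k x ∣ f).card =
      (f.map (algebraMap F K)).rootMultiplicity x := by
  set q := Fintype.card F with hq
  set φ : K → K := fun y => FiniteField.frobeniusAlgHom F K y with hφ
  have hφinj : Function.Injective φ := (FiniteField.frobeniusAlgHom F K).injective
  have hφit : ∀ n y, φ^[n] y = y ^ q ^ n := fun n y => by
    have h : φ = ⇑(FiniteField.frobeniusAlgHom F K) := rfl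
    rw [← frobenius_pow_apply, h, AlgHom.coe_pow]
  set e := Function.minimalPeriod φ x with he
  have hxi : IsIntegral F x := ⟨f, hf, by rwa [IsRoot, eval_map] at hx⟩
  have hdvd : ∀ k, x ^ q ^ k = x ↔ e ∣ k := fun k => by
    rw [he, ← Function.isPeriodicPt_iff_minimalPeriod_dvd, Function.IsPeriodicPt,
      Function.IsFixedPt, hφit]
  have he0 : e ≠ 0 := by
    obtain ⟨e', h1, h2⟩ := exists_pow_card_pow_eq hxi
    rintro h
    rw [hdvd, h, zero_dvd_iff] at h2
    exact h1 h2
  have hxe : x ^ q ^ e = x := (hdvd e).2 dvd_rfl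
  have hf0 : f.map (algebraMap F K) ≠ 0 := (hf.map _).ne_zero
  have key : ∀ j, normPoly F (e * j) x ∣ f ↔ j ≤ (f.map (algebraMap F K)).rootMultiplicity x := by
    intro j
    rw [← map_dvd_map' (algebraMap F K), map_normPoly ((hdvd _).2 (dvd_mul_right e j)),
      frobPoly_mul hxe, le_rootMultiplicity_iff hf0]
    constructor
    · refine (pow_dvd_pow_of_dvd ?_ j).trans
      have h1 : (X - C (x ^ q ^ 0) : K[X]) ∣ frobPoly q x e :=
        Finset.dvd_prod_of_mem _ (Finset.mem_range.2 (Nat.pos_of_ne_zero he0))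
      simpa using h1
    · intro h
      rw [frobPoly, ← Finset.prod_pow]
      refine Finset.prod_dvd_of_coprime (fun a ha b hb hab => ?_) fun i _ =>
        X_sub_C_pow_dvd_frobenius h i
      refine IsCoprime.pow (isCoprime_X_sub_C_of_isUnit_sub ?_)
      rw [isUnit_iff_ne_zero, sub_ne_zero, ← hφit, ← hφit]
      intro h
      rw [Finset.coe_range] at ha hb
      exact hab (Function.iterate_injOn_Iio_minimalPeriod ha hb h)
  have h1 : ((Finset.Icc 1 f.natDegree).filter fun k => x ^ q ^ k = x ∧ normPoly F k x ∣ f) =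
      (Finset.Icc 1 ((f.map (algebraMap F K)).rootMultiplicity x)).image (e * ·) := by
    ext k
    simp only [Finset.mem_filter, Finset.mem_Icc, Finset.mem_image]
    constructor
    · rintro ⟨⟨hk1, _⟩, hk2, hk3⟩
      obtain ⟨j, rfl⟩ := (hdvd k).1 hk2
      refine ⟨j, ⟨Nat.pos_of_ne_zero ?_, (key j).1 hk3⟩, rfl⟩
      rintro rfl
      omega
    · rintro ⟨j, ⟨hj1, hj2⟩, rfl⟩
      have h2 := (hdvd _).2 (dvd_mul_right e j)
      refine ⟨⟨Nat.mul_pos (Nat.pos_of_ne_zero he0) hj1, ?_⟩, h2, (key j).2 hj2⟩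
      rw [← (mem_monics.1 (normPoly_mem_monics h2)).2]
      exact natDegree_le_of_dvd ((key j).2 hj2) hf.ne_zero
  refine (congrArg Finset.card h1).trans ?_
  rw [Finset.card_image_of_injective _ (mul_right_injective₀ he0), Nat.card_Icc,
    Nat.add_sub_cancel]

variable [IsAlgClosed K]

open scoped Classical in
theorem sum_card_normPoly_dvd {f : F[X]} (hf : f.Monic) :
    ∑ k ∈ Finset.Icc 1 f.natDegree, ((frobFix F K k).filter fun x => normPoly F k x ∣ f).card =
      f.natDegree := by
  have hf0 : f.map (algebraMap F K) ≠ 0 := (hf.map _).ne_zero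
  have h1 : ∀ k ∈ Finset.Icc 1 f.natDegree,
      ((frobFix F K k).filter fun x => normPoly F k x ∣ f).card =
      ((f.map (algebraMap F K)).roots.toFinset.filter fun x =>
        x ^ Fintype.card F ^ k = x ∧ normPoly F k x ∣ f).card := by
    intro k hk
    have hk0 : k ≠ 0 := by
      rw [Finset.mem_Icc] at hk
      omega
    congr 1
    ext x
    rw [Finset.mem_filter, Finset.mem_filter, mem_frobFix hk0, Multiset.mem_toFinset, mem_roots hf0]
    refine ⟨fun h => ⟨?_, h⟩, fun h => h.2⟩
    have h2 := Polynomial.map_dvd (algebraMap F K) h.2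
    rw [map_normPoly h.1] at h2
    rw [← dvd_iff_isRoot]
    refine dvd_trans ?_ h2
    have h3 : (X - C (x ^ Fintype.card F ^ 0) : K[X]) ∣ frobPoly (Fintype.card F) x k :=
        Finset.dvd_prod_of_mem _ (Finset.mem_range.2 (Nat.pos_of_ne_zero hk0))
    simpa using h3
  rw [Finset.sum_congr rfl h1]
  simp_rw [Finset.card_filter]
  rw [Finset.sum_comm]
  have h2 : ∀ x ∈ (f.map (algebraMap F K)).roots.toFinset, (∑ k ∈ Finset.Icc 1 f.natDegree,
      if x ^ Fintype.card F ^ k = x ∧ normPoly F k x ∣ f then 1 else 0) =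
      (f.map (algebraMap F K)).roots.count x := by
    intro x hx
    rw [Multiset.mem_toFinset, mem_roots hf0] at hx
    rw [← Finset.card_filter, card_filter_normPoly_dvd hf hx, count_roots]
  rw [Finset.sum_congr rfl h2, Multiset.toFinset_sum_count_eq,
    ← (IsAlgClosed.splits _).natDegree_eq_card_roots, natDegree_map]

theorem sum_monics_dvd {M : Type*} [AddCommMonoid M] {k m : ℕ} {n : F[X]} (hn : n ∈ monics F k)
    (hkm : k ≤ m) [DecidablePred fun f => n ∣ f] (g : F[X] → M) :
    ∑ f ∈ (monics F m).filter (fun f => n ∣ f), g f = ∑ w ∈ monics F (m - k), g (n * w) := by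
  symm
  refine Finset.sum_bij (fun w _ => n * w) ?_ ?_ ?_ fun _ _ => rfl
  · intro w hw
    refine Finset.mem_filter.2 ⟨?_, dvd_mul_right _ _⟩
    have := mul_mem_monics hn hw
    rwa [Nat.add_sub_cancel' hkm] at this
  · intro w _ w' _ h
    exact mul_left_cancel₀ (mem_monics.1 hn).1.ne_zero h
  · intro f hf
    obtain ⟨hf, w, rfl⟩ := Finset.mem_filter.1 hf
    rw [mem_monics] at hf hn
    have hw : w.Monic := hn.1.of_mul_monic_left hf.1
    refine ⟨w, mem_monics.2 ⟨hw, ?_⟩, rfl⟩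
    have := hf.2
    rw [hn.1.natDegree_mul hw, hn.2] at this
    omega

theorem newton_monics (ψ : F[X] → ℂ) (hψ : ∀ f g, ψ (f * g) = ψ f * ψ g) (m : ℕ) :
    (m : ℂ) * ∑ f ∈ monics F m, ψ f =
      ∑ k ∈ Finset.Icc 1 m, (∑ x ∈ frobFix F K k, ψ (normPoly F k x)) *
        ∑ w ∈ monics F (m - k), ψ w := by
  classical
  have h1 : ∀ f ∈ monics F m, (m : ℂ) * ψ f =
      ∑ k ∈ Finset.Icc 1 m, ∑ x ∈ frobFix F K k, if normPoly F k x ∣ f then ψ f else 0 := by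
    intro f hf
    rw [mem_monics] at hf
    have h2 := sum_card_normPoly_dvd (K := K) hf.1
    rw [hf.2] at h2
    conv_lhs => rw [← h2]
    push_cast
    rw [Finset.sum_mul]
    refine Finset.sum_congr rfl fun k _ => ?_
    rw [← Finset.sum_filter, Finset.sum_const, nsmul_eq_mul]
  rw [Finset.mul_sum, Finset.sum_congr rfl h1, Finset.sum_comm]
  refine Finset.sum_congr rfl fun k hk => ?_
  rw [Finset.mem_Icc] at hk
  rw [Finset.sum_comm, Finset.sum_mul]
  refine Finset.sum_congr rfl fun x hx => ?_
  rw [mem_frobFix (by omega)] at hx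
  rw [← Finset.sum_filter, sum_monics_dvd (normPoly_mem_monics hx) hk.2, Finset.mul_sum]
  exact Finset.sum_congr rfl fun w _ => hψ _ _

end FrobeniusFixed

section CongruenceClasses

variable {F : Type*} [Field F] [Fintype F] {R : Type*} [CommRing R] [Algebra F R]

/-- The value of `homEval U V m` on the polynomials of degree less than `m`, as an additive map on
coefficient vectors. -/
noncomputable def homEvalLow (F : Type*) [Field F] {R : Type*} [CommRing R] [Algebra F R] (U V : R)
    (m : ℕ) : (Fin m → F) →+ R where
  toFun x := ∑ i : Fin m, x i • (U ^ (i : ℕ) * V ^ (m - i))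
  map_zero' := by simp
  map_add' x y := by simp [add_smul, Finset.sum_add_distrib]

theorem homEval_X_pow_add_lowPoly (U V : R) (m : ℕ) (x : Fin m → F) :
    homEval U V m (X ^ m + lowPoly F m x) = U ^ m + homEvalLow F U V m x := by
  have h0 : (lowPoly F m x).coeff m = 0 :=
    coeff_eq_zero_of_degree_lt (degree_lowPoly_lt x)
  rw [homEval, Finset.sum_range_succ, add_comm, coeff_add, h0, coeff_X_pow_self, add_zero, one_smul,
    Nat.sub_self, pow_zero, mul_one, homEvalLow, AddMonoidHom.coe_mk, ZeroHom.coe_mk,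
    Finset.sum_range]
  congr 1
  refine Finset.sum_congr rfl fun i _ => ?_
  rw [coeff_add, coeff_lowPoly, coeff_X_pow, if_neg i.2.ne, zero_add]

theorem homEval_lowPoly (U V : R) (m : ℕ) (x : Fin m → F) :
    homEval U V m (lowPoly F m x) = homEvalLow F U V m x := by
  have h0 : (lowPoly F m x).coeff m = 0 :=
    coeff_eq_zero_of_degree_lt (degree_lowPoly_lt x)
  rw [homEval, Finset.sum_range_succ, h0, zero_smul, add_zero, homEvalLow, AddMonoidHom.coe_mk,
    ZeroHom.coe_mk, Finset.sum_range]
  exact Finset.sum_congr rfl fun i _ => by rw [coeff_lowPoly]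

theorem dvd_homEvalLow (U V : R) (m : ℕ) (x : Fin m → F) : V ∣ homEvalLow F U V m x := by
  rw [homEvalLow, AddMonoidHom.coe_mk, ZeroHom.coe_mk]
  refine Finset.dvd_sum fun i _ => ?_
  rw [← mul_smul_comm, Algebra.smul_def]
  exact Dvd.dvd.mul_left (Dvd.dvd.mul_left (dvd_pow_self V (by omega)) _) _

theorem dvd_homEval_sub_one {U V : R} (hUV : V ∣ U - 1) {m : ℕ} {f : F[X]} (hf : f ∈ monics F m) :
    V ∣ homEval U V m f - 1 := by
  classical
  have hUm : V ∣ U ^ m - 1 := hUV.trans (by simpa using sub_dvd_pow_sub_pow U 1 m)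
  rw [monics, lows, Finset.image_image, Finset.mem_image] at hf
  obtain ⟨x, _, rfl⟩ := hf
  have := dvd_add hUm (dvd_homEvalLow U V m x)
  rwa [sub_add_eq_add_sub, ← homEval_X_pow_add_lowPoly] at this

variable [Fintype R]

open scoped Classical in
theorem card_mul_sum_monics_homEval {U V : R} (hUV : V ∣ U - 1) {m : ℕ}
    (hsurj : ∀ r, ∃ x, homEvalLow F U V m x = V * r) (φ : R → ℂ) :
    ((Finset.univ.filter fun r => V ∣ r - 1).card : ℂ) * ∑ f ∈ monics F m, φ (homEval U V m f) =
      (Fintype.card F : ℂ) ^ m * ∑ r ∈ Finset.univ.filter (fun r => V ∣ r - 1), φ r := by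
  have hUm : V ∣ U ^ m - 1 := hUV.trans (by simpa using sub_dvd_pow_sub_pow U 1 m)
  have hdvd : ∀ x, V ∣ homEvalLow F U V m x := dvd_homEvalLow U V m
  have hE : ∀ r, V ∣ r - 1 ↔ r ∈ Finset.univ.image fun x => U ^ m + homEvalLow F U V m x := by
    intro r
    simp only [Finset.mem_image, Finset.mem_univ, true_and]
    constructor
    · intro h
      obtain ⟨s, hs⟩ := h.sub hUm
      obtain ⟨x, hx⟩ := hsurj s
      exact ⟨x, by rw [hx, ← hs]; ring⟩
    · rintro ⟨x, rfl⟩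
      have := dvd_add hUm (hdvd x)
      rwa [sub_add_eq_add_sub] at this
  have hfib : ∀ r, V ∣ r - 1 → (Finset.univ.filter fun x => U ^ m + homEvalLow F U V m x = r).card =
      (Finset.univ.filter fun x => homEvalLow F U V m x = 0).card := by
    intro r hr
    rw [hE] at hr
    obtain ⟨y, _, rfl⟩ := Finset.mem_image.1 hr
    simp only [add_right_inj]
    exact AddMonoidHom.card_fiber_eq_of_mem_range (homEvalLow F U V m) ⟨y, rfl⟩ ⟨0, map_zero _⟩
  have hmain : ∀ φ : R → ℂ, ∑ f ∈ monics F m, φ (homEval U V m f) =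
      ((Finset.univ.filter fun x => homEvalLow F U V m x = 0).card : ℂ) *
        ∑ r ∈ Finset.univ.filter (fun r => V ∣ r - 1), φ r := by
    intro φ
    rw [sum_monics, lows, Finset.sum_image (lowPoly_injective m).injOn]
    simp_rw [homEval_X_pow_add_lowPoly]
    rw [← Finset.sum_fiberwise_of_maps_to (s := Finset.univ)
      (t := Finset.univ.filter fun r => V ∣ r - 1)
      (g := fun x => U ^ m + homEvalLow F U V m x), Finset.mul_sum]
    · refine Finset.sum_congr rfl fun r hr => ?_
      rw [Finset.sum_congr rfl (g := fun _ => φ r)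
        (fun x hx => by rw [(Finset.mem_filter.1 hx).2]), Finset.sum_const, nsmul_eq_mul,
        hfib r (Finset.mem_filter.1 hr).2]
    · intro x _
      rw [Finset.mem_filter, hE]
      exact ⟨Finset.mem_univ _, Finset.mem_image_of_mem _ (Finset.mem_univ x)⟩
  have h1 := hmain fun _ => 1
  rw [Finset.sum_const, card_monics, Finset.sum_const, nsmul_eq_mul, nsmul_eq_mul, mul_one,
    mul_one] at h1
  push_cast at h1
  rw [hmain φ, h1]
  ring

open scoped Classical in
theorem sum_filter_mulChar_eq_zero {V : R} {χ : MulChar R ℂ} {u : R} (hu : V ∣ u - 1)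
    (h0 : χ u ≠ 0) (h1 : χ u ≠ 1) : ∑ r ∈ Finset.univ.filter (fun r => V ∣ r - 1), χ r = 0 := by
  have hunit : IsUnit u := by
    by_contra h
    exact h0 (χ.map_nonunit h)
  have h2 : ∑ r ∈ Finset.univ.filter (fun r => V ∣ r - 1), χ (u * r) =
      ∑ r ∈ Finset.univ.filter (fun r => V ∣ r - 1), χ r := by
    have h3 : (Finset.univ.filter (fun r => V ∣ r - 1)).image (u * ·) =
        Finset.univ.filter (fun r => V ∣ r - 1) := by
      refine Finset.eq_of_subset_of_card_le ?_ ?_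
      · intro r hr
        obtain ⟨s, hs, rfl⟩ := Finset.mem_image.1 hr
        rw [Finset.mem_filter] at hs ⊢
        refine ⟨Finset.mem_univ _, ?_⟩
        have : u * s - 1 = u * (s - 1) + (u - 1) := by ring
        rw [this]
        exact dvd_add (hs.2.mul_left _) hu
      · rw [Finset.card_image_of_injective _ hunit.mul_right_injective]
    conv_rhs => rw [← h3]
    rw [Finset.sum_image hunit.mul_right_injective.injOn]
  simp_rw [map_mul] at h2
  rw [← Finset.mul_sum] at h2
  by_contra h
  exact h1 (mul_right_cancel₀ h (by rw [h2, one_mul]))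

end CongruenceClasses

section FrobeniusSums

variable {F : Type*} [Field F] [Fintype F] {R : Type*} [CommRing R] [Fintype R] [Algebra F R]
  {K : Type*} [Field K] [IsAlgClosed K] [Algebra F K]

theorem norm_mulChar_le_one (χ : MulChar R ℂ) (r : R) : ‖χ r‖ ≤ 1 := by
  by_cases h : IsUnit r
  · obtain ⟨u, rfl⟩ := h
    refine (Complex.norm_eq_one_of_pow_eq_one (n := orderOf u) ?_ (orderOf_pos u).ne').le
    rw [← map_pow, ← Units.val_pow_eq_pow_val, pow_orderOf_eq_one, Units.val_one, map_one]
  · rw [χ.map_nonunit h, norm_zero]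
    exact zero_le_one

theorem exists_norm_sum_mulChar_sub_le [Algebra.IsAlgebraic F K] {U V : R} {Z : Finset K}
    (hZ : ∀ k, k ≠ 0 → ∀ x : K, x ^ Fintype.card F ^ k = x → x ∉ Z →
      IsUnit (homEval U V k (normPoly F k x))) (χ : MulChar R ℂ) :
    ∃ δ : ℂ, (δ = 0 ∨ δ = 1) ∧ ∃ (k₁ s₀ : ℕ) (C : ℝ), k₁ ≠ 0 ∧ ∀ s, s₀ ≤ s →
      ‖(∑ x ∈ frobFix F K (k₁ * s), χ (homEval U V (k₁ * s) (normPoly F (k₁ * s) x))) -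
        δ * (Fintype.card F : ℂ) ^ (k₁ * s)‖ ≤
        C * ((Fintype.card F : ℝ) ^ (3 / 4 : ℝ)) ^ (k₁ * s) := by
  classical
  obtain ⟨x₀, hx₀Z⟩ := Infinite.exists_notMem_finset Z
  obtain ⟨e, he, hx₀⟩ := exists_pow_card_pow_eq (Algebra.IsIntegral.isIntegral (R := F) x₀)
  obtain ⟨H, k₀, C, s₀, hk₀, hcard⟩ := exists_subgroup_card_frobenius_le U V
    (Nat.pos_of_ne_zero he) hx₀ (map_normPoly hx₀) (hZ e he x₀ hx₀ hx₀Z)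
  set q := Fintype.card F with hq
  have hq1 : 1 ≤ q := Fintype.card_pos
  have hH0 : (0 : ℝ) < Nat.card H := by exact_mod_cast Nat.card_pos
  have hH0' : (Nat.card H : ℂ) ≠ 0 := by exact_mod_cast hH0.ne'
  set σ : ℂ := ∑ g : H, χ (g : Rˣ) with hσ
  have hσ' : σ = ∑ g : Rˣ, if g ∈ H then χ g else 0 := by
    rw [hσ, ← Finset.sum_filter]
    symm
    exact Finset.sum_subtype (Finset.univ.filter fun g => g ∈ H) (fun g => by simp)
      fun g : Rˣ => χ g
  have hδ : σ / Nat.card H = 0 ∨ σ / Nat.card H = 1 := by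
    have h1 := sum_hom_units (G := H) (R := ℂ)
      ((χ : R →* ℂ).comp ((Units.coeHom R).comp H.subtype))
    have h2 : σ = ∑ g : H, ((χ : R →* ℂ).comp ((Units.coeHom R).comp H.subtype)) g := rfl
    rw [h2, h1]
    split_ifs with h
    · right
      rw [← Nat.card_eq_fintype_card]
      exact div_self hH0'
    · left
      simp
  refine ⟨σ / Nat.card H, hδ, k₀ * 4, s₀ + 1, 2 * C + Z.card + 2 * Fintype.card Rˣ * C,
    by omega, fun s hs => ?_⟩
  have hs' : s₀ ≤ s := by omega
  have hk : k₀ * 4 * s = k₀ * (s * 4) := by ring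
  have hkn : k₀ * (s * 4) ≠ 0 := by
    have : s * 4 ≠ 0 := by omega
    exact Nat.mul_ne_zero hk₀.ne' this
  have hpow : ((q : ℝ) ^ (3 / 4 : ℝ)) ^ (k₀ * (s * 4)) = (q : ℝ) ^ (k₀ * (s * 3)) := by
    rw [← Real.rpow_natCast, ← Real.rpow_mul (by positivity), ← Real.rpow_natCast]
    congr 1
    push_cast
    ring
  rw [hk, hpow]
  set k := k₀ * (s * 4) with hkdef
  set Q3 : ℝ := (q : ℝ) ^ (k₀ * (s * 3)) with hQ3
  have hQ31 : 1 ≤ Q3 := one_le_pow₀ (by exact_mod_cast hq1)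
  set η : K → R := fun x => homEval U V k (normPoly F k x) with hη
  set n : Rˣ → ℕ := fun g => ((frobFix F K k).filter fun x => η x = g).card with hn
  have hclass := fun g => hcard s hs' g ((frobFix F K k).filter fun x => η x = g) (fun x hx => by
    rw [Finset.mem_filter, mem_frobFix hkn] at hx
    exact ⟨hx.1, _, map_normPoly hx.1, hx.2⟩)
  have hSn : ∑ x ∈ frobFix F K k, χ (η x) = ∑ g : Rˣ, (n g : ℂ) * χ g := by
    have h1 : ∀ x, χ (η x) = ∑ g : Rˣ, if η x = g then χ g else 0 := by
      intro x
      by_cases hu : IsUnit (η x)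
      · obtain ⟨u, hu⟩ := hu
        rw [← hu]
        simp [Units.val_inj]
      · rw [χ.map_nonunit hu]
        refine (Finset.sum_eq_zero fun g _ => if_neg ?_).symm
        exact fun h => hu ⟨g, h.symm⟩
    simp_rw [h1]
    rw [Finset.sum_comm]
    refine Finset.sum_congr rfl fun g _ => ?_
    rw [← Finset.sum_filter, Finset.sum_const, nsmul_eq_mul]
  have hnsum : (q : ℝ) ^ k - Z.card ≤ ∑ g : Rˣ, (n g : ℝ) := by
    have h1 : frobFix F K k ⊆ Z ∪ (Finset.univ.biUnion fun g : Rˣ =>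
        (frobFix F K k).filter fun x => η x = g) := by
      intro x hx
      by_cases hxZ : x ∈ Z
      · exact Finset.mem_union_left _ hxZ
      · obtain ⟨u, hu⟩ := hZ k hkn x ((mem_frobFix hkn).1 hx) hxZ
        refine Finset.mem_union_right _ (Finset.mem_biUnion.2 ⟨u, Finset.mem_univ _, ?_⟩)
        exact Finset.mem_filter.2 ⟨hx, hu.symm⟩
    have h2 := (Finset.card_le_card h1).trans ((Finset.card_union_le _ _).trans
      (Nat.add_le_add_left Finset.card_biUnion_le _))
    rw [card_frobFix hkn] at h2
    have h3 : ((q ^ k : ℕ) : ℝ) ≤ ((Z.card + ∑ g : Rˣ, n g : ℕ) : ℝ) := by exact_mod_cast h2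
    push_cast at h3
    linarith
  set A : ℝ := ((q : ℝ) ^ k + C * Q3) / Nat.card H with hA
  have hterm : ∀ g : Rˣ, ‖((n g : ℂ) - if g ∈ H then (A : ℂ) else 0) * χ g‖ ≤
      (if g ∈ H then A else 0) - n g + 2 * C := by
    intro g
    rw [norm_mul]
    refine (mul_le_of_le_one_right (norm_nonneg _) (norm_mulChar_le_one χ _)).trans ?_
    split_ifs with hg
    · have h1 : (n g : ℝ) ≤ A := by
        rw [hA, le_div_iff₀ hH0, mul_comm, hQ3]
        exact_mod_cast (hclass g).1 hg
      rw [← Complex.ofReal_natCast, ← Complex.ofReal_sub, Complex.norm_real, Real.norm_eq_abs,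
        abs_sub_comm, abs_of_nonneg (by linarith)]
      have : (0 : ℝ) ≤ C := Nat.cast_nonneg C
      linarith
    · have h1 : (n g : ℝ) ≤ C := by exact_mod_cast (hclass g).2 hg
      rw [sub_zero, Complex.norm_natCast]
      linarith
  have hHsum : ∑ g : Rˣ, (if g ∈ H then A else 0) = (q : ℝ) ^ k + C * Q3 := by
    rw [← Finset.sum_filter, Finset.sum_const, nsmul_eq_mul]
    have : (Finset.univ.filter fun g => g ∈ H).card = Nat.card H := by
      rw [Nat.card_eq_fintype_card, Fintype.card_subtype]
    rw [this, hA, mul_div_cancel₀ _ hH0.ne']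
  have hbound : ‖∑ g : Rˣ, ((n g : ℂ) - if g ∈ H then (A : ℂ) else 0) * χ g‖ ≤
      C * Q3 + Z.card + 2 * Fintype.card Rˣ * C := by
    refine (norm_sum_le _ _).trans ((Finset.sum_le_sum fun g _ => hterm g).trans ?_)
    rw [Finset.sum_add_distrib, Finset.sum_sub_distrib, hHsum, Finset.sum_const, nsmul_eq_mul,
      Finset.card_univ]
    linarith
  have hdecomp : (∑ x ∈ frobFix F K k, χ (η x)) - σ / Nat.card H * (q : ℂ) ^ k =
      (∑ g : Rˣ, ((n g : ℂ) - if g ∈ H then (A : ℂ) else 0) * χ g) +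
        σ / Nat.card H * (C * Q3 : ℝ) := by
    rw [hSn]
    simp_rw [sub_mul, ite_mul, zero_mul]
    rw [Finset.sum_sub_distrib]
    have h1 : (∑ g : Rˣ, if g ∈ H then (A : ℂ) * χ g else 0) = A * σ := by
      rw [hσ', Finset.mul_sum]
      exact Finset.sum_congr rfl fun g _ => by rw [mul_ite, mul_zero]
    rw [h1, hA]
    push_cast
    field_simp
    ring
  rw [hdecomp]
  refine (norm_add_le _ _).trans ?_
  have h1 : ‖σ / Nat.card H * (C * Q3 : ℝ)‖ ≤ C * Q3 := by
    rw [norm_mul, Complex.norm_real, Real.norm_eq_abs, abs_of_nonneg (by positivity)]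
    refine mul_le_of_le_one_left (by positivity) ?_
    rcases hδ with h | h <;> rw [h] <;> simp
  have h2 : (0 : ℝ) ≤ Z.card + 2 * Fintype.card Rˣ * C := by positivity
  nlinarith [hbound, h1, hQ31, h2]

end FrobeniusSums

section MoebiusSums

variable {F : Type*} [Field F] [Fintype F]

theorem mk_sum_polyMu_mul_mk (ψ : F[X] →* ℂ) :
    (PowerSeries.mk fun m => ∑ f ∈ monics F m, (polyMu f : ℂ) * ψ f) *
      (PowerSeries.mk fun m => ∑ f ∈ monics F m, ψ f) = 1 := by
  ext m
  rw [PowerSeries.coeff_mul, PowerSeries.coeff_one]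
  simp only [PowerSeries.coeff_mk]
  have h1 := sum_monics_monicPairs (F := F) m fun a w => (polyMu a : ℂ) * ψ a * ψ w
  simp only [← Finset.mul_sum, ← Finset.sum_mul] at h1
  rw [← h1]
  have h2 : ∀ f ∈ monics F m, ∑ k ∈ monicPairs f, (polyMu k.1 : ℂ) * ψ k.1 * ψ k.2 =
      if m = 0 then 1 else 0 := by
    intro f hf
    rw [mem_monics] at hf
    have h3 : ∑ k ∈ monicPairs f, (polyMu k.1 : ℂ) * ψ k.1 * ψ k.2 =
        (∑ k ∈ monicPairs f, polyMu k.1 : ℤ) * ψ f := by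
      push_cast
      rw [Finset.sum_mul]
      refine Finset.sum_congr rfl fun k hk => ?_
      rw [← (mem_monicPairs.1 hk).2.2, map_mul, mul_assoc]
    rw [h3]
    split_ifs with hm
    · have hf1 : f = 1 := by
        rw [hm, ← mem_monics, monics_zero, Finset.mem_singleton] at hf
        exact hf
      have h4 : monicPairs (1 : F[X]) = {(1, 1)} := by
        ext k
        rw [mem_monicPairs, Finset.mem_singleton]
        constructor
        · rintro ⟨h1, h2, h3⟩
          have := h1.eq_one_of_isUnit (IsUnit.of_mul_eq_one _ h3)
          exact Prod.ext this (by rwa [this, one_mul] at h3)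
        · rintro rfl
          exact ⟨monic_one, monic_one, mul_one 1⟩
      rw [hf1, h4, Finset.sum_singleton, polyMu_one, map_one, Int.cast_one, one_mul]
    · rw [sum_monicPairs_polyMu hf.1 (by rintro rfl; exact hm (by simpa using hf.2.symm)),
        Int.cast_zero, zero_mul]
  rw [Finset.sum_congr rfl h2]
  split_ifs with hm
  · rw [hm, monics_zero, Finset.sum_singleton]
  · exact Finset.sum_const_zero

theorem thetaOp_mk_sum (K : Type*) [Field K] [IsAlgClosed K] [Algebra F K] (ψ : F[X] →* ℂ) :
    thetaOp (PowerSeries.mk fun m => ∑ f ∈ monics F m, ψ f) =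
      (PowerSeries.mk fun m => ∑ f ∈ monics F m, ψ f) *
      PowerSeries.mk fun k => if k = 0 then 0 else ∑ x ∈ frobFix F K k, ψ (normPoly F k x) := by
  ext m
  rw [thetaOp, PowerSeries.coeff_mk, PowerSeries.coeff_mk, newton_monics (K := K) ψ (map_mul ψ),
    mul_comm (PowerSeries.mk _), PowerSeries.coeff_mul,
    Finset.Nat.sum_antidiagonal_eq_sum_range_succ_mk]
  simp only [PowerSeries.coeff_mk]
  rw [Finset.sum_range_succ', if_pos rfl, zero_mul, add_zero]
  refine Finset.sum_nbij' (· - 1) (· + 1) ?_ ?_ ?_ ?_ ?_ <;>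
    simp only [Finset.mem_Icc, Finset.mem_range] <;> intro k hk
  · omega
  · omega
  · omega
  · omega
  · rw [Nat.sub_add_cancel hk.1, if_neg (by omega)]

variable {R : Type*} [CommRing R] [Fintype R] [Algebra F R] {K : Type*} [Field K] [IsAlgClosed K]
  [Algebra F K]

open scoped Classical in
theorem norm_sum_polyMu_mulChar_le [Algebra.IsAlgebraic F K] {U V : R} (hUV : V ∣ U - 1) {D : ℕ}
    (hsurj : ∀ m, D ≤ m → ∀ r, ∃ x, homEvalLow F U V m x = V * r) {Z : Finset K}
    (hZ : ∀ k, k ≠ 0 → ∀ x : K, x ^ Fintype.card F ^ k = x → x ∉ Z →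
      IsUnit (homEval U V k (normPoly F k x)))
    (ev : F[X] →* R) (hev : ∀ m, ∀ f ∈ monics F m, ev f = homEval U V m f) (χ : MulChar R ℂ)
    (m : ℕ) :
    ‖∑ f ∈ monics F m, (polyMu f : ℂ) * χ (ev f)‖ ≤
      8 ^ D * (1 + Fintype.card F) * (8 / 7 * (Fintype.card F : ℝ) ^ (3 / 4 : ℝ)) ^ m := by
  set q := Fintype.card F with hq
  have hq1 : 1 < q := Fintype.one_lt_card
  have hq1' : (1 : ℝ) < q := by exact_mod_cast hq1
  set ρ : ℝ := (q : ℝ) ^ (3 / 4 : ℝ) with hρ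
  have hρ1 : 1 ≤ ρ := Real.one_le_rpow hq1'.le (by norm_num)
  have hρq : ρ < q := by
    conv_rhs => rw [← Real.rpow_one (q : ℝ)]
    exact Real.rpow_lt_rpow_of_exponent_lt hq1' (by norm_num)
  set ψ : F[X] →* ℂ := (χ : R →* ℂ).comp ev with hψ
  have hψχ : ∀ f, ψ f = χ (ev f) := fun f => rfl
  set L : PowerSeries ℂ := PowerSeries.mk fun m => ∑ f ∈ monics F m, ψ f with hL
  set S : ℕ → ℂ := fun k => ∑ x ∈ frobFix F K k, ψ (normPoly F k x) with hS
  have hSeval : ∀ k, k ≠ 0 → S k = ∑ x ∈ frobFix F K k, χ (homEval U V k (normPoly F k x)) :=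
    fun k hk => Finset.sum_congr rfl fun x hx => by
      rw [hψχ, hev k _ (normPoly_mem_monics ((mem_frobFix hk).1 hx))]
  set E : Finset R := Finset.univ.filter fun r => V ∣ r - 1 with hE
  have hE0 : (E.card : ℂ) ≠ 0 := by
    rw [Nat.cast_ne_zero, Finset.card_ne_zero]
    exact ⟨1, by simp [hE]⟩
  have hLm : ∀ m, D ≤ m → PowerSeries.coeff m L = (q : ℂ) ^ m * ((∑ r ∈ E, χ r) / E.card) := by
    intro m hm
    have h1 := card_mul_sum_monics_homEval hUV (hsurj m hm) χ
    rw [hL, PowerSeries.coeff_mk, Finset.sum_congr rfl fun f hf => by rw [hψχ, hev m f hf],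
      mul_div_assoc', eq_div_iff hE0, ← h1, mul_comm]
  obtain ⟨δ, hδ, hδL, hδroots⟩ : ∃ δ : ℂ, (δ = 0 ∨ δ = 1) ∧
      (δ = 0 → ∑ r ∈ E, χ r = 0) ∧ ∀ s : Multiset ℂ,
      (∀ k, k ≠ 0 → S k - (δ * q) ^ k = -(s.map (· ^ k)).sum) → ∀ z ∈ s, ‖z‖ ≤ ρ := by
    by_cases hcase : ∀ m, ∀ f ∈ monics F m, χ (ev f) ≠ 0 → χ (ev f) = 1
    · refine ⟨1, Or.inr rfl, fun h => absurd h one_ne_zero, fun s hs => ?_⟩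
      refine norm_le_of_power_sums s (C := Z.card) (by linarith) 1 fun k hk => ?_
      have hk0 : k ≠ 0 := by omega
      rw [← norm_neg, ← hs k hk0, hSeval k hk0, one_mul]
      have h1 : (q : ℂ) ^ k = ∑ x ∈ frobFix F K k, 1 := by
        rw [Finset.sum_const, card_frobFix hk0]
        simp [hq]
      rw [h1, ← Finset.sum_sub_distrib]
      have h2 : ∀ x ∈ frobFix F K k, χ (homEval U V k (normPoly F k x)) - 1 =
          if x ∈ Z then χ (homEval U V k (normPoly F k x)) - 1 else 0 := by
        intro x hx
        rw [mem_frobFix hk0] at hx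
        split_ifs with hxZ
        · rfl
        · rw [← hev k _ (normPoly_mem_monics hx), hcase k _ (normPoly_mem_monics hx), sub_self]
          rw [hev k _ (normPoly_mem_monics hx)]
          exact ((hZ k hk0 x hx hxZ).map χ).ne_zero
      rw [Finset.sum_congr rfl h2, ← Finset.sum_filter]
      refine (norm_sum_le_of_le (f := fun x => χ (homEval U V k (normPoly F k x)) - 1) _
        (n := fun _ => 1) fun x hx => ?_).trans ?_
      · rw [Finset.mem_filter, mem_frobFix hk0] at hx
        by_cases h0 : χ (ev (normPoly F k x)) = 0
        · rw [← hev k _ (normPoly_mem_monics hx.1), h0]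
          simp
        · rw [← hev k _ (normPoly_mem_monics hx.1), hcase k _ (normPoly_mem_monics hx.1) h0]
          simp
      · rw [Finset.sum_const, nsmul_eq_mul, mul_one]
        have h3 : ((frobFix F K k).filter (· ∈ Z)).card ≤ Z.card :=
          Finset.card_le_card fun x hx => (Finset.mem_filter.1 hx).2
        have h4 : (((frobFix F K k).filter (· ∈ Z)).card : ℝ) ≤ Z.card := by exact_mod_cast h3
        exact h4.trans (le_mul_of_one_le_right (by positivity) (one_le_pow₀ hρ1))
    · push Not at hcase
      obtain ⟨m₀, f₀, hf₀, hf₀0, hf₀1⟩ := hcase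
      refine ⟨0, Or.inl rfl, fun _ => ?_, fun s hs => ?_⟩
      · refine sum_filter_mulChar_eq_zero ?_ hf₀0 hf₀1
        rw [hev m₀ f₀ hf₀]
        exact dvd_homEval_sub_one hUV hf₀
      · obtain ⟨δ, hδ, k₁, s₀, C, hk₁, hC⟩ := exists_norm_sum_mulChar_sub_le hZ χ
        have hs' : ∀ k, k ≠ 0 → S k = -(s.map (· ^ k)).sum := fun k hk => by
          rw [← hs k hk, zero_mul, zero_pow hk, sub_zero]
        rcases hδ with rfl | rfl
        · refine norm_le_of_power_sums_mul s (by linarith) (s₀ + 1) hk₁ (C := C) fun k hk => ?_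
          have hk0 : k₁ * k ≠ 0 := Nat.mul_ne_zero hk₁ (by omega)
          have h1 := hC k (by omega)
          rw [zero_mul, sub_zero, ← hSeval _ hk0, hs' _ hk0, norm_neg] at h1
          exact h1
        · exfalso
          have h2 := norm_le_of_power_sums_mul ((q : ℂ) ::ₘ s) (by linarith) (s₀ + 1) hk₁ (C := C)
            (R := ρ) fun k hk => by
              have hk0 : k₁ * k ≠ 0 := Nat.mul_ne_zero hk₁ (by omega)
              have h1 := hC k (by omega)
              rw [one_mul, ← hSeval _ hk0, hs' _ hk0, ← norm_neg, neg_sub, sub_neg_eq_add] at h1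
              rwa [Multiset.map_cons, Multiset.sum_cons]
          have h3 := h2 q (Multiset.mem_cons_self _ _)
          rw [Complex.norm_natCast] at h3
          linarith
  set P : ℂ[X] := PowerSeries.trunc (D + 1) ((1 - PowerSeries.C (δ * q) * PowerSeries.X) * L) with hP
  have hPL : (P : PowerSeries ℂ) = (1 - PowerSeries.C (δ * q) * PowerSeries.X) * L := by
    ext m
    rw [hP, coeff_coe, PowerSeries.coeff_trunc]
    split_ifs with hm
    · rfl
    · obtain ⟨m, rfl⟩ : ∃ m', m = m' + 1 := ⟨m - 1, by omega⟩
      rw [sub_mul, one_mul, mul_assoc, map_sub, PowerSeries.coeff_C_mul,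
        PowerSeries.coeff_succ_X_mul, hLm _ (by omega), hLm m (by omega)]
      rcases hδ with rfl | rfl
      · rw [hδL rfl]
        simp
      · ring
  have hPdeg : P.natDegree ≤ D := by
    rw [hP]
    exact Nat.lt_succ_iff.1 (PowerSeries.natDegree_trunc_lt _ _)
  have hP0 : P.coeff 0 = 1 := by
    rw [hP, PowerSeries.coeff_trunc, if_pos (by omega), sub_mul, one_mul, mul_assoc, map_sub,
      PowerSeries.coeff_C_mul, PowerSeries.coeff_zero_X_mul, hL, PowerSeries.coeff_mk, monics_zero,
      Finset.sum_singleton, map_one]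
    simp
  have hprod : ∀ a : ℂ, ((({a} : Multiset ℂ)).map fun α =>
      (1 - PowerSeries.C α * PowerSeries.X)).prod = 1 - PowerSeries.C a * PowerSeries.X :=
          fun a => by
    rw [Multiset.map_singleton, Multiset.prod_singleton]
  have hPtheta : thetaOp P = P * PowerSeries.mk fun k => if k = 0 then 0 else S k - (δ * q) ^ k :=
      by
    have h1 := thetaOp_prod {δ * (q : ℂ)}
    rw [hprod] at h1
    have h2 : (PowerSeries.mk fun k => if k = 0 then 0 else S k - (δ * q) ^ k) =
        (PowerSeries.mk fun k => if k = 0 then 0 else S k) - psumSeries {δ * (q : ℂ)} := by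
      ext k
      rw [psumSeries, map_sub, PowerSeries.coeff_mk, PowerSeries.coeff_mk, PowerSeries.coeff_mk]
      split_ifs <;> simp
    rw [hPL, thetaOp_mul, h1, hL, thetaOp_mk_sum K ψ, h2]
    ring
  obtain ⟨s, hscard, hPs, hSs⟩ := exists_multiset_of_thetaOp hP0 hPtheta
  have hroots := hδroots s hSs
  have hA : (0 : ℝ) ≤ 1 + q := by positivity
  have h1 := norm_coeff_le_of_prod_mul s (A := 1 + q) (by linarith) hA hroots
    (PowerSeries.mk fun m => ∑ f ∈ monics F m, (polyMu f : ℂ) * ψ f)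
    (1 - PowerSeries.C (δ * q) * PowerSeries.X) (fun m => ?_) ?_ m
  · rw [PowerSeries.coeff_mk] at h1
    refine h1.trans ?_
    have h2 : (8 : ℝ) ^ s.card ≤ 8 ^ D := pow_le_pow_right₀ (by norm_num) (hscard ▸ hPdeg)
    gcongr
  · have hδ1 : ‖δ‖ ≤ 1 := by rcases hδ with rfl | rfl <;> simp
    have h87 : 1 ≤ 8 / 7 * ρ := by linarith
    rw [map_sub, PowerSeries.coeff_one, PowerSeries.coeff_C_mul, PowerSeries.coeff_X]
    have h3 : (1 + q : ℝ) ≤ (1 + q) * (8 / 7 * ρ) ^ m :=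
      le_mul_of_one_le_right hA (one_le_pow₀ h87)
    refine le_trans ?_ h3
    refine (norm_sub_le _ _).trans (add_le_add ?_ ?_)
    · split_ifs <;> simp
    · split_ifs
      · rw [mul_one, norm_mul, Complex.norm_natCast]
        exact mul_le_of_le_one_left (by positivity) hδ1
      · simp
  · rw [← hPs, hPL, mul_assoc, mul_comm L, hL, mk_sum_polyMu_mul_mk, mul_one]

end MoebiusSums

section ResidueRing

variable {F : Type*} [Field F]

/-- The product of the residue ring modulo `G` and the residue ring modulo `X ^ T`. -/
abbrev ResidueRing (G : F[X]) (T : ℕ) : Type _ := AdjoinRoot G × AdjoinRoot (X ^ T : F[X])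

/-- The residue of a polynomial modulo `G`, paired with the residue of its reverse modulo `X ^ T`. -/
noncomputable def residueHom (G : F[X]) (T : ℕ) : F[X] →* ResidueRing G T where
  toFun f := (AdjoinRoot.mk G f, AdjoinRoot.mk (X ^ T) f.reverse)
  map_one' := by
    have : (1 : F[X]).reverse = 1 := by rw [← C_1, reverse_C]
    rw [map_one, this, map_one]
    rfl
  map_mul' f g := by
    rw [map_mul, reverse_mul_of_domain, map_mul]
    rfl

theorem homEval_residue (G : F[X]) (T : ℕ) {m : ℕ} {f : F[X]} (hf : f.natDegree ≤ m) :
    homEval ((AdjoinRoot.root G, 1) : ResidueRing G T) (1, AdjoinRoot.root (X ^ T)) m f =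
      (AdjoinRoot.mk G f, AdjoinRoot.mk (X ^ T) (f.reflect m)) := by
  have h1 : (f.reflect m).natDegree < m + 1 := by
    have := f.natDegree_reflect_le (N := m)
    omega
  refine Prod.ext ?_ ?_
  · rw [homEval, Prod.fst_sum]
    conv_rhs => rw [f.as_sum_range_C_mul_X_pow' (Nat.lt_succ_of_le hf)]
    simp [Algebra.smul_def, AdjoinRoot.algebraMap_eq]
  · rw [homEval, Prod.snd_sum]
    conv_rhs => rw [(f.reflect m).as_sum_range_C_mul_X_pow' h1, ← Finset.sum_range_reflect]
    rw [map_sum]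
    refine Finset.sum_congr rfl fun i hi => ?_
    rw [Finset.mem_range] at hi
    have h2 : m + 1 - 1 - i = m - i := by omega
    rw [h2, coeff_reflect, revAt_le (Nat.sub_le m i), Nat.sub_sub_self (by omega)]
    simp [Algebra.smul_def, AdjoinRoot.algebraMap_eq]

theorem isUnit_residueHom (G : F[X]) (T : ℕ) {f : F[X]} (hf : f.Monic) (h : IsCoprime f G) :
    IsUnit (residueHom G T f) := by
  have key : ∀ A B : F[X], IsCoprime A B → IsUnit (AdjoinRoot.mk B A) := by
    rintro A B ⟨u, v, huv⟩
    refine IsUnit.of_mul_eq_one (AdjoinRoot.mk B u) ?_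
    rw [mul_comm, ← map_mul, ← map_one (AdjoinRoot.mk B), AdjoinRoot.mk_eq_mk]
    exact ⟨-v, by linear_combination huv⟩
  rw [Prod.isUnit_iff]
  refine ⟨key _ _ h, key _ _ (IsCoprime.pow_right ?_)⟩
  refine ⟨1, -divX f.reverse, ?_⟩
  have h1 := divX_mul_X_add f.reverse
  rw [coeff_zero_reverse, hf.leadingCoeff, C_1] at h1
  linear_combination -h1

variable [Fintype F]

theorem residueHom_eq_homEval (G : F[X]) (T : ℕ) (m : ℕ) (f : F[X]) (hf : f ∈ monics F m) :
    residueHom G T f =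
      homEval ((AdjoinRoot.root G, 1) : ResidueRing G T) (1, AdjoinRoot.root (X ^ T)) m f := by
  rw [mem_monics] at hf
  rw [homEval_residue G T hf.2.le, ← hf.2]
  rfl

theorem exists_homEvalLow_residue_eq {G : F[X]} (hG : G.Monic) (T : ℕ) {m : ℕ}
    (hm : G.natDegree + T ≤ m) (r : ResidueRing G T) :
    ∃ x, homEvalLow F ((AdjoinRoot.root G, 1) : ResidueRing G T) (1, AdjoinRoot.root (X ^ T)) m x =
      (1, AdjoinRoot.root (X ^ T)) * r := by
  classical
  obtain ⟨a, b⟩ := r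
  obtain ⟨a, rfl⟩ := AdjoinRoot.mk_surjective a
  obtain ⟨b, rfl⟩ := AdjoinRoot.mk_surjective b
  have hXT : (X ^ T : F[X]).Monic := monic_X_pow T
  set b' := b %ₘ X ^ T with hb'
  have hb'deg : ∀ n, T ≤ n → b'.coeff n = 0 := fun n hn => by
    refine coeff_eq_zero_of_degree_lt ((degree_modByMonic_lt b hXT).trans_le ?_)
    rw [degree_X_pow]
    exact_mod_cast hn
  have hbb : AdjoinRoot.mk (X ^ T) b' = AdjoinRoot.mk (X ^ T) b := by
    rw [AdjoinRoot.mk_eq_mk]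
    have := modByMonic_add_div b (X ^ T : F[X])
    exact ⟨-(b /ₘ X ^ T), by rw [hb']; linear_combination this⟩
  set t := (X * b').reflect m with ht
  set w := (a - t) %ₘ G with hw
  have hwdeg : ∀ n, G.natDegree ≤ n → w.coeff n = 0 := fun n hn => by
    refine coeff_eq_zero_of_degree_lt ((degree_modByMonic_lt (a - t) hG).trans_le ?_)
    rw [degree_eq_natDegree hG.ne_zero]
    exact_mod_cast hn
  have htw : (t + w).degree < m := by
    rw [degree_lt_iff_coeff_zero]
    intro n hn
    rw [coeff_add, hwdeg n (by omega), add_zero, ht, coeff_reflect]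
    rcases hn.eq_or_lt with rfl | hn
    · rw [revAt_le le_rfl, Nat.sub_self, coeff_X_mul_zero]
    · rw [revAt_eq_self_of_lt hn]
      obtain ⟨n, rfl⟩ : ∃ n', n = n' + 1 := ⟨n - 1, by omega⟩
      rw [coeff_X_mul]
      exact hb'deg n (by omega)
  have h1 := mem_lows.2 htw
  rw [lows, Finset.mem_image] at h1
  obtain ⟨x, _, hx⟩ := h1
  refine ⟨x, ?_⟩
  rw [← homEval_lowPoly, hx, homEval_residue G T (natDegree_le_of_degree_le htw.le)]
  refine Prod.ext ?_ ?_
  · simp only [Prod.mk_mul_mk, one_mul]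
    rw [AdjoinRoot.mk_eq_mk]
    have := modByMonic_add_div (a - t) G
    exact ⟨-((a - t) /ₘ G), by rw [hw]; linear_combination this⟩
  · simp only [Prod.mk_mul_mk]
    rw [← AdjoinRoot.mk_X, ← hbb, ← map_mul, reflect_add, ht, reflect_reflect, AdjoinRoot.mk_eq_mk,
      add_sub_cancel_left, X_pow_dvd_iff]
    intro d hd
    rw [coeff_reflect, revAt_le (by omega)]
    exact hwdeg _ (by omega)

theorem isCoprime_normPoly {K : Type*} [Field K] [Algebra F K] {G : F[X]} {x : K} (hx : aeval x G ≠ 0)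
    {k : ℕ} (hk : x ^ Fintype.card F ^ k = x) : IsCoprime (normPoly F k x) G := by
  rw [← isCoprime_map (algebraMap F K), map_normPoly hk]
  refine IsCoprime.prod_left fun i _ => ?_
  rw [(irreducible_X_sub_C _).coprime_iff_not_dvd, dvd_iff_isRoot, IsRoot, eval_map_algebraMap,
    ← frobenius_pow_apply, aeval_algHom_apply]
  exact (_root_.map_ne_zero _).2 hx

theorem finite_residueRing {G : F[X]} (hG : G.Monic) (T : ℕ) : Finite (ResidueRing G T) := by
  have := hG.finite_adjoinRoot
  have := (monic_X_pow (R := F) T).finite_adjoinRoot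
  exact Module.finite_of_finite F

theorem card_residueRing {G : F[X]} (hG : G.Monic) (T : ℕ) :
    Nat.card (ResidueRing G T) = Fintype.card F ^ (G.natDegree + T) := by
  have := hG.finite_adjoinRoot
  have := (monic_X_pow (R := F) T).finite_adjoinRoot
  have h1 : ∀ A : F[X], A.Monic → Module.Finite F (AdjoinRoot A) →
      Nat.card (AdjoinRoot A) = Fintype.card F ^ A.natDegree := by
    intro A hA _
    rw [Module.natCard_eq_pow_finrank (K := F), Nat.card_eq_fintype_card]
    congr 1
    exact finrank_quotient_span_eq_natDegree' hA
  rw [Nat.card_prod, h1 G hG ‹_›, h1 _ (monic_X_pow T) ‹_›, natDegree_X_pow, pow_add]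

open scoped Classical in
theorem norm_sum_polyMu_residueHom_le {G : F[X]} (hG : G.Monic) (T : ℕ)
    (χ : MulChar (ResidueRing G T) ℂ) (m : ℕ) :
    ‖∑ f ∈ monics F m, (polyMu f : ℂ) * χ (residueHom G T f)‖ ≤
      8 ^ (G.natDegree + T) * (1 + Fintype.card F) *
        (8 / 7 * (Fintype.card F : ℝ) ^ (3 / 4 : ℝ)) ^ m := by
  have := finite_residueRing hG T
  have := Fintype.ofFinite (ResidueRing G T)
  refine norm_sum_polyMu_mulChar_le (K := AlgebraicClosure F)
    (U := ((AdjoinRoot.root G, 1) : ResidueRing G T)) (V := (1, AdjoinRoot.root (X ^ T)))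
    ⟨(AdjoinRoot.root G - 1, 0), by simp [Prod.ext_iff]⟩
    (fun m hm r => exists_homEvalLow_residue_eq hG T hm r)
    (Z := (G.aroots (AlgebraicClosure F)).toFinset) (fun k hk x hx hxZ => ?_)
    (residueHom G T) (residueHom_eq_homEval G T) χ m
  have h1 := normPoly_mem_monics hx
  rw [← residueHom_eq_homEval G T k _ h1]
  refine isUnit_residueHom G T (mem_monics.1 h1).1 (isCoprime_normPoly (fun h => hxZ ?_) hx)
  rw [Multiset.mem_toFinset, mem_aroots]
  exact ⟨hG.ne_zero, h⟩

end ResidueRing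

section LinearMajorArc

open scoped Classical in
theorem norm_sum_mul_ite_isUnit_le {R : Type*} [CommRing R] [Fintype R] {ι : Type*} (s : Finset ι)
    (a : ι → ℂ) (η : ι → R) {B : ℝ} (hB : ∀ χ : MulChar R ℂ, ‖∑ i ∈ s, a i * χ (η i)‖ ≤ B)
    (Ψ : R → ℂ) (hΨ : ∀ r, ‖Ψ r‖ ≤ 1) :
    ‖∑ i ∈ s, a i * (if IsUnit (η i) then Ψ (η i) else 0)‖ ≤ Nat.card R * B := by
  have : Fintype (MulChar R ℂ) := Fintype.ofFinite _
  have hB0 : 0 ≤ B := (norm_nonneg _).trans (hB 1)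
  have hN : (Fintype.card (MulChar R ℂ) : ℂ) ≠ 0 := Nat.cast_ne_zero.2 Fintype.card_ne_zero
  have hcard : Fintype.card (MulChar R ℂ) = Fintype.card Rˣ := by
    rw [← Nat.card_eq_fintype_card, MulChar.card_eq_card_units_of_hasEnoughRootsOfUnity,
      Nat.card_eq_fintype_card]
  have hsum : ∀ r : R, ∑ χ : MulChar R ℂ, χ r =
      if r = 1 then (Fintype.card (MulChar R ℂ) : ℂ) else 0 := by
    intro r
    split_ifs with hr
    · simp [hr]
    · obtain ⟨χ₀, hχ₀⟩ := MulChar.exists_apply_ne_one_of_hasEnoughRootsOfUnity R ℂ hr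
      have h1 : ∑ χ : MulChar R ℂ, (χ₀ * χ) r = ∑ χ : MulChar R ℂ, χ r :=
        Equiv.sum_comp (Equiv.mulLeft χ₀) fun χ : MulChar R ℂ => χ r
      simp_rw [MulChar.mul_apply] at h1
      rw [← Finset.mul_sum] at h1
      by_contra h
      exact hχ₀ (mul_right_cancel₀ h (by rw [h1, one_mul]))
  set c : MulChar R ℂ → ℂ := fun χ =>
    (∑ u : Rˣ, Ψ u * χ ((u⁻¹ : Rˣ) : R)) / Fintype.card (MulChar R ℂ) with hc
  have hc1 : ∀ χ, ‖c χ‖ ≤ 1 := by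
    intro χ
    rw [hc]
    simp only
    rw [norm_div, Complex.norm_natCast, div_le_one (by exact_mod_cast Fintype.card_pos), hcard]
    refine (norm_sum_le_of_le _ (n := fun _ => 1) fun u _ => ?_).trans ?_
    · rw [norm_mul]
      exact mul_le_one₀ (hΨ _) (norm_nonneg _) (norm_mulChar_le_one χ _)
    · simp
  have hexp : ∀ r : R, (if IsUnit r then Ψ r else 0) = ∑ χ : MulChar R ℂ, c χ * χ r := by
    intro r
    have h1 : ∑ χ : MulChar R ℂ, c χ * χ r = ∑ u : Rˣ, if ((u⁻¹ : Rˣ) : R) * r =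
        1 then Ψ u else 0 := by
      simp_rw [hc, div_mul_eq_mul_div, Finset.sum_mul]
      rw [← Finset.sum_div, Finset.sum_comm]
      simp_rw [mul_assoc, ← map_mul]
      simp_rw [← Finset.mul_sum, hsum, mul_ite, mul_zero]
      rw [div_eq_iff hN, Finset.sum_mul]
      exact Finset.sum_congr rfl fun u _ => by rw [ite_mul, zero_mul]
    rw [h1]
    split_ifs with h
    · obtain ⟨u, rfl⟩ := h
      rw [Finset.sum_eq_single u]
      · simp
      · intro b _ hb
        rw [if_neg]
        intro h
        rw [← Units.val_mul, Units.val_eq_one, inv_mul_eq_one] at h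
        exact hb h
      · simp
    · refine (Finset.sum_eq_zero fun u _ => if_neg fun h1 => h ?_).symm
      exact IsUnit.of_mul_eq_one _ (by rwa [mul_comm])
  simp_rw [hexp, Finset.mul_sum]
  rw [Finset.sum_comm]
  have h1 : ∀ χ : MulChar R ℂ, ∑ i ∈ s, a i * (c χ * χ (η i)) = c χ * ∑ i ∈ s, a i * χ (η i) :=
    fun χ => by
      rw [Finset.mul_sum]
      exact Finset.sum_congr rfl fun i _ => by ring
  simp_rw [h1]
  refine (norm_sum_le_of_le _ (n := fun _ => B) fun χ _ => ?_).trans ?_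
  · rw [norm_mul]
    exact (mul_le_of_le_one_left (norm_nonneg _) (hc1 χ)).trans (hB χ)
  · rw [Finset.sum_const, nsmul_eq_mul, Finset.card_univ, hcard]
    refine mul_le_mul_of_nonneg_right ?_ hB0
    rw [Nat.card_eq_fintype_card]
    exact_mod_cast Fintype.card_le_of_injective (fun u : Rˣ => (u : R)) Units.val_injective

variable {F : Type*} [Field F]

theorem isUnit_residueHom_iff (G : F[X]) (T : ℕ) {f : F[X]} (hf : f.Monic) :
    IsUnit (residueHom G T f) ↔ IsCoprime f G := by
  refine ⟨fun h => ?_, isUnit_residueHom G T hf⟩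
  have h1 : IsUnit (AdjoinRoot.mk G f) := (Prod.isUnit_iff.1 h).1
  obtain ⟨u, hu⟩ := h1.exists_left_inv
  obtain ⟨u, rfl⟩ := AdjoinRoot.mk_surjective u
  rw [← map_mul, ← map_one (AdjoinRoot.mk G), AdjoinRoot.mk_eq_mk] at hu
  obtain ⟨v, hv⟩ := hu
  exact ⟨u, -v, by linear_combination hv⟩

variable [Fintype F]

theorem residueHom_eq_residueHom {G : F[X]} {T m : ℕ} {f f' : F[X]} (hf : f ∈ monics F m)
    (hf' : f' ∈ monics F m) (h : residueHom G T f = residueHom G T f') :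
    G ∣ f - f' ∧ (f - f' ≠ 0 → (f - f').natDegree + T ≤ m) := by
  rw [mem_monics] at hf hf'
  have h1 : AdjoinRoot.mk G f = AdjoinRoot.mk G f' := congrArg Prod.fst h
  have h2 : AdjoinRoot.mk (X ^ T) f.reverse = AdjoinRoot.mk (X ^ T) f'.reverse :=
      congrArg Prod.snd h
  rw [AdjoinRoot.mk_eq_mk] at h1 h2
  refine ⟨h1, fun h0 => ?_⟩
  by_contra hT
  rw [reverse, reverse, hf.2, hf'.2, ← reflect_sub, X_pow_dvd_iff] at h2
  have hdeg : (f - f').natDegree ≤ m := (natDegree_sub_le _ _).trans (by rw [hf.2, hf'.2, max_self])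
  have h3 := h2 (m - (f - f').natDegree) (by omega)
  rw [coeff_reflect, revAt_le (Nat.sub_le _ _), Nat.sub_sub_self hdeg, coeff_natDegree,
    leadingCoeff_eq_zero] at h3
  exact h0 h3

open scoped Classical in
theorem norm_sum_polyMu_coprime_le {G : F[X]} (hG : G.Monic) (T m : ℕ) (e : F[X] → ℂ)
    (he1 : ∀ f, ‖e f‖ ≤ 1) (he : ∀ f ∈ monics F m, ∀ f' ∈ monics F m, G ∣ f - f' →
      (f - f' ≠ 0 → (f - f').natDegree + T ≤ m) → e f = e f') :
    ‖∑ f ∈ monics F m, if IsCoprime f G then (polyMu f : ℂ) * e f else 0‖ ≤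
      (Fintype.card F : ℝ) ^ (G.natDegree + T) * (8 ^ (G.natDegree + T) * (1 + Fintype.card F) *
        (8 / 7 * (Fintype.card F : ℝ) ^ (3 / 4 : ℝ)) ^ m) := by
  have := finite_residueRing hG T
  have := Fintype.ofFinite (ResidueRing G T)
  set Ψ : ResidueRing G T → ℂ := fun r =>
    if h : ∃ f ∈ monics F m, residueHom G T f = r then e h.choose else 0 with hΨ
  have hΨe : ∀ f ∈ monics F m, Ψ (residueHom G T f) = e f := by
    intro f hf
    have h : ∃ f' ∈ monics F m, residueHom G T f' = residueHom G T f := ⟨f, hf, rfl⟩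
    rw [hΨ]
    simp only
    rw [dif_pos h]
    have h1 := residueHom_eq_residueHom h.choose_spec.1 hf h.choose_spec.2
    exact he _ h.choose_spec.1 f hf h1.1 h1.2
  have h1 := norm_sum_mul_ite_isUnit_le (monics F m) (fun f => (polyMu f : ℂ)) (residueHom G T)
    (norm_sum_polyMu_residueHom_le hG T · m) Ψ fun r => by
      rw [hΨ]
      simp only
      split_ifs
      · exact he1 _
      · simp
  rw [card_residueRing hG T] at h1
  push_cast at h1
  refine le_of_eq_of_le ?_ h1
  congr 1
  refine Finset.sum_congr rfl fun f hf => ?_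
  rw [hΨe f hf]
  by_cases h : IsCoprime f G
  · rw [if_pos h, if_pos ((isUnit_residueHom_iff G T (mem_monics.1 hf).1).2 h)]
  · rw [if_neg h, if_neg fun h' => h ((isUnit_residueHom_iff G T (mem_monics.1 hf).1).1 h'),
      mul_zero]

theorem exists_monicPairs_gcd {f : F[X]} (hf : f.Monic) (hsq : Squarefree f) (G : F[X]) :
    ∃ k ∈ monicPairs f, (k.1 ∣ G ∧ IsCoprime k.2 G) ∧
      ∀ k' ∈ monicPairs f, k'.1 ∣ G ∧ IsCoprime k'.2 G → k' = k := by
  classical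
  set a := normalize (EuclideanDomain.gcd f G) with ha
  have haf : a ∣ f := normalize_dvd_iff.2 (EuclideanDomain.gcd_dvd_left f G)
  have haG : a ∣ G := normalize_dvd_iff.2 (EuclideanDomain.gcd_dvd_right f G)
  have ham : a.Monic := monic_normalize fun h => hf.ne_zero (EuclideanDomain.gcd_eq_zero_iff.1 h).1
  obtain ⟨w, hw⟩ := haf
  have hwm : w.Monic := ham.of_mul_monic_left (hw ▸ hf)
  have hwG : IsCoprime w G := by
    refine isCoprime_of_irreducible_dvd (fun h => hwm.ne_zero h.1) fun p hp hpw hpG => ?_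
    have h1 : p ∣ a := by
      rw [ha, dvd_normalize_iff]
      exact EuclideanDomain.dvd_gcd (hw ▸ hpw.mul_left a) hpG
    exact hp.1 (hsq p (hw ▸ mul_dvd_mul h1 hpw))
  refine ⟨(a, w), mem_monicPairs.2 ⟨ham, hwm, hw.symm⟩, ⟨haG, hwG⟩, ?_⟩
  rintro ⟨a', w'⟩ hk ⟨ha'G, hw'G⟩
  obtain ⟨ha'm, hw'm, hw'⟩ := mem_monicPairs.1 hk
  simp only at ha'm hw'm hw' ha'G hw'G
  have h1 : a ∣ a' := by
    refine (hw'G.symm.of_isCoprime_of_dvd_left haG).dvd_of_dvd_mul_right ?_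
    rw [hw', hw]
    exact dvd_mul_right a w
  have h2 : a' ∣ a := by
    refine (hwG.symm.of_isCoprime_of_dvd_left ha'G).dvd_of_dvd_mul_right ?_
    rw [← hw, ← hw']
    exact dvd_mul_right a' w'
  have h3 : a' = a := eq_of_monic_of_associated ha'm ham (associated_of_dvd_dvd h2 h1)
  subst h3
  rw [hw] at hw'
  rw [mul_left_cancel₀ ha'm.ne_zero hw']

open scoped Classical in
/-- The correlation of the Möbius function with a function of the residue modulo `G` and of the
leading `T` coefficients. -/
theorem norm_sum_polyMu_periodic_le {G : F[X]} (hG : G.Monic) (T m : ℕ) (e : F[X] → ℂ)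
    (he1 : ∀ f, ‖e f‖ ≤ 1) (he : ∀ f ∈ monics F m, ∀ f' ∈ monics F m, G ∣ f - f' →
      (f - f' ≠ 0 → (f - f').natDegree + T ≤ m) → e f = e f') :
    ‖∑ f ∈ monics F m, (polyMu f : ℂ) * e f‖ ≤ (Fintype.card F : ℝ) ^ (G.natDegree + 1) *
      ((Fintype.card F : ℝ) ^ (G.natDegree + T) * (8 ^ (G.natDegree + T) * (1 + Fintype.card F) *
        (8 / 7 * (Fintype.card F : ℝ) ^ (3 / 4 : ℝ)) ^ m)) := by
  set q := Fintype.card F with hq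
  have hq1 : 1 < q := Fintype.one_lt_card
  have hq1' : (1 : ℝ) < q := by exact_mod_cast hq1
  set B : ℝ := (q : ℝ) ^ (G.natDegree + T) * (8 ^ (G.natDegree + T) * (1 + q) *
        (8 / 7 * (q : ℝ) ^ (3 / 4 : ℝ)) ^ m) with hB
  have hB0 : 0 ≤ B := by positivity
  set g : F[X] → F[X] → ℂ := fun a w =>
    if a ∣ G ∧ IsCoprime w G then (polyMu (a * w) : ℂ) * e (a * w) else 0 with hg
  have h1 : ∀ f ∈ monics F m, (polyMu f : ℂ) * e f = ∑ k ∈ monicPairs f, g k.1 k.2 := by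
    intro f hf
    rw [mem_monics] at hf
    have h2 : ∀ k ∈ monicPairs f, g k.1 k.2 =
        if k.1 ∣ G ∧ IsCoprime k.2 G then (polyMu f : ℂ) * e f else 0 := fun k hk => by
      simp only [hg]
      rw [(mem_monicPairs.1 hk).2.2]
    rw [Finset.sum_congr rfl h2]
    by_cases hsq : Squarefree f
    · obtain ⟨k, hk, hkG, huniq⟩ := exists_monicPairs_gcd hf.1 hsq G
      rw [Finset.sum_eq_single_of_mem k hk fun k' hk' hne => if_neg fun h => hne (huniq k' hk' h),
        if_pos hkG]
    · rw [polyMu_of_not_squarefree hsq]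
      simp
  rw [Finset.sum_congr rfl h1, sum_monics_monicPairs]
  have h2 : ∀ ij ∈ Finset.HasAntidiagonal.antidiagonal m, ∀ a ∈ monics F ij.1,
      ‖∑ w ∈ monics F ij.2, g a w‖ ≤ if a ∣ G then B else 0 := by
    intro ij hij a ha
    rw [Finset.HasAntidiagonal.mem_antidiagonal] at hij
    split_ifs with haG
    · have h3 : ∀ w, g a w = (polyMu a : ℂ) *
          (if IsCoprime w G then (polyMu w : ℂ) * e (a * w) else 0) := by
        intro w
        rw [hg]
        simp only [haG, true_and]
        split_ifs with hw
        · rw [polyMu_mul (hw.symm.of_isCoprime_of_dvd_left haG)]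
          push_cast
          ring
        · rw [mul_zero]
      simp_rw [h3]
      rw [← Finset.mul_sum, norm_mul]
      have h4 : ‖(polyMu a : ℂ)‖ ≤ 1 := by
        rw [Complex.norm_intCast]
        exact_mod_cast abs_polyMu_le a
      refine (mul_le_of_le_one_left (norm_nonneg _) h4).trans ?_
      refine (norm_sum_polyMu_coprime_le hG T ij.2 (fun w => e (a * w)) (fun w => he1 _) ?_).trans ?_
      · intro f hf f' hf' hdvd hdeg
        refine he _ (hij ▸ mul_mem_monics ha hf) _ (hij ▸ mul_mem_monics ha hf') ?_ ?_
        · rw [← mul_sub]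
          exact hdvd.mul_left a
        · rw [← mul_sub]
          intro h0
          have h5 := right_ne_zero_of_mul h0
          rw [natDegree_mul (left_ne_zero_of_mul h0) h5, (mem_monics.1 ha).2]
          have := hdeg h5
          omega
      · rw [hB]
        have hρ1 : 1 ≤ (q : ℝ) ^ (3 / 4 : ℝ) := Real.one_le_rpow hq1'.le (by norm_num)
        have h6 : (8 / 7 * (q : ℝ) ^ (3 / 4 : ℝ)) ^ ij.2 ≤ (8 / 7 * (q : ℝ) ^ (3 / 4 : ℝ)) ^ m :=
          pow_le_pow_right₀ (by linarith) (by omega)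
        gcongr
    · rw [Finset.sum_eq_zero fun w _ => if_neg fun h => haG h.1, norm_zero]
  refine (norm_sum_le_of_le _ fun ij hij => norm_sum_le_of_le _ (h2 ij hij)).trans ?_
  have h3 : ∀ ij ∈ Finset.HasAntidiagonal.antidiagonal m,
      (∑ a ∈ monics F ij.1, if a ∣ G then B else 0) ≤
      if ij.1 ∈ Finset.range (G.natDegree + 1) then (q : ℝ) ^ ij.1 * B else 0 := by
    intro ij _
    split_ifs with h
    · refine (Finset.sum_le_card_nsmul _ _ B fun a _ => ?_).trans ?_
      · split_ifs
        exacts [le_rfl, hB0]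
      · rw [card_monics, nsmul_eq_mul]
        push_cast
        exact le_rfl
    · refine (Finset.sum_eq_zero fun a ha => if_neg fun haG => h ?_).le
      rw [Finset.mem_range, ← (mem_monics.1 ha).2]
      exact Nat.lt_succ_of_le (natDegree_le_of_dvd haG hG.ne_zero)
  refine (Finset.sum_le_sum h3).trans ?_
  rw [Finset.Nat.sum_antidiagonal_eq_sum_range_succ_mk]
  simp only
  rw [← Finset.sum_filter]
  have h4 : ∑ a ∈ Finset.range m.succ with a ∈ Finset.range (G.natDegree + 1), (q : ℝ) ^ a * B ≤
      ∑ a ∈ Finset.range (G.natDegree + 1), (q : ℝ) ^ a * B :=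
    Finset.sum_le_sum_of_subset_of_nonneg (fun a ha => (Finset.mem_filter.1 ha).2)
      fun a _ _ => by positivity
  refine h4.trans ?_
  rw [← Finset.sum_mul]
  refine mul_le_mul_of_nonneg_right ?_ hB0
  have h5 := Nat.geomSum_lt (n := G.natDegree + 1) hq1 (s := Finset.range (G.natDegree + 1))
    fun k hk => Finset.mem_range.1 hk
  exact_mod_cast h5.le

end LinearMajorArc

/-- The polynomials of degree `< D` orthogonal, for the form `(p, w) ↦ B (p * w)`, to all the
polynomials of degree `< W`. -/
def hankelKer {F : Type*} [Field F] (B : F[X] →ₗ[F] F) (D W : ℕ) : Submodule F F[X] where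
  carrier := {p | p ∈ degreeLT F D ∧ ∀ w ∈ degreeLT F W, B (p * w) = 0}
  add_mem' := fun ha hb => ⟨add_mem ha.1 hb.1, fun w hw => by
    rw [add_mul, map_add, ha.2 w hw, hb.2 w hw, add_zero]⟩
  zero_mem' := ⟨zero_mem _, fun w _ => by rw [zero_mul, map_zero]⟩
  smul_mem' := fun c x hx => ⟨Submodule.smul_mem _ c hx.1, fun w hw => by
    rw [smul_mul_assoc, map_smul, hx.2 w hw, smul_zero]⟩

section HankelKer

variable {F : Type*} [Field F] {B : F[X] →ₗ[F] F}

theorem mem_hankelKer {D W : ℕ} {p : F[X]} :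
    p ∈ hankelKer B D W ↔ p ∈ degreeLT F D ∧ ∀ w ∈ degreeLT F W, B (p * w) = 0 :=
  Iff.rfl

theorem hankelKer_le_degreeLT (D W : ℕ) : hankelKer B D W ≤ degreeLT F D :=
  fun _ hp => hp.1

theorem finrank_degreeLT (D : ℕ) : Module.finrank F (degreeLT F D) = D := by
  rw [(degreeLTEquiv F D).finrank_eq, Module.finrank_fin_fun]

theorem finiteDimensional_degreeLT (D : ℕ) : FiniteDimensional F (degreeLT F D) :=
  (degreeLTEquiv F D).symm.finiteDimensional

theorem finiteDimensional_hankelKer (D W : ℕ) : FiniteDimensional F (hankelKer B D W) :=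
  have := finiteDimensional_degreeLT (F := F) D
  Submodule.finiteDimensional_of_le (hankelKer_le_degreeLT D W)

theorem finrank_hankelKer_le (D W : ℕ) : Module.finrank F (hankelKer B D W) ≤ D := by
  have := finiteDimensional_degreeLT (F := F) D
  exact (Submodule.finrank_mono (hankelKer_le_degreeLT D W)).trans_eq (finrank_degreeLT D)

theorem X_mul_mem_degreeLT {m : ℕ} {p : F[X]} : X * p ∈ degreeLT F (m + 1) ↔ p ∈ degreeLT F m := by
  rw [mem_degreeLT, mem_degreeLT]
  rcases eq_or_ne p 0 with rfl | hp
  · simp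
  · rw [degree_mul, degree_X, degree_eq_natDegree hp]
    norm_cast
    omega

theorem mem_degreeLT_succ {m : ℕ} {p : F[X]} (hp : p ∈ degreeLT F (m + 1)) :
    ∃ c : F, ∃ w ∈ degreeLT F m, p = C c + X * w := by
  refine ⟨p.coeff 0, p.divX, ?_, by rw [add_comm, X_mul_divX_add]⟩
  rw [← X_mul_mem_degreeLT]
  have h := X_mul_divX_add p
  rw [← eq_sub_iff_add_eq] at h
  rw [h]
  refine sub_mem hp ?_
  rw [mem_degreeLT]
  exact degree_C_le.trans_lt (by exact_mod_cast Nat.succ_pos m)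

theorem two_mul_finrank_hankelKer_le (D W : ℕ) :
    2 * Module.finrank F (hankelKer B (D + 1) (W + 1)) ≤
      Module.finrank F (hankelKer B D (W + 2)) + Module.finrank F (hankelKer B (D + 2) W) := by
  have := finiteDimensional_hankelKer (B := B) (D + 1) (W + 1)
  have := finiteDimensional_hankelKer (B := B) D (W + 2)
  have := finiteDimensional_hankelKer (B := B) (D + 2) W
  set S := hankelKer B (D + 1) (W + 1) with hS
  set mX : F[X] →ₗ[F] F[X] := LinearMap.mulLeft F X with hmX
  have hinj : Function.Injective mX := fun a b h => mul_left_cancel₀ X_ne_zero h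
  have hmono : ∀ {a b : ℕ}, a ≤ b → degreeLT F a ≤ degreeLT F b := fun h => degreeLT_mono h
  have h1 : S ⊔ S.map mX ≤ hankelKer B (D + 2) W := by
    refine sup_le (fun p hp => ⟨hmono (by omega) hp.1, fun w hw => hp.2 w (hmono (by omega) hw)⟩) ?_
    rintro _ ⟨p, hp, rfl⟩
    refine ⟨X_mul_mem_degreeLT.2 hp.1, fun w hw => ?_⟩
    rw [hmX, LinearMap.mulLeft_apply, mul_comm X p, mul_assoc]
    exact hp.2 _ (X_mul_mem_degreeLT.2 hw)
  have h2 : S ⊓ S.map mX ≤ (hankelKer B D (W + 2)).map mX := by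
    rintro _ ⟨hp', p, hp, rfl⟩
    refine ⟨p, ⟨X_mul_mem_degreeLT.1 hp'.1, fun w hw => ?_⟩, rfl⟩
    obtain ⟨c, w', hw', rfl⟩ := mem_degreeLT_succ hw
    have h3 := hp'.2 w' hw'
    rw [hmX, LinearMap.mulLeft_apply, mul_comm X p, mul_assoc] at h3
    rw [mul_add, map_add, h3, add_zero]
    refine hp.2 _ ?_
    rw [mem_degreeLT]
    exact degree_C_le.trans_lt (by exact_mod_cast Nat.succ_pos W)
  have h3 := Submodule.finrank_sup_add_finrank_inf_eq S (S.map mX)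
  have h4 := Submodule.finrank_mono h1
  have h5 := Submodule.finrank_mono h2
  rw [(Submodule.equivMapOfInjective mX hinj S).finrank_eq.symm] at h3
  rw [(Submodule.equivMapOfInjective mX hinj _).finrank_eq.symm] at h5
  omega

end HankelKer

theorem pos_of_convex {κ : ℕ → ℕ} {N D W r : ℕ} (hκ : ∀ i < N, 2 * κ (i + 1) ≤ κ i + κ (i + 2))
    (hN : κ (N + 1) ≤ N + 1) (hDW : D + W = N + 1) (hrD : r < D) (hrW : r < W)
    (hD : D ≤ κ D + r) : 0 < κ (r + 1) := by
  by_contra! h0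
  have hmono : ∀ i d, i + d ≤ N → (κ (i + 1) : ℤ) - κ i ≤ κ (i + d + 1) - κ (i + d) := by
    intro i d
    induction d with
    | zero => intro _; exact le_rfl
    | succ d ih =>
      intro h
      have h1 := ih (by omega)
      have h2 : 2 * κ (i + d + 1) ≤ κ (i + d) + κ (i + d + 1 + 1) := hκ (i + d) (by omega)
      rw [show i + (d + 1) = i + d + 1 by ring]
      omega
  have h1 : ∀ j, r + 1 + j ≤ D → (κ (D) : ℤ) - κ (D - 1) ≤ 1 → κ (r + 1 + j) ≤ j := by
    intro j
    induction j with
    | zero => intro _ _; simpa using h0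
    | succ j ih =>
      intro h hd
      have h2 := ih (by omega) hd
      have h3 := hmono (r + 1 + j) (D - 1 - (r + 1 + j)) (by omega)
      rw [show r + 1 + j + (D - 1 - (r + 1 + j)) = D - 1 by omega, Nat.sub_add_cancel (by omega)]
        at h3
      rw [show r + 1 + (j + 1) = r + 1 + j + 1 by ring]
      omega
  have h2 : (2 : ℤ) ≤ κ D - κ (D - 1) := by
    by_contra! h
    have h3 := h1 (D - (r + 1)) (by omega) (by omega)
    rw [Nat.add_sub_cancel' (by omega)] at h3
    omega
  have h3 : ∀ j, D + j ≤ N + 1 → κ D + 2 * j ≤ κ (D + j) := by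
    intro j
    induction j with
    | zero => intro _; simp
    | succ j ih =>
      intro h
      have h4 := ih (by omega)
      have h5 := hmono (D - 1) (j + 1) (by omega)
      rw [show D - 1 + (j + 1) = D + j by omega, Nat.sub_add_cancel (by omega)] at h5
      rw [show D + (j + 1) = D + j + 1 by ring]
      omega
  have h4 := h3 W (by omega)
  rw [hDW] at h4
  omega

/-- A Hankel form of small rank has a kernel generated by a polynomial of low degree. -/
theorem exists_ne_zero_of_finrank_hankelKer {F : Type*} [Field F] {B : F[X] →ₗ[F] F}
    {N D W r : ℕ} (hDW : D + W = N + 1) (hrD : r < D) (hrW : r < W)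
    (hD : D ≤ Module.finrank F (hankelKer B D W) + r) :
    ∃ g : F[X], g ≠ 0 ∧ g.natDegree ≤ r ∧ ∀ x ∈ degreeLT F (N - r), B (g * x) = 0 := by
  have h := pos_of_convex (κ := fun i => Module.finrank F (hankelKer B i (N + 1 - i)))
    (N := N) (D := D) (W := W) (r := r) (fun i hi => by
      have := two_mul_finrank_hankelKer_le (B := B) i (N - 1 - i)
      rw [show N + 1 - (i + 1) = N - 1 - i + 1 by omega, show N + 1 - i = N - 1 - i + 2 by omega,
        show N + 1 - (i + 2) = N - 1 - i by omega]
      exact this) (finrank_hankelKer_le _ _) hDW hrD hrW (by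
        rw [show N + 1 - D = W by omega]
        exact hD)
  have h1 : hankelKer B (r + 1) (N + 1 - (r + 1)) ≠ ⊥ := fun h0 => by
    rw [h0, finrank_bot] at h
    exact h.ne rfl
  obtain ⟨g, hg, hg0⟩ := Submodule.exists_mem_ne_zero_of_ne_bot h1
  refine ⟨g, hg0, ?_, fun x hx => hg.2 x (by rwa [Nat.add_sub_add_right])⟩
  have h2 := mem_degreeLT.1 hg.1
  rw [degree_eq_natDegree hg0] at h2
  exact Nat.lt_succ_iff.1 (by exact_mod_cast h2)

section CharacterSums

variable {F : Type*} [Field F] [Fintype F]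

open scoped Classical in
theorem card_filter_mem_submodule {m : ℕ} {S : Submodule F F[X]} (hS : S ≤ degreeLT F m) :
    ((lows F m).filter (· ∈ S)).card = Fintype.card F ^ Module.finrank F S := by
  have := finiteDimensional_degreeLT (F := F) m
  have := Submodule.finiteDimensional_of_le hS
  rw [← Nat.card_eq_fintype_card, ← Module.natCard_eq_pow_finrank (K := F) (V := S),
    Nat.subtype_card ((lows F m).filter (· ∈ S)) fun x => ?_]
  rw [Finset.mem_filter, mem_lows, ← mem_degreeLT]
  exact ⟨fun h => h.2, fun h => ⟨hS h, h⟩⟩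

theorem coe_addChar_add (χ : AddChar F Circle) (a b : F) :
    (χ (a + b) : ℂ) = χ a * χ b := by
  rw [AddChar.map_add_eq_mul, Circle.coe_mul]

theorem conj_coe_addChar (χ : AddChar F Circle) (a : F) :
    (starRingEnd ℂ) (χ a : ℂ) = χ (-a) := by
  rw [AddChar.map_neg_eq_inv, Circle.coe_inv_eq_conj]

theorem sum_lows_add {M : Type*} [AddCommMonoid M] {m : ℕ} {u : F[X]} (hu : u ∈ lows F m)
    (g : F[X] → M) : ∑ v ∈ lows F m, g (v + u) = ∑ v ∈ lows F m, g v := by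
  rw [mem_lows, ← mem_degreeLT] at hu
  refine Finset.sum_nbij' (· + u) (· - u) (fun v hv => ?_) (fun v hv => ?_) (fun v _ => ?_)
    (fun v _ => ?_) fun v _ => rfl
  · rw [mem_lows, ← mem_degreeLT] at hv ⊢
    exact add_mem hv hu
  · rw [mem_lows, ← mem_degreeLT] at hv ⊢
    exact sub_mem hv hu
  · simp
  · simp

theorem sum_lows_addChar_eq_zero {χ : AddChar F Circle} (hχ : χ ≠ 1) {m : ℕ} (l : F[X] →ₗ[F] F)
    (h : ¬ ∀ v ∈ degreeLT F m, l v = 0) : ∑ v ∈ lows F m, (χ (l v) : ℂ) = 0 := by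
  push Not at h
  obtain ⟨v₀, hv₀, hl⟩ := h
  obtain ⟨c, hc⟩ := AddChar.ne_one_iff.1 hχ
  have hu : (c / l v₀) • v₀ ∈ lows F m := by
    rw [mem_lows, ← mem_degreeLT]
    exact Submodule.smul_mem _ _ hv₀
  have h1 := sum_lows_add hu fun v => (χ (l v) : ℂ)
  have h2 : ∀ v, (χ (l (v + (c / l v₀) • v₀)) : ℂ) = χ (l v) * χ c := fun v => by
    rw [map_add, map_smul, smul_eq_mul, div_mul_cancel₀ _ hl, coe_addChar_add]
  rw [Finset.sum_congr rfl fun v _ => h2 v, ← Finset.sum_mul] at h1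
  by_contra h0
  exact hc (Circle.coe_injective ((mul_eq_left₀ h0).1 h1))

theorem sum_monics_sub {M : Type*} [AddCommMonoid M] {m : ℕ} {f' : F[X]} (hf' : f' ∈ monics F m)
    (g : F[X] → M) : ∑ f ∈ monics F m, g f = ∑ h ∈ lows F m, g (f' + h) := by
  rw [sum_monics]
  have hu : f' - X ^ m ∈ lows F m := by
    classical
    unfold monics at hf'
    obtain ⟨v, hv, rfl⟩ := Finset.mem_image.1 hf'
    simpa using hv
  rw [← sum_lows_add hu]
  exact Finset.sum_congr rfl fun v _ => by congr 1; ring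

/-- The square root cancellation in a quadratic exponential sum. -/
theorem norm_sum_quadratic_sq_le {χ : AddChar F Circle} (hχ : χ ≠ 1) (hF : ringChar F ≠ 2)
    (m : ℕ) (b l : F[X] →ₗ[F] F) :
    ‖∑ f ∈ monics F m, (χ (b (f ^ 2) + l f) : ℂ)‖ ^ 2 ≤
      (Fintype.card F : ℝ) ^ (m + Module.finrank F (hankelKer b m m)) := by
  classical
  have h2 : (2 : F) ≠ 0 := Ring.two_ne_zero hF
  have h1 : ((‖∑ f ∈ monics F m, (χ (b (f ^ 2) + l f) : ℂ)‖ ^ 2 : ℝ) : ℂ) =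
      ∑ h ∈ lows F m, ∑ f' ∈ monics F m, (χ (b (2 * f' * h + h ^ 2) + l h) : ℂ) := by
    rw [Complex.ofReal_pow, ← Complex.mul_conj', map_sum, Finset.mul_sum, Finset.sum_comm]
    refine Finset.sum_congr rfl fun f' hf' => ?_
    rw [sum_monics_sub hf', Finset.sum_mul]
    refine Finset.sum_congr rfl fun h _ => ?_
    rw [conj_coe_addChar, ← coe_addChar_add]
    congr 2
    rw [map_add l, show (f' + h) ^ 2 = f' ^ 2 + (2 * f' * h + h ^ 2) by ring, map_add b (f' ^ 2)]
    ring
  have h3 : ∀ h ∈ lows F m, ‖∑ f' ∈ monics F m, (χ (b (2 * f' * h + h ^ 2) + l h) : ℂ)‖ ≤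
      if h ∈ hankelKer b m m then (Fintype.card F : ℝ) ^ m else 0 := by
    intro h hh
    split_ifs with hK
    · refine (norm_sum_le _ _).trans ?_
      refine (Finset.sum_le_card_nsmul _ _ 1 fun f _ => (Circle.norm_coe _).le).trans_eq ?_
      rw [card_monics, nsmul_eq_mul, mul_one, Nat.cast_pow]
    · rw [sum_monics]
      have h4 : ∀ v, (χ (b (2 * (X ^ m + v) * h + h ^ 2) + l h) : ℂ) =
          χ (((2 : F) • b ∘ₗ LinearMap.mulLeft F h) v) *
            χ (b (2 * X ^ m * h + h ^ 2) + l h) := fun v => by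
        rw [← coe_addChar_add, LinearMap.smul_apply, LinearMap.comp_apply,
          LinearMap.mulLeft_apply, ← map_smul, ← add_assoc, ← map_add, smul_eq_C_mul]
        congr 4
        simp only [map_ofNat]
        ring
      rw [Finset.sum_congr rfl fun v _ => h4 v, ← Finset.sum_mul,
        sum_lows_addChar_eq_zero hχ _ fun hv => hK ⟨mem_degreeLT.2 (mem_lows.1 hh), fun w hw => ?_⟩,
        zero_mul, norm_zero]
      have h5 := hv w hw
      rw [LinearMap.smul_apply, LinearMap.comp_apply, LinearMap.mulLeft_apply, smul_eq_mul] at h5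
      exact (mul_eq_zero.1 h5).resolve_left h2
  have h4 : ‖∑ f ∈ monics F m, (χ (b (f ^ 2) + l f) : ℂ)‖ ^ 2 =
      ‖((‖∑ f ∈ monics F m, (χ (b (f ^ 2) + l f) : ℂ)‖ ^ 2 : ℝ) : ℂ)‖ := by
    rw [Complex.norm_real, Real.norm_of_nonneg (by positivity)]
  rw [h4, h1]
  refine (norm_sum_le _ _).trans ((Finset.sum_le_sum h3).trans_eq ?_)
  rw [← Finset.sum_filter, Finset.sum_const, card_filter_mem_submodule (hankelKer_le_degreeLT m m),
    nsmul_eq_mul, add_comm, pow_add]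
  push_cast
  rfl

theorem forall_eq_zero_of_sum_monics_ne_zero {χ : AddChar F Circle} (hχ : χ ≠ 1) {m : ℕ}
    {l : F[X] →ₗ[F] F} (h : ∑ f ∈ monics F m, (χ (l f) : ℂ) ≠ 0) :
    ∀ v ∈ degreeLT F m, l v = 0 := by
  by_contra h1
  refine h ?_
  rw [sum_monics, Finset.sum_congr rfl fun v _ => by rw [map_add, coe_addChar_add],
    ← Finset.mul_sum, sum_lows_addChar_eq_zero hχ l h1, mul_zero]

end CharacterSums

section Fourier

variable {F : Type*} [Field F] [Fintype F] {W : Type*} [AddCommGroup W] [Module F W]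

theorem sum_dual_addChar_eq_zero [Module.Finite F W] [Fintype (Module.Dual F W)]
    {χ : AddChar F Circle} (hχ : χ ≠ 1) {w : W} (hw : w ≠ 0) :
    ∑ d : Module.Dual F W, (χ (d w) : ℂ) = 0 := by
  have h1 : ∃ d : Module.Dual F W, d w ≠ 0 := by
    by_contra! h
    exact hw ((Module.forall_dual_apply_eq_zero_iff F w).1 h)
  obtain ⟨d₀, hd₀⟩ := h1
  obtain ⟨c, hc⟩ := AddChar.ne_one_iff.1 hχ
  have h1 := Equiv.sum_comp (Equiv.addRight ((c / d₀ w) • d₀)) fun d => (χ (d w) : ℂ)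
  have h2 : ∀ d : Module.Dual F W, (χ (Equiv.addRight ((c / d₀ w) • d₀) d w) : ℂ) =
      χ (d w) * χ c := fun d => by
    rw [Equiv.coe_addRight, LinearMap.add_apply, LinearMap.smul_apply, smul_eq_mul,
      div_mul_cancel₀ _ hd₀, coe_addChar_add]
  rw [Finset.sum_congr rfl fun v _ => h2 v, ← Finset.sum_mul] at h1
  by_contra h0
  exact hc (Circle.coe_injective ((mul_eq_left₀ h0).1 h1))

/-- A sum twisted by a function of a point in a finite vector space is controlled by the sums
twisted by linear phases. -/
theorem norm_sum_comp_le [Module.Finite F W] {χ : AddChar F Circle} (hχ : χ ≠ 1) {ι : Type*}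
    (s : Finset ι) (a : ι → ℂ) (π : ι → W) (Φ : W → ℂ) (hΦ : ∀ w, ‖Φ w‖ ≤ 1) {B : ℝ}
    (hB : ∀ d : Module.Dual F W, ‖∑ v ∈ s, a v * χ (d (π v))‖ ≤ B) :
    ‖∑ v ∈ s, a v * Φ (π v)‖ ≤ (Fintype.card F : ℝ) ^ Module.finrank F W * B := by
  classical
  have := Module.finite_of_finite F (M := W)
  have := Fintype.ofFinite W
  have := Module.finite_of_finite F (M := Module.Dual F W)
  have := Fintype.ofFinite (Module.Dual F W)
  set Q : ℕ := Fintype.card F ^ Module.finrank F W with hQ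
  have hW : Fintype.card W = Q := by
    rw [Module.card_eq_pow_finrank (K := F) (V := W)]
  have hD : Fintype.card (Module.Dual F W) = Q := by
    rw [Module.card_eq_pow_finrank (K := F) (V := Module.Dual F W), Subspace.dual_finrank_eq]
  have hQ0 : (0 : ℝ) < Q := by
    rw [← hW]
    exact_mod_cast Fintype.card_pos
  have h1 : ∀ v, (Q : ℂ) * Φ (π v) =
      ∑ w : W, ∑ d : Module.Dual F W, Φ w * χ (d (-w)) * χ (d (π v)) := fun v => by
    have h2 : ∀ w : W, ∑ d : Module.Dual F W, Φ w * χ (d (-w)) * χ (d (π v)) =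
        if w = π v then (Q : ℂ) * Φ w else 0 := fun w => by
      have h3 : ∀ d : Module.Dual F W, Φ w * χ (d (-w)) * χ (d (π v)) =
          Φ w * χ (d (π v - w)) := fun d => by
        rw [mul_assoc, ← coe_addChar_add, ← map_add, neg_add_eq_sub]
      rw [Finset.sum_congr rfl fun d _ => h3 d, ← Finset.mul_sum]
      split_ifs with hw
      · rw [hw, sub_self]
        simp [hD, mul_comm]
      · rw [sum_dual_addChar_eq_zero hχ (sub_ne_zero.2 (Ne.symm hw)), mul_zero]
    rw [Finset.sum_congr rfl fun w _ => h2 w, Finset.sum_ite_eq' Finset.univ,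
        if_pos (Finset.mem_univ _)]
  have h2 : (Q : ℂ) * ∑ v ∈ s, a v * Φ (π v) = ∑ w : W, ∑ d : Module.Dual F W,
      Φ w * χ (d (-w)) * ∑ v ∈ s, a v * χ (d (π v)) := by
    calc (Q : ℂ) * ∑ v ∈ s, a v * Φ (π v) = ∑ v ∈ s, a v * ((Q : ℂ) * Φ (π v)) := by
          rw [Finset.mul_sum]
          exact Finset.sum_congr rfl fun v _ => by ring
      _ = ∑ v ∈ s, ∑ w : W, ∑ d : Module.Dual F W,
          Φ w * χ (d (-w)) * (a v * χ (d (π v))) := by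
          refine Finset.sum_congr rfl fun v _ => ?_
          rw [h1, Finset.mul_sum]
          refine Finset.sum_congr rfl fun w _ => ?_
          rw [Finset.mul_sum]
          exact Finset.sum_congr rfl fun d _ => by ring
      _ = _ := by
          rw [Finset.sum_comm]
          refine Finset.sum_congr rfl fun w _ => ?_
          rw [Finset.sum_comm]
          exact Finset.sum_congr rfl fun d _ => by rw [Finset.mul_sum]
  have h3 : (Q : ℝ) * ‖∑ v ∈ s, a v * Φ (π v)‖ ≤ Q * (Q * B) := by
    have h4 : (Q : ℝ) * ‖∑ v ∈ s, a v * Φ (π v)‖ = ‖(Q : ℂ) * ∑ v ∈ s, a v * Φ (π v)‖ := by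
      simp
    rw [h4, h2]
    have h5 : ∀ w : W, ‖∑ d : Module.Dual F W,
        Φ w * χ (d (-w)) * ∑ v ∈ s, a v * χ (d (π v))‖ ≤ Q * B := fun w => by
      refine (norm_sum_le _ _).trans ((Finset.sum_le_card_nsmul _ _ B fun d _ => ?_).trans_eq ?_)
      · rw [norm_mul, norm_mul, Circle.norm_coe, mul_one]
        exact (mul_le_of_le_one_left (norm_nonneg _) (hΦ w)).trans (hB d)
      · rw [Finset.card_univ, hD, nsmul_eq_mul]
    refine (norm_sum_le _ _).trans ((Finset.sum_le_card_nsmul _ _ _ fun w _ => h5 w).trans_eq ?_)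
    rw [Finset.card_univ, hW, nsmul_eq_mul]
  have h4 := le_of_mul_le_mul_left h3 hQ0
  rwa [hQ, Nat.cast_pow] at h4

end Fourier

section Bilinear

/-- A Cauchy–Schwarz bound for bilinear sums. -/
theorem norm_bilinear_pow_four_le {ι κ : Type*} (s : Finset ι) (t : Finset κ) (α : ι → ℂ)
    (hα : ∀ a, ‖α a‖ ≤ 1) (β : κ → ℂ) (e : ι → κ → ℂ) :
    ‖∑ a ∈ s, ∑ w ∈ t, α a * β w * e a w‖ ^ 4 ≤ (s.card : ℝ) ^ 2 * (∑ w ∈ t, ‖β w‖ ^ 2) ^ 2 *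
      ∑ p ∈ t ×ˢ t, ‖∑ a ∈ s, e a p.1 * (starRingEnd ℂ) (e a p.2)‖ ^ 2 := by
  set T : ι → ℂ := fun a => ∑ w ∈ t, β w * e a w with hT
  set Y : ℝ := ∑ p ∈ t ×ˢ t, (‖β p.1‖ * ‖β p.2‖) *
    ‖∑ a ∈ s, e a p.1 * (starRingEnd ℂ) (e a p.2)‖ with hY
  have h1 : ‖∑ a ∈ s, ∑ w ∈ t, α a * β w * e a w‖ ≤ ∑ a ∈ s, ‖T a‖ := by
    refine (norm_sum_le _ _).trans (Finset.sum_le_sum fun a _ => ?_)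
    have h : ∑ w ∈ t, α a * β w * e a w = α a * T a := by
      rw [hT, Finset.mul_sum]
      exact Finset.sum_congr rfl fun w _ => by ring
    rw [h, norm_mul]
    exact mul_le_of_le_one_left (norm_nonneg _) (hα a)
  have h2 : (∑ a ∈ s, ‖T a‖) ^ 2 ≤ s.card * ∑ a ∈ s, ‖T a‖ ^ 2 := sq_sum_le_card_mul_sum_sq
  have h3 : ((∑ a ∈ s, ‖T a‖ ^ 2 : ℝ) : ℂ) = ∑ p ∈ t ×ˢ t, β p.1 * (starRingEnd ℂ) (β p.2) *
      ∑ a ∈ s, e a p.1 * (starRingEnd ℂ) (e a p.2) := by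
    rw [Complex.ofReal_sum]
    simp_rw [Finset.mul_sum]
    rw [Finset.sum_comm]
    refine Finset.sum_congr rfl fun a _ => ?_
    rw [Complex.ofReal_pow, ← Complex.mul_conj', hT]
    simp only
    rw [map_sum, Finset.sum_mul_sum, ← Finset.sum_product']
    refine Finset.sum_congr rfl fun p _ => ?_
    rw [map_mul]
    ring
  have h4 : ∑ a ∈ s, ‖T a‖ ^ 2 ≤ Y := by
    have h : ∑ a ∈ s, ‖T a‖ ^ 2 = ‖((∑ a ∈ s, ‖T a‖ ^ 2 : ℝ) : ℂ)‖ := by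
      rw [Complex.norm_real, Real.norm_of_nonneg (Finset.sum_nonneg fun a _ => by positivity)]
    rw [h, h3]
    refine (norm_sum_le _ _).trans_eq (Finset.sum_congr rfl fun p _ => ?_)
    rw [norm_mul, norm_mul, RCLike.norm_conj]
  have h5 : Y ^ 2 ≤ (∑ w ∈ t, ‖β w‖ ^ 2) ^ 2 *
      ∑ p ∈ t ×ˢ t, ‖∑ a ∈ s, e a p.1 * (starRingEnd ℂ) (e a p.2)‖ ^ 2 := by
    refine (Finset.sum_mul_sq_le_sq_mul_sq _ _ _).trans_eq ?_
    congr 1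
    rw [sq (∑ w ∈ t, ‖β w‖ ^ 2), Finset.sum_mul_sum, ← Finset.sum_product']
    exact Finset.sum_congr rfl fun p _ => mul_pow _ _ 2
  calc ‖∑ a ∈ s, ∑ w ∈ t, α a * β w * e a w‖ ^ 4
      = (‖∑ a ∈ s, ∑ w ∈ t, α a * β w * e a w‖ ^ 2) ^ 2 := by ring
    _ ≤ (s.card * Y) ^ 2 := by
        gcongr
        exact (pow_le_pow_left₀ (norm_nonneg _) h1 2).trans
          (h2.trans (mul_le_mul_of_nonneg_left h4 (Nat.cast_nonneg _)))
    _ ≤ _ := by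
        rw [mul_pow, mul_assoc]
        exact mul_le_mul_of_nonneg_left h5 (by positivity)

end Bilinear

section Vaughan

variable {F : Type*} [Field F] [Fintype F]

theorem sum_monicPairs_comm {f : F[X]} (g h : F[X] → ℤ) :
    ∑ k ∈ monicPairs f, ∑ l ∈ monicPairs k.2, g k.1 * h l.1 =
      ∑ k ∈ monicPairs f, ∑ l ∈ monicPairs k.2, h k.1 * g l.1 := by
  classical
  rw [Finset.sum_sigma', Finset.sum_sigma']
  have key : ∀ x ∈ (monicPairs f).sigma fun k => monicPairs k.2,
      (⟨(x.2.1, x.1.1 * x.2.2), (x.1.1, x.2.2)⟩ : (_ : F[X] × F[X]) × (F[X] × F[X])) ∈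
        (monicPairs f).sigma fun k => monicPairs k.2 := by
    rintro ⟨⟨a, w⟩, ⟨b, c⟩⟩ hx
    simp only [Finset.mem_sigma, mem_monicPairs] at hx ⊢
    obtain ⟨⟨ha, -, rfl⟩, hb, hc, rfl⟩ := hx
    exact ⟨⟨hb, ha.mul hc, by ring⟩, ha, hc, trivial⟩
  refine Finset.sum_nbij' (fun x => ⟨(x.2.1, x.1.1 * x.2.2), (x.1.1, x.2.2)⟩)
    (fun x => ⟨(x.2.1, x.1.1 * x.2.2), (x.1.1, x.2.2)⟩) key key ?_ ?_ ?_
  · rintro ⟨⟨a, w⟩, ⟨b, c⟩⟩ hx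
    simp only [Finset.mem_sigma, mem_monicPairs] at hx
    simp only [hx.2.2.2]
  · rintro ⟨⟨a, w⟩, ⟨b, c⟩⟩ hx
    simp only [Finset.mem_sigma, mem_monicPairs] at hx
    simp only [hx.2.2.2]
  · rintro ⟨⟨a, w⟩, ⟨b, c⟩⟩ _
    exact mul_comm _ _

theorem sum_monicPairs_mul_polyMu {f : F[X]} (hf : f.Monic) (g : F[X] → ℤ) :
    ∑ k ∈ monicPairs f, ∑ l ∈ monicPairs k.2, g k.1 * polyMu l.1 = g f := by
  classical
  rw [Finset.sum_eq_single (f, 1)]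
  · have h1 : monicPairs (1 : F[X]) = {(1, 1)} := by
      ext ⟨a, w⟩
      rw [mem_monicPairs, Finset.mem_singleton, Prod.mk.injEq]
      constructor
      · rintro ⟨ha, hw, h⟩
        exact ⟨ha.eq_one_of_isUnit (IsUnit.of_mul_eq_one _ h),
          hw.eq_one_of_isUnit (IsUnit.of_mul_eq_one _ ((mul_comm _ _).trans h))⟩
      · rintro ⟨rfl, rfl⟩
        exact ⟨monic_one, monic_one, mul_one _⟩
    simp only [h1, Finset.sum_singleton, polyMu_one, mul_one]
  · rintro ⟨a, w⟩ hk hne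
    rw [mem_monicPairs] at hk
    rw [← Finset.mul_sum, sum_monicPairs_polyMu hk.2.1, mul_zero]
    rintro rfl
    exact hne (by rw [← hk.2.2, mul_one])
  · intro h
    exact (h (mem_monicPairs.2 ⟨hf, monic_one, mul_one _⟩)).elim

/-- The Möbius function restricted to degrees `> U`. -/
noncomputable def muHigh (U : ℕ) (f : F[X]) : ℤ := if U < f.natDegree then polyMu f else 0

/-- The Möbius function restricted to degrees `≤ U`. -/
noncomputable def muLow (U : ℕ) (f : F[X]) : ℤ := if U < f.natDegree then 0 else polyMu f

theorem muHigh_add_muLow (U : ℕ) (f : F[X]) : muHigh U f + muLow U f = polyMu f := by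
  unfold muHigh muLow
  split_ifs <;> simp

theorem norm_muHigh_le (U : ℕ) (f : F[X]) : ‖(muHigh U f : ℂ)‖ ≤ 1 := by
  unfold muHigh
  split_ifs
  · rw [Complex.norm_intCast]
    exact_mod_cast abs_polyMu_le f
  · simp

theorem norm_muLow_le (U : ℕ) (f : F[X]) : ‖(muLow U f : ℂ)‖ ≤ 1 := by
  unfold muLow
  split_ifs
  · simp
  · rw [Complex.norm_intCast]
    exact_mod_cast abs_polyMu_le f

/-- Vaughan's identity. -/
theorem polyMu_eq_vaughan {f : F[X]} (hf : f.Monic) {U : ℕ} (hU : U < f.natDegree) :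
    polyMu f = ∑ k ∈ monicPairs f, ∑ l ∈ monicPairs k.2, muHigh U k.1 * muHigh U l.1 -
      ∑ k ∈ monicPairs f, ∑ l ∈ monicPairs k.2, muLow U k.1 * muLow U l.1 := by
  have h1 := sum_monicPairs_mul_polyMu hf (muHigh U)
  have h2 := sum_monicPairs_mul_polyMu hf (muLow U)
  rw [sum_monicPairs_comm] at h2
  simp only [← muHigh_add_muLow U, mul_add, add_mul, Finset.sum_add_distrib] at h1 h2
  have h3 : muLow U f = 0 := if_pos hU
  rw [← muHigh_add_muLow U f]
  linarith

theorem card_monicPairs_mul_le {d x : F[X]} (hd : d.Monic) (hx : x.Monic) :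
    (monicPairs (d * x)).card ≤ (monicPairs d).card * (monicPairs x).card := by
  classical
  rw [← Finset.card_product]
  refine Finset.card_le_card_of_surjOn (fun p => (p.1.1 * p.2.1, p.1.2 * p.2.2)) ?_
  rintro ⟨a, b⟩ hab
  rw [Finset.mem_coe, mem_monicPairs] at hab
  obtain ⟨ha, hb, hab⟩ := hab
  simp only at ha hb hab
  obtain ⟨a₁, a₂, ⟨b₁, h₁⟩, ⟨b₂, h₂⟩, rfl⟩ := exists_dvd_and_dvd_of_dvd_mul ⟨b, hab.symm⟩
  have key : ∀ {y a₀ b₀ : F[X]}, y.Monic → y = a₀ * b₀ →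
      (normalize a₀, normalize b₀) ∈ monicPairs y := fun {y a₀ b₀} hy h => by
    have ha₀ : a₀ ≠ 0 := fun h0 => hy.ne_zero (by rw [h, h0, zero_mul])
    have hb₀ : b₀ ≠ 0 := fun h0 => hy.ne_zero (by rw [h, h0, mul_zero])
    refine mem_monicPairs.2 ⟨monic_normalize ha₀, monic_normalize hb₀, ?_⟩
    simp only
    rw [← normalize_mul, ← h, hy.normalize_eq_self]
  refine ⟨((normalize a₁, normalize b₁), (normalize a₂, normalize b₂)),
    Finset.mem_coe.2 (Finset.mem_product.2 ⟨key hd h₁, key hx h₂⟩), ?_⟩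
  have h3 : normalize a₁ * normalize a₂ = a₁ * a₂ := by
    rw [← normalize_mul, ha.normalize_eq_self]
  simp only
  rw [Prod.mk.injEq]
  refine ⟨h3, mul_left_cancel₀ ha.ne_zero ?_⟩
  rw [hab, ← h3, mul_mul_mul_comm, (mem_monicPairs.1 (key hd h₁)).2.2,
    (mem_monicPairs.1 (key hx h₂)).2.2]

theorem sum_card_monicPairs (m : ℕ) :
    ∑ f ∈ monics F m, (monicPairs f).card = (m + 1) * Fintype.card F ^ m := by
  have h := sum_monics_monicPairs m fun _ _ : F[X] => 1
  simp only [Finset.sum_const, smul_eq_mul, mul_one] at h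
  rw [h, ← Finset.Nat.card_antidiagonal m, ← smul_eq_mul, ← Finset.sum_const]
  refine Finset.sum_congr rfl fun ij hij => ?_
  rw [card_monics, card_monics, ← pow_add, Finset.HasAntidiagonal.mem_antidiagonal.1 hij]

theorem sum_card_monicPairs_sq_le (m : ℕ) :
    ∑ f ∈ monics F m, (monicPairs f).card ^ 2 ≤ (m + 1) ^ 3 * Fintype.card F ^ m := by
  calc ∑ f ∈ monics F m, (monicPairs f).card ^ 2
      = ∑ f ∈ monics F m, ∑ k ∈ monicPairs f, (monicPairs (k.1 * k.2)).card := by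
        refine Finset.sum_congr rfl fun f _ => ?_
        rw [Finset.sum_congr rfl fun k hk => by rw [(mem_monicPairs.1 hk).2.2], Finset.sum_const,
          smul_eq_mul, sq]
    _ = ∑ ij ∈ Finset.HasAntidiagonal.antidiagonal m, ∑ a ∈ monics F ij.1, ∑ w ∈ monics F ij.2,
          (monicPairs (a * w)).card := sum_monics_monicPairs m fun a w => (monicPairs (a * w)).card
    _ ≤ ∑ ij ∈ Finset.HasAntidiagonal.antidiagonal m, ∑ a ∈ monics F ij.1, ∑ w ∈ monics F ij.2,
          (monicPairs a).card * (monicPairs w).card := by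
        refine Finset.sum_le_sum fun ij _ => Finset.sum_le_sum fun a ha =>
          Finset.sum_le_sum fun w hw => card_monicPairs_mul_le (mem_monics.1 ha).1 (mem_monics.1 hw).1
    _ ≤ ∑ ij ∈ Finset.HasAntidiagonal.antidiagonal m, (m + 1) ^ 2 * Fintype.card F ^ m := by
        refine Finset.sum_le_sum fun ij hij => ?_
        rw [← Finset.sum_mul_sum, sum_card_monicPairs, sum_card_monicPairs]
        rw [Finset.HasAntidiagonal.mem_antidiagonal] at hij
        rw [mul_mul_mul_comm, ← pow_add, hij, sq]
        gcongr <;> omega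
    _ = _ := by
        rw [Finset.sum_const, Finset.Nat.card_antidiagonal, smul_eq_mul]
        ring

end Vaughan

section TypeSums

variable {F : Type*} [Field F] [Fintype F]

/-- The correlation of the phases `a ↦ e (a * w)` and `a ↦ e (a * w')` on monic polynomials of
degree `i`. -/
noncomputable def phaseCorr (e : F[X] → ℂ) (i : ℕ) (p : F[X] × F[X]) : ℂ :=
  ∑ a ∈ monics F i, e (a * p.1) * (starRingEnd ℂ) (e (a * p.2))

theorem norm_phaseCorr_le {e : F[X] → ℂ} (he : ∀ f, ‖e f‖ ≤ 1) (i : ℕ) (p : F[X] × F[X]) :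
    ‖phaseCorr e i p‖ ≤ (Fintype.card F : ℝ) ^ i := by
  refine (norm_sum_le _ _).trans ((Finset.sum_le_card_nsmul _ _ 1 fun a _ => ?_).trans_eq ?_)
  · rw [norm_mul, RCLike.norm_conj]
    exact mul_le_one₀ (he _) (norm_nonneg _) (he _)
  · rw [card_monics, nsmul_eq_mul, mul_one, Nat.cast_pow]

open scoped Classical in
theorem norm_typeII_le {e : F[X] → ℂ} (he : ∀ f, ‖e f‖ ≤ 1) {i j s : ℕ}
    (h : (((monics F j ×ˢ monics F j).filter fun p => (Fintype.card F : ℝ) ^ (2 * i) <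
      ‖phaseCorr e i p‖ ^ 2 * (Fintype.card F : ℝ) ^ (4 * s)).card : ℝ) *
        (Fintype.card F : ℝ) ^ (4 * s) ≤ (Fintype.card F : ℝ) ^ (2 * j)) {α β : F[X] → ℂ}
    (hα : ∀ a, ‖α a‖ ≤ 1) (hβ : ∀ w ∈ monics F j, ‖β w‖ ≤ (monicPairs w).card) :
    ‖∑ a ∈ monics F i, ∑ w ∈ monics F j, α a * β w * e (a * w)‖ * (Fintype.card F : ℝ) ^ s ≤
      2 * (j + 1) ^ 2 * (Fintype.card F : ℝ) ^ (i + j) := by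
  set q : ℝ := (Fintype.card F : ℝ) with hq
  have hq0 : 0 < q := by
    rw [hq]
    exact_mod_cast Fintype.card_pos
  set bad := (monics F j ×ˢ monics F j).filter fun p => q ^ (2 * i) <
      ‖phaseCorr e i p‖ ^ 2 * q ^ (4 * s) with hbad
  have h1 : ‖∑ a ∈ monics F i, ∑ w ∈ monics F j, α a * β w * e (a * w)‖ ^ 4 ≤
      ((monics F i).card : ℝ) ^ 2 * (∑ w ∈ monics F j, ‖β w‖ ^ 2) ^ 2 *
        ∑ p ∈ monics F j ×ˢ monics F j, ‖phaseCorr e i p‖ ^ 2 :=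
    norm_bilinear_pow_four_le (monics F i) (monics F j) α hα β fun a w => e (a * w)
  rw [card_monics, Nat.cast_pow, ← hq] at h1
  generalize ‖∑ a ∈ monics F i, ∑ w ∈ monics F j, α a * β w * e (a * w)‖ = S at h1 ⊢
  have h2 : ∑ w ∈ monics F j, ‖β w‖ ^ 2 ≤ (j + 1) ^ 3 * q ^ j := by
    refine (Finset.sum_le_sum fun w hw => pow_le_pow_left₀ (norm_nonneg _) (hβ w hw) 2).trans ?_
    have := sum_card_monicPairs_sq_le (F := F) j
    rw [hq]
    exact_mod_cast this
  have h3 : (∑ p ∈ monics F j ×ˢ monics F j, ‖phaseCorr e i p‖ ^ 2) * q ^ (4 * s) ≤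
      2 * q ^ (2 * (i + j)) := by
    have h4 : ∀ p ∈ monics F j ×ˢ monics F j, ‖phaseCorr e i p‖ ^ 2 * q ^ (4 * s) ≤
        q ^ (2 * i) + if q ^ (2 * i) < ‖phaseCorr e i p‖ ^ 2 * q ^ (4 * s) then
          q ^ (2 * i) * q ^ (4 * s) else 0 := fun p _ => by
      split_ifs with hp
      · have : ‖phaseCorr e i p‖ ^ 2 ≤ q ^ (2 * i) := by
          rw [mul_comm 2 i, pow_mul]
          exact pow_le_pow_left₀ (norm_nonneg _) (norm_phaseCorr_le he i p) 2
        have := mul_le_mul_of_nonneg_right this (pow_nonneg hq0.le (4 * s))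
        have := pow_nonneg hq0.le (2 * i)
        linarith
      · linarith
    rw [Finset.sum_mul]
    refine (Finset.sum_le_sum h4).trans ?_
    rw [Finset.sum_add_distrib, ← Finset.sum_filter, Finset.sum_const, Finset.sum_const,
      Finset.card_product, card_monics, nsmul_eq_mul, nsmul_eq_mul, ← hbad]
    push_cast
    rw [← hq]
    have h5 := mul_le_mul_of_nonneg_right h (pow_nonneg hq0.le (2 * i))
    have h6 : q ^ (2 * (i + j)) = q ^ (2 * j) * q ^ (2 * i) := by ring
    have h7 : q ^ j * q ^ j * q ^ (2 * i) = q ^ (2 * j) * q ^ (2 * i) := by ring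
    rw [h6, h7]
    nlinarith
  have h4 : (S * q ^ s) ^ 4 ≤ (2 * (j + 1) ^ 2 * q ^ (i + j)) ^ 4 := by
    have hj : (1 : ℝ) ≤ j + 1 := by
      have : (0 : ℝ) ≤ j := Nat.cast_nonneg j
      linarith
    generalize ∑ p ∈ monics F j ×ˢ monics F j, ‖phaseCorr e i p‖ ^ 2 = P at h1 h3
    have h5 : (∑ w ∈ monics F j, ‖β w‖ ^ 2) ^ 2 ≤ ((j + 1) ^ 3 * q ^ j) ^ 2 :=
      pow_le_pow_left₀ (Finset.sum_nonneg fun w _ => by positivity) h2 2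
    have hZ : 0 ≤ (∑ w ∈ monics F j, ‖β w‖ ^ 2) ^ 2 := sq_nonneg _
    generalize (∑ w ∈ monics F j, ‖β w‖ ^ 2) ^ 2 = Z at h1 h5 hZ
    calc (S * q ^ s) ^ 4 = S ^ 4 * q ^ (4 * s) := by ring
      _ ≤ ((q ^ i) ^ 2 * Z * P) * q ^ (4 * s) :=
          mul_le_mul_of_nonneg_right h1 (pow_nonneg hq0.le _)
      _ = ((q ^ i) ^ 2 * Z) * (P * q ^ (4 * s)) := by ring
      _ ≤ ((q ^ i) ^ 2 * Z) * (2 * q ^ (2 * (i + j))) := by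
          refine mul_le_mul_of_nonneg_left h3 (mul_nonneg (by positivity) ?_)
          exact hZ
      _ ≤ ((q ^ i) ^ 2 * ((j + 1) ^ 3 * q ^ j) ^ 2) * (2 * q ^ (2 * (i + j))) := by
          gcongr
      _ = 2 * (j + 1) ^ 6 * q ^ (4 * (i + j)) := by ring
      _ ≤ 16 * (j + 1) ^ 8 * q ^ (4 * (i + j)) := by
          gcongr
          · norm_num
          · norm_num
      _ = _ := by ring
  exact le_of_pow_le_pow_left₀ (by norm_num) (by positivity) h4

/-- The bilinear method for sums over the Möbius function. -/
theorem norm_sum_polyMu_mul_le_of_bilinear {e : F[X] → ℂ} (he : ∀ f, ‖e f‖ ≤ 1) {m U s : ℕ}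
    (hU : U < m)
    (hI : ∀ i ≤ 2 * U, ∀ l, i + l = m → ∀ d ∈ monics F i, ‖∑ c ∈ monics F l, e (d * c)‖ *
      (Fintype.card F : ℝ) ^ s ≤ (Fintype.card F : ℝ) ^ l)
    (hII : ∀ i j, U < i → U < j → i + j = m → ∀ bad : Finset (F[X] × F[X]),
      (∀ p ∈ bad, p ∈ monics F j ×ˢ monics F j ∧ (Fintype.card F : ℝ) ^ (2 * i) <
        ‖phaseCorr e i p‖ ^ 2 * (Fintype.card F : ℝ) ^ (4 * s)) →
      (bad.card : ℝ) * (Fintype.card F : ℝ) ^ (4 * s) ≤ (Fintype.card F : ℝ) ^ (2 * j)) :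
    ‖∑ f ∈ monics F m, (polyMu f : ℂ) * e f‖ * (Fintype.card F : ℝ) ^ s ≤
      3 * (m + 1) ^ 3 * (Fintype.card F : ℝ) ^ m := by
  classical
  set q : ℝ := (Fintype.card F : ℝ) with hq
  have hq0 : 0 < q := by
    rw [hq]
    exact_mod_cast Fintype.card_pos
  have hm0 : (0 : ℝ) ≤ m := Nat.cast_nonneg m
  set β : F[X] → ℂ := fun w => ∑ l ∈ monicPairs w, (muHigh U l.1 : ℂ) with hβ
  set A : ℂ := ∑ ij ∈ Finset.HasAntidiagonal.antidiagonal m, ∑ a ∈ monics F ij.1,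
    ∑ w ∈ monics F ij.2, (muHigh U a : ℂ) * β w * e (a * w) with hA
  set D : ℂ := ∑ ij ∈ Finset.HasAntidiagonal.antidiagonal m, ∑ a ∈ monics F ij.1,
    ∑ kl ∈ Finset.HasAntidiagonal.antidiagonal ij.2, ∑ b ∈ monics F kl.1, ∑ c ∈ monics F kl.2,
      (muLow U a : ℂ) * muLow U b * e (a * (b * c)) with hD
  have h1 : ∑ f ∈ monics F m, (polyMu f : ℂ) * e f = A - D := by
    have h2 : D = ∑ f ∈ monics F m, ∑ k ∈ monicPairs f, ∑ l ∈ monicPairs k.2,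
        (muLow U k.1 : ℂ) * muLow U l.1 * e f := by
      have h3 : ∀ f ∈ monics F m, ∑ k ∈ monicPairs f, ∑ l ∈ monicPairs k.2,
          (muLow U k.1 : ℂ) * muLow U l.1 * e f = ∑ k ∈ monicPairs f, (fun a w =>
            ∑ l ∈ monicPairs w, (muLow U a : ℂ) * muLow U l.1 * e (a * (l.1 * l.2))) k.1 k.2 := by
        intro f _
        refine Finset.sum_congr rfl fun k hk => Finset.sum_congr rfl fun l hl => ?_
        rw [(mem_monicPairs.1 hl).2.2, (mem_monicPairs.1 hk).2.2]
      rw [Finset.sum_congr rfl h3, sum_monics_monicPairs m fun a w =>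
        ∑ l ∈ monicPairs w, (muLow U a : ℂ) * muLow U l.1 * e (a * (l.1 * l.2))]
      refine Finset.sum_congr rfl fun ij _ => Finset.sum_congr rfl fun a _ => ?_
      exact (sum_monics_monicPairs ij.2
        fun b c => (muLow U a : ℂ) * muLow U b * e (a * (b * c))).symm
    have h3 : A = ∑ f ∈ monics F m, ∑ k ∈ monicPairs f, ∑ l ∈ monicPairs k.2,
        (muHigh U k.1 : ℂ) * muHigh U l.1 * e f := by
      rw [hA, ← sum_monics_monicPairs m fun a w => (muHigh U a : ℂ) * β w * e (a * w)]
      refine Finset.sum_congr rfl fun f _ => Finset.sum_congr rfl fun k hk => ?_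
      rw [(mem_monicPairs.1 hk).2.2, hβ]
      simp only
      rw [Finset.mul_sum, Finset.sum_mul]
    rw [h2, h3, ← Finset.sum_sub_distrib]
    refine Finset.sum_congr rfl fun f hf => ?_
    rw [mem_monics] at hf
    rw [polyMu_eq_vaughan hf.1 (hf.2.symm ▸ hU : U < f.natDegree)]
    push_cast
    rw [sub_mul, Finset.sum_mul, Finset.sum_mul]
    simp only [Finset.sum_mul]
  have hAle : ‖A‖ * q ^ s ≤ 2 * (m + 1) ^ 3 * q ^ m := by
    have h2 : ∀ ij ∈ Finset.HasAntidiagonal.antidiagonal m, ‖∑ a ∈ monics F ij.1,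
        ∑ w ∈ monics F ij.2, (muHigh U a : ℂ) * β w * e (a * w)‖ * q ^ s ≤
          2 * (m + 1) ^ 2 * q ^ m := by
      intro ij hij
      rw [Finset.HasAntidiagonal.mem_antidiagonal] at hij
      by_cases hi : U < ij.1
      · by_cases hj : U < ij.2
        · refine (norm_typeII_le he (hII ij.1 ij.2 hi hj hij _ fun p hp => ?_)
            (norm_muHigh_le U) fun w _ => ?_).trans ?_
          · exact Finset.mem_filter.1 hp
          · refine (norm_sum_le _ _).trans
              ((Finset.sum_le_card_nsmul _ _ 1 fun l _ => norm_muHigh_le U l.1).trans_eq ?_)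
            rw [nsmul_eq_mul, mul_one]
          · rw [hij, ← hq]
            have : (ij.2 : ℝ) ≤ m := by
              rw [← hij]
              exact_mod_cast Nat.le_add_left _ _
            gcongr
        · have h3 : ∀ a ∈ monics F ij.1, ∑ w ∈ monics F ij.2,
              (muHigh U a : ℂ) * β w * e (a * w) = 0 := fun a _ =>
            Finset.sum_eq_zero fun w hw => by
              have : β w = 0 := Finset.sum_eq_zero fun l hl => by
                rw [mem_monicPairs] at hl
                have h4 := congrArg natDegree hl.2.2
                rw [hl.1.natDegree_mul hl.2.1, (mem_monics.1 hw).2] at h4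
                rw [muHigh, if_neg (by omega), Int.cast_zero]
              rw [this, mul_zero, zero_mul]
          rw [Finset.sum_eq_zero h3, norm_zero, zero_mul]
          positivity
      · have h3 : ∀ a ∈ monics F ij.1, ∑ w ∈ monics F ij.2,
            (muHigh U a : ℂ) * β w * e (a * w) = 0 := fun a ha =>
          Finset.sum_eq_zero fun w _ => by
            rw [muHigh, (mem_monics.1 ha).2, if_neg hi, Int.cast_zero, zero_mul, zero_mul]
        rw [Finset.sum_eq_zero h3, norm_zero, zero_mul]
        positivity
    calc ‖A‖ * q ^ s ≤ ∑ ij ∈ Finset.HasAntidiagonal.antidiagonal m, ‖∑ a ∈ monics F ij.1,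
        ∑ w ∈ monics F ij.2, (muHigh U a : ℂ) * β w * e (a * w)‖ * q ^ s := by
          rw [← Finset.sum_mul]
          exact mul_le_mul_of_nonneg_right (norm_sum_le _ _) (by positivity)
      _ ≤ _ := (Finset.sum_le_card_nsmul _ _ _ h2).trans_eq (by
          rw [Finset.Nat.card_antidiagonal, nsmul_eq_mul]
          push_cast
          ring)
  have hDle : ‖D‖ * q ^ s ≤ (m + 1) ^ 2 * q ^ m := by
    have h2 : ∀ ij ∈ Finset.HasAntidiagonal.antidiagonal m, ∀ a ∈ monics F ij.1,
        ∀ kl ∈ Finset.HasAntidiagonal.antidiagonal ij.2, ∀ b ∈ monics F kl.1,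
        ‖∑ c ∈ monics F kl.2, (muLow U a : ℂ) * muLow U b * e (a * (b * c))‖ * q ^ s ≤
          q ^ kl.2 := by
      intro ij hij a ha kl hkl b hb
      rw [Finset.HasAntidiagonal.mem_antidiagonal] at hij hkl
      rw [← Finset.mul_sum, norm_mul, norm_mul]
      by_cases hi : U < ij.1
      · rw [muLow, (mem_monics.1 ha).2, if_pos hi]
        simp only [Int.cast_zero, norm_zero, zero_mul]
        positivity
      by_cases hk : U < kl.1
      · rw [muLow, muLow, (mem_monics.1 hb).2, if_pos hk]
        simp only [Int.cast_zero, norm_zero, zero_mul, mul_zero]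
        positivity
      have h3 := hI (ij.1 + kl.1) (by omega) kl.2 (by omega) (a * b) (mul_mem_monics ha hb)
      simp only [mul_assoc] at h3
      rw [mul_assoc]
      refine (mul_le_of_le_one_left (by positivity) ?_).trans h3
      exact mul_le_one₀ (norm_muLow_le U a) (norm_nonneg _) (norm_muLow_le U b)
    have h3 : ∀ ij ∈ Finset.HasAntidiagonal.antidiagonal m, ∀ a ∈ monics F ij.1,
        ∀ kl ∈ Finset.HasAntidiagonal.antidiagonal ij.2,
        ‖∑ b ∈ monics F kl.1, ∑ c ∈ monics F kl.2,
          (muLow U a : ℂ) * muLow U b * e (a * (b * c))‖ * q ^ s ≤ q ^ ij.2 := by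
      intro ij hij a ha kl hkl
      refine (mul_le_mul_of_nonneg_right (norm_sum_le _ _) (by positivity)).trans ?_
      rw [Finset.sum_mul]
      refine (Finset.sum_le_card_nsmul _ _ _ fun b hb => h2 ij hij a ha kl hkl b hb).trans_eq ?_
      rw [card_monics, nsmul_eq_mul, Nat.cast_pow, ← hq, ← pow_add,
        Finset.HasAntidiagonal.mem_antidiagonal.1 hkl]
    have h4 : ∀ ij ∈ Finset.HasAntidiagonal.antidiagonal m, ∀ a ∈ monics F ij.1,
        ‖∑ kl ∈ Finset.HasAntidiagonal.antidiagonal ij.2, ∑ b ∈ monics F kl.1,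
          ∑ c ∈ monics F kl.2, (muLow U a : ℂ) * muLow U b * e (a * (b * c))‖ * q ^ s ≤
          (m + 1) * q ^ ij.2 := by
      intro ij hij a ha
      refine (mul_le_mul_of_nonneg_right (norm_sum_le _ _) (by positivity)).trans ?_
      rw [Finset.sum_mul]
      refine (Finset.sum_le_card_nsmul _ _ _ fun kl hkl => h3 ij hij a ha kl hkl).trans ?_
      rw [Finset.Nat.card_antidiagonal, nsmul_eq_mul]
      refine mul_le_mul_of_nonneg_right ?_ (by positivity)
      rw [← Finset.HasAntidiagonal.mem_antidiagonal.1 hij]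
      push_cast
      have : (0 : ℝ) ≤ ij.1 := Nat.cast_nonneg _
      linarith
    have h5 : ∀ ij ∈ Finset.HasAntidiagonal.antidiagonal m, ‖∑ a ∈ monics F ij.1,
        ∑ kl ∈ Finset.HasAntidiagonal.antidiagonal ij.2, ∑ b ∈ monics F kl.1,
          ∑ c ∈ monics F kl.2, (muLow U a : ℂ) * muLow U b * e (a * (b * c))‖ * q ^ s ≤
          (m + 1) * q ^ m := by
      intro ij hij
      refine (mul_le_mul_of_nonneg_right (norm_sum_le _ _) (by positivity)).trans ?_
      rw [Finset.sum_mul]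
      refine (Finset.sum_le_card_nsmul _ _ _ fun a ha => h4 ij hij a ha).trans_eq ?_
      rw [card_monics, nsmul_eq_mul, Nat.cast_pow, ← hq, mul_left_comm, ← pow_add,
        Finset.HasAntidiagonal.mem_antidiagonal.1 hij]
    rw [hD]
    refine (mul_le_mul_of_nonneg_right (norm_sum_le _ _) (by positivity)).trans ?_
    rw [Finset.sum_mul]
    refine (Finset.sum_le_card_nsmul _ _ _ h5).trans_eq ?_
    rw [Finset.Nat.card_antidiagonal, nsmul_eq_mul]
    push_cast
    ring
  rw [h1]
  have h2 : (m + 1 : ℝ) ^ 2 * q ^ m ≤ (m + 1) ^ 3 * q ^ m := by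
    gcongr
    · linarith
    · norm_num
  calc ‖A - D‖ * q ^ s ≤ (‖A‖ + ‖D‖) * q ^ s :=
        mul_le_mul_of_nonneg_right (norm_sub_le _ _) (by positivity)
    _ ≤ _ := by linarith

end TypeSums

section LinearPhase

variable {F : Type*} [Field F] [Fintype F]

theorem exists_monic_of_ne_zero {g : F[X]} (hg : g ≠ 0) {B : F[X] →ₗ[F] F} {V : Submodule F F[X]}
    (h : ∀ x ∈ V, B (g * x) = 0) :
    ∃ G : F[X], G.Monic ∧ G.natDegree = g.natDegree ∧ ∀ x ∈ V, B (G * x) = 0 := by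
  refine ⟨g * C g.leadingCoeff⁻¹, monic_mul_leadingCoeff_inv hg,
    natDegree_mul_leadingCoeff_inv g hg, fun x hx => ?_⟩
  rw [mul_right_comm, mul_comm, ← smul_eq_C_mul, map_smul, h x hx, smul_zero]

/-- The phase `χ ∘ l` either satisfies the bilinear bound or is periodic. -/
theorem bound_or_exists_of_linear {χ : AddChar F Circle} (hχ : χ ≠ 1) (l : F[X] →ₗ[F] F)
    {m s : ℕ} (hm : 4 * s < m) :
    ‖∑ f ∈ monics F m, (polyMu f : ℂ) * χ (l f)‖ * (Fintype.card F : ℝ) ^ s ≤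
        3 * (m + 1) ^ 3 * (Fintype.card F : ℝ) ^ m ∨
      ∃ G : F[X], G.Monic ∧ G.natDegree ≤ 8 * s ∧
        ∀ x ∈ degreeLT F (m - 8 * s - 1), l (G * x) = 0 := by
  classical
  by_contra! hcon
  obtain ⟨h1, h2⟩ := hcon
  refine h1.not_ge (norm_sum_polyMu_mul_le_of_bilinear (U := 4 * s)
    (fun f => (Circle.norm_coe (χ (l f))).le) hm ?_ ?_)
  · intro i hi l' hil d hd
    rw [mem_monics] at hd
    by_contra! h
    have h0 : ∑ c ∈ monics F l', (χ ((l ∘ₗ LinearMap.mulLeft F d) c) : ℂ) ≠ 0 := fun h0 => by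
      simp only [LinearMap.comp_apply, LinearMap.mulLeft_apply] at h0
      rw [h0, norm_zero, zero_mul] at h
      exact h.not_ge (by positivity)
    have h3 := forall_eq_zero_of_sum_monics_ne_zero hχ h0
    obtain ⟨x, hx, hx0⟩ := h2 d hd.1 (by omega)
    exact hx0 (h3 x (degreeLT_mono (by omega) hx))
  · intro i j hi hj hij bad hbad
    have h3 : ∀ p ∈ bad, p.1 - p.2 ∈ hankelKer l j i := by
      intro p hp
      have hp' := hbad p hp
      rw [Finset.mem_product] at hp'
      have h0 : ∑ a ∈ monics F i, (χ ((l ∘ₗ LinearMap.mulLeft F (p.1 - p.2)) a) : ℂ) ≠ 0 := by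
        intro h0
        refine hp'.2.not_ge ?_
        have : phaseCorr (fun f => (χ (l f) : ℂ)) i p = 0 := by
          rw [← h0]
          refine Finset.sum_congr rfl fun a _ => ?_
          rw [conj_coe_addChar, ← coe_addChar_add, LinearMap.comp_apply, LinearMap.mulLeft_apply,
            ← sub_eq_add_neg, ← map_sub, ← mul_sub, mul_comm]
        rw [this, norm_zero]
        simp only [ne_eq, OfNat.ofNat_ne_zero, not_false_eq_true, zero_pow, zero_mul]
        positivity
      refine ⟨?_, fun w hw => forall_eq_zero_of_sum_monics_ne_zero hχ h0 w hw⟩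
      have hm1 := mem_monics.1 hp'.1.1
      have hm2 := mem_monics.1 hp'.1.2
      rw [mem_degreeLT]
      refine (degree_sub_lt_left ?_ hm1.1.ne_zero ?_).trans_eq ?_
      · rw [degree_eq_natDegree hm1.1.ne_zero, degree_eq_natDegree hm2.1.ne_zero, hm1.2, hm2.2]
      · rw [hm1.1.leadingCoeff, hm2.1.leadingCoeff]
      · rw [degree_eq_natDegree hm1.1.ne_zero, hm1.2]
    have h4 : bad.card ≤ Fintype.card F ^ (j + Module.finrank F (hankelKer l j i)) := by
      rw [pow_add, ← card_monics, ← card_filter_mem_submodule (hankelKer_le_degreeLT (B := l) j i),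
        ← Finset.card_product]
      refine Finset.card_le_card_of_injOn (fun p => (p.2, p.1 - p.2)) (fun p hp => ?_) ?_
      · rw [Finset.mem_coe, Finset.mem_product, Finset.mem_filter]
        exact ⟨(Finset.mem_product.1 (hbad p hp).1).2,
          mem_lows.2 (mem_degreeLT.1 (h3 p hp).1), h3 p hp⟩
      · rintro ⟨a, b⟩ _ ⟨a', b'⟩ _ h
        simp only [Prod.mk.injEq] at h
        obtain ⟨rfl, h⟩ := h
        rw [sub_left_inj.1 h]
    by_cases h5 : Module.finrank F (hankelKer l j i) + 4 * s ≤ j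
    · have h6 : bad.card * Fintype.card F ^ (4 * s) ≤ Fintype.card F ^ (2 * j) := by
        refine (Nat.mul_le_mul_right _ h4).trans ?_
        rw [← pow_add]
        exact Nat.pow_le_pow_right Fintype.card_pos (by omega)
      exact_mod_cast h6
    · obtain ⟨g, hg0, hgd, hg⟩ := exists_ne_zero_of_finrank_hankelKer (B := l) (N := m - 1)
        (D := j) (W := i) (r := 4 * s) (by omega) (by omega) (by omega) (by omega)
      obtain ⟨G, hG, hGd, hGl⟩ := exists_monic_of_ne_zero hg0 hg
      obtain ⟨x, hx, hx0⟩ := h2 G hG (by omega)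
      exact (hx0 (hGl x (degreeLT_mono (by omega) hx))).elim

theorem three_le_card (hF : ringChar F ≠ 2) : 3 ≤ Fintype.card F := by
  have h1 : 1 < Fintype.card F := Fintype.one_lt_card
  have h2 := FiniteField.odd_card_of_char_ne_two hF
  omega

theorem pow_eight_le {q : ℝ} (hq : 3 ≤ q) (m : ℕ) :
    ((8 / 7 * q ^ (3 / 4 : ℝ)) ^ m) ^ 8 ≤ q ^ (7 * m) := by
  have hq0 : 0 ≤ q := by linarith
  have h1 : (q ^ (3 / 4 : ℝ)) ^ 8 = q ^ 6 := by
    rw [← Real.rpow_natCast (q ^ (3 / 4 : ℝ)), ← Real.rpow_mul hq0, ← Real.rpow_natCast q 6]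
    norm_num
  rw [← pow_mul, mul_comm m 8, pow_mul, pow_mul, mul_pow, h1]
  gcongr
  have : (8 / 7 : ℝ) ^ 8 ≤ q := le_trans (by norm_num) hq
  calc (8 / 7 : ℝ) ^ 8 * q ^ 6 ≤ q * q ^ 6 := by gcongr
    _ = q ^ 7 := by ring

/-- The correlation of the Möbius function with a linear phase. -/
theorem norm_sum_polyMu_linear_le {χ : AddChar F Circle} (hχ : χ ≠ 1) (hF : ringChar F ≠ 2)
    (l : F[X] →ₗ[F] F) {m s : ℕ} (hm : 456 * s + 72 ≤ m) :
    ‖∑ f ∈ monics F m, (polyMu f : ℂ) * χ (l f)‖ * (Fintype.card F : ℝ) ^ s ≤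
      3 * (m + 1) ^ 3 * (Fintype.card F : ℝ) ^ m := by
  rcases bound_or_exists_of_linear hχ l (m := m) (s := s) (by omega) with h | ⟨G, hG, hGd, hGl⟩
  · exact h
  have h1 := norm_sum_polyMu_periodic_le hG (8 * s + 2) m (fun f => (χ (l f) : ℂ))
    (fun f => (Circle.norm_coe _).le) fun f _ f' _ hdvd hdeg => by
      obtain ⟨y, hy⟩ := hdvd
      have h2 : l (f - f') = 0 := by
        by_cases h0 : f - f' = 0
        · rw [h0, map_zero]
        · rw [hy]
          refine hGl y ?_
          have hy0 : y ≠ 0 := fun h => h0 (by rw [hy, h, mul_zero])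
          have h3 := hdeg h0
          have h4 := natDegree_le_of_dvd (Dvd.intro_left G hy.symm) h0
          rw [mem_degreeLT, degree_eq_natDegree hy0]
          exact_mod_cast (by omega : y.natDegree < m - 8 * s - 1)
      rw [map_sub, sub_eq_zero] at h2
      simp only [h2]
  have hq : (3 : ℝ) ≤ Fintype.card F := by exact_mod_cast three_le_card hF
  set q : ℝ := (Fintype.card F : ℝ) with hq'
  have hq1 : 1 ≤ q := by linarith
  set L : ℝ := (8 / 7 * q ^ (3 / 4 : ℝ)) ^ m with hL
  have hL0 : 0 ≤ L := by positivity
  have h2 : q ^ (G.natDegree + 1) * (q ^ (G.natDegree + (8 * s + 2)) *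
      (8 ^ (G.natDegree + (8 * s + 2)) * (1 + q) * L)) ≤ q ^ (56 * s + 9) * L := by
    have h3 : (8 : ℝ) ≤ q ^ 2 := by nlinarith
    have h4 : 1 + q ≤ q ^ 2 := by nlinarith
    calc q ^ (G.natDegree + 1) * (q ^ (G.natDegree + (8 * s + 2)) *
        (8 ^ (G.natDegree + (8 * s + 2)) * (1 + q) * L))
        ≤ q ^ (8 * s + 1) * (q ^ (8 * s + (8 * s + 2)) *
        ((q ^ 2) ^ (8 * s + (8 * s + 2)) * q ^ 2 * L)) := by
          have h5 : (8 : ℝ) ^ (G.natDegree + (8 * s + 2)) ≤ (q ^ 2) ^ (8 * s + (8 * s + 2)) :=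
            (pow_le_pow_left₀ (by norm_num) h3 _).trans
              (pow_le_pow_right₀ (one_le_pow₀ hq1) (by omega))
          gcongr
      _ = _ := by ring
  have h3 : q ^ (56 * s + 9) * L * q ^ s ≤ q ^ m := by
    refine le_of_pow_le_pow_left₀ (n := 8) (by norm_num) (by positivity) ?_
    calc (q ^ (56 * s + 9) * L * q ^ s) ^ 8 = q ^ (8 * (57 * s + 9)) * L ^ 8 := by ring
      _ ≤ q ^ (8 * (57 * s + 9)) * q ^ (7 * m) := by
          gcongr
          exact pow_eight_le hq m
      _ = q ^ (8 * (57 * s + 9) + 7 * m) := by rw [pow_add]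
      _ ≤ q ^ (m * 8) := pow_le_pow_right₀ hq1 (by omega)
      _ = (q ^ m) ^ 8 := by rw [pow_mul]
  have h4 : (1 : ℝ) ≤ 3 * (m + 1) ^ 3 := by
    have : (1 : ℝ) ≤ (m + 1) ^ 3 := one_le_pow₀ (by
      have : (0 : ℝ) ≤ m := Nat.cast_nonneg m
      linarith)
    linarith
  calc _ ≤ q ^ (56 * s + 9) * L * q ^ s := by
        gcongr
        exact h1.trans h2
    _ ≤ q ^ m := h3
    _ ≤ _ := le_mul_of_one_le_left (by positivity) h4

end LinearPhase

section QuadraticPhase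

variable {F : Type*} [Field F] [Fintype F]

open scoped Classical in
theorem exists_card_le_of_forall_exists {ι : Type*} {S : Finset ι} (hS : S.Nonempty) {r : ℕ}
    {P : ι → F[X] → Prop} (h : ∀ i ∈ S, ∃ g : F[X], g ≠ 0 ∧ g.natDegree ≤ r ∧ P i g) :
    ∃ g : F[X], g ≠ 0 ∧ g.natDegree ≤ r ∧
      S.card ≤ Fintype.card F ^ (r + 1) * (S.filter (P · g)).card := by
  choose! f hf0 hfr hfP using h
  have h1 : ∀ i ∈ S, f i ∈ S.image f := fun i hi => Finset.mem_image_of_mem f hi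
  have h2 : (S.image f).card ≤ Fintype.card F ^ (r + 1) := by
    rw [← card_lows (F := F)]
    refine Finset.card_le_card fun g hg => ?_
    obtain ⟨i, hi, rfl⟩ := Finset.mem_image.1 hg
    rw [mem_lows, degree_eq_natDegree (hf0 i hi)]
    exact_mod_cast Nat.lt_succ_iff.2 (hfr i hi)
  have h3 : ∑ _g ∈ S.image f, S.card ≤
      ∑ g ∈ S.image f, Fintype.card F ^ (r + 1) * (S.filter fun i => f i = g).card := by
    rw [← Finset.mul_sum, ← Finset.card_eq_sum_card_fiberwise h1, Finset.sum_const, smul_eq_mul]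
    exact Nat.mul_le_mul_right _ h2
  obtain ⟨g, hg, hle⟩ := Finset.exists_le_of_sum_le (hS.image f) h3
  obtain ⟨i, hi, rfl⟩ := Finset.mem_image.1 hg
  refine ⟨f i, hf0 i hi, hfr i hi, hle.trans (Nat.mul_le_mul_left _ (Finset.card_le_card ?_))⟩
  intro k hk
  rw [Finset.mem_filter] at hk ⊢
  exact ⟨hk.1, hk.2 ▸ hfP k hk.1⟩

theorem exists_ne_zero_of_norm_sum_quadratic {χ : AddChar F Circle} (hχ : χ ≠ 1)
    (hF : ringChar F ≠ 2) {b l : F[X] →ₗ[F] F} {i r : ℕ} (hri : r < i)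
    (h : (Fintype.card F : ℝ) ^ (2 * i) <
      ‖∑ f ∈ monics F i, (χ (b (f ^ 2) + l f) : ℂ)‖ ^ 2 * (Fintype.card F : ℝ) ^ r) :
    ∃ g : F[X], g ≠ 0 ∧ g.natDegree ≤ r ∧ ∀ x ∈ degreeLT F (2 * i - 1 - r), b (g * x) = 0 := by
  have hq : (1 : ℝ) < Fintype.card F := by exact_mod_cast Fintype.one_lt_card
  have h1 := h.trans_le (mul_le_mul_of_nonneg_right (norm_sum_quadratic_sq_le hχ hF i b l)
    (by positivity))
  rw [← pow_add] at h1
  have h2 := (pow_lt_pow_iff_right₀ hq).1 h1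
  exact exists_ne_zero_of_finrank_hankelKer (B := b) (N := 2 * i - 1) (D := i) (W := i) (r := r)
    (by omega) hri hri (by omega)

open scoped Classical in
/-- If a trilinear Hankel form vanishes for many pairs in the first two variables, then it
factors through a polynomial of low degree. -/
theorem exists_ne_zero_of_card_lt {B : F[X] →ₗ[F] F} {J N e : ℕ} (hJ : 2 * e + 2 < J) (hN : 2 * e + 2 < N)
    (h : Fintype.card F ^ (2 * J) < ((lows F J ×ˢ lows F J).filter fun p =>
      ∀ x ∈ degreeLT F N, B (p.1 * p.2 * x) = 0).card * Fintype.card F ^ e) :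
    ∃ g : F[X], g ≠ 0 ∧ g.natDegree ≤ 3 * e + 2 ∧
      ∀ x ∈ degreeLT F (2 * J + N - (3 * e + 4)), B (g * x) = 0 := by
  set q := Fintype.card F with hq
  have hq1 : 2 ≤ q := Fintype.one_lt_card
  set κ : F[X] → ℕ := fun v =>
    Module.finrank F (hankelKer (B ∘ₗ LinearMap.mulLeft F v) J N) with hκ
  have h1 : ((lows F J ×ˢ lows F J).filter fun p =>
      ∀ x ∈ degreeLT F N, B (p.1 * p.2 * x) = 0).card = ∑ v ∈ lows F J, q ^ κ v := by
    rw [Finset.card_filter, Finset.sum_product]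
    refine Finset.sum_congr rfl fun v _ => ?_
    rw [← Finset.card_filter, hκ, hq, ← card_filter_mem_submodule (hankelKer_le_degreeLT J N)]
    congr 1
    refine Finset.filter_congr fun u hu => ?_
    rw [mem_hankelKer, mem_degreeLT, ← mem_lows]
    simp only [hu, true_and, LinearMap.comp_apply, LinearMap.mulLeft_apply, mul_assoc]
  set S := (lows F J).filter fun v => J ≤ κ v + e with hS
  have h2 : q ^ J < S.card * q ^ (e + 1) := by
    have h3 : ∀ v ∈ lows F J, q ^ κ v * q ^ e * q ≤
        (if J ≤ κ v + e then q ^ (J + e + 1) else 0) + q ^ J := by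
      intro v _
      split_ifs with hv
      · refine le_trans ?_ (Nat.le_add_right _ _)
        rw [← pow_add, ← pow_succ]
        have := finrank_hankelKer_le (B := B ∘ₗ LinearMap.mulLeft F v) J N
        exact Nat.pow_le_pow_right (by omega) (by simp only [hκ]; omega)
      · rw [zero_add, ← pow_add, ← pow_succ]
        exact Nat.pow_le_pow_right (by omega) (by omega)
    have h4 := Finset.sum_le_sum h3
    rw [← Finset.sum_mul, ← Finset.sum_mul, ← h1, Finset.sum_add_distrib, ← Finset.sum_filter,
      Finset.sum_const, Finset.sum_const, smul_eq_mul, smul_eq_mul, card_lows, ← hq, ← hS] at h4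
    have h5 : q ^ (2 * J) = q ^ J * q ^ J := by ring
    have h6 : q ^ (J + e + 1) = q ^ J * q ^ (e + 1) := by ring
    rw [h5] at h
    rw [h6] at h4
    have h7 : q ^ J * q ^ J * 2 < S.card * (q ^ J * q ^ (e + 1)) + q ^ J * q ^ J :=
      lt_of_lt_of_le (lt_of_le_of_lt (Nat.mul_le_mul_left _ hq1)
        (Nat.mul_lt_mul_of_pos_right h (by omega))) h4
    have h8 : q ^ J * q ^ J < q ^ J * (S.card * q ^ (e + 1)) := by
      rw [mul_left_comm]
      omega
    exact lt_of_mul_lt_mul_left h8 (Nat.zero_le _)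
  have hSne : S.Nonempty := by
    rw [Finset.nonempty_iff_ne_empty]
    intro h0
    rw [h0] at h2
    simp at h2
  obtain ⟨g₂, hg₂0, hg₂d, hg₂⟩ := exists_card_le_of_forall_exists hSne (r := e)
    (P := fun v g => ∀ x ∈ degreeLT F (J + N - 1 - e), B (v * (g * x)) = 0) fun v hv =>
      exists_ne_zero_of_finrank_hankelKer (B := B ∘ₗ LinearMap.mulLeft F v) (N := J + N - 1)
        (D := J) (W := N) (r := e) (by omega) (by omega) (by omega) (Finset.mem_filter.1 hv).2
  set B₂ := B ∘ₗ LinearMap.mulLeft F g₂ with hB₂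
  have h3 : (S.filter fun v => ∀ x ∈ degreeLT F (J + N - 1 - e), B (v * (g₂ * x)) = 0).card ≤
      q ^ Module.finrank F (hankelKer B₂ J (J + N - 1 - e)) := by
    rw [← card_filter_mem_submodule (hankelKer_le_degreeLT _ _)]
    refine Finset.card_le_card fun v hv => ?_
    rw [Finset.mem_filter, hS, Finset.mem_filter] at hv
    rw [Finset.mem_filter, mem_hankelKer, mem_degreeLT, ← mem_lows]
    refine ⟨hv.1.1, hv.1.1, fun w hw => ?_⟩
    rw [hB₂, LinearMap.comp_apply, LinearMap.mulLeft_apply, mul_left_comm]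
    exact hv.2 w hw
  have h4 : J < Module.finrank F (hankelKer B₂ J (J + N - 1 - e)) + (2 * e + 2) := by
    have h5 : q ^ J < q ^ (Module.finrank F (hankelKer B₂ J (J + N - 1 - e)) + (2 * e + 2)) := by
      refine h2.trans_le ((Nat.mul_le_mul_right _ (hg₂.trans (Nat.mul_le_mul_left _ h3))).trans_eq ?_)
      ring
    exact (Nat.pow_lt_pow_iff_right hq1).1 h5
  obtain ⟨g₃, hg₃0, hg₃d, hg₃⟩ := exists_ne_zero_of_finrank_hankelKer (B := B₂)
    (N := J + (J + N - 1 - e) - 1) (D := J) (W := J + N - 1 - e) (r := 2 * e + 2) (by omega)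
    (by omega) (by omega) h4.le
  refine ⟨g₂ * g₃, mul_ne_zero hg₂0 hg₃0, natDegree_mul_le.trans (by omega), fun x hx => ?_⟩
  rw [mul_assoc]
  exact hg₃ x (degreeLT_mono (by omega) hx)

/-- The phase `χ ∘ (f ↦ b (f ^ 2) + l f)` either satisfies the bilinear bound or has a quadratic
part of small rank. -/
theorem bound_or_exists_of_quadratic {χ : AddChar F Circle} (hχ : χ ≠ 1) (hF : ringChar F ≠ 2)
    (b l : F[X] →ₗ[F] F) {m s : ℕ} (hm : 116 * s + 80 < m) :
    ‖∑ f ∈ monics F m, (polyMu f : ℂ) * χ (b (f ^ 2) + l f)‖ * (Fintype.card F : ℝ) ^ s ≤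
        3 * (m + 1) ^ 3 * (Fintype.card F : ℝ) ^ m ∨
      ∃ G : F[X], G ≠ 0 ∧ G.natDegree ≤ 116 * s + 80 ∧
        ∀ x ∈ degreeLT F (2 * m - 1 - (116 * s + 80)), b (G * x) = 0 := by
  classical
  by_contra! hcon
  obtain ⟨h1, h2⟩ := hcon
  have hq1 : (1 : ℝ) < Fintype.card F := by exact_mod_cast Fintype.one_lt_card
  refine h1.not_ge (norm_sum_polyMu_mul_le_of_bilinear (U := 28 * s + 20)
    (fun f => (Circle.norm_coe (χ (b (f ^ 2) + l f))).le) (by omega) ?_ ?_)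
  · intro i hi k hik d hd
    rw [mem_monics] at hd
    by_contra! h
    have h3 : (Fintype.card F : ℝ) ^ (2 * k) <
        ‖∑ f ∈ monics F k, (χ ((b ∘ₗ LinearMap.mulLeft F (d ^ 2)) (f ^ 2) +
          (l ∘ₗ LinearMap.mulLeft F d) f) : ℂ)‖ ^ 2 * (Fintype.card F : ℝ) ^ (4 * s) := by
      simp only [LinearMap.comp_apply, LinearMap.mulLeft_apply, ← mul_pow]
      rw [mul_comm 2 k, pow_mul]
      refine (pow_lt_pow_left₀ h (by positivity) (by norm_num)).trans_le ?_
      rw [mul_pow, ← pow_mul]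
      refine mul_le_mul_of_nonneg_left (pow_le_pow_right₀ hq1.le (by omega)) (by positivity)
    obtain ⟨g, hg0, hgd, hg⟩ := exists_ne_zero_of_norm_sum_quadratic hχ hF (by omega) h3
    obtain ⟨x, hx, hx0⟩ := h2 (d ^ 2 * g) (mul_ne_zero (pow_ne_zero 2 hd.1.ne_zero) hg0)
      (natDegree_mul_le.trans (by rw [hd.1.natDegree_pow, hd.2]; omega))
    refine hx0 ?_
    rw [mul_assoc]
    exact hg x (degreeLT_mono (by omega) hx)
  · intro i j hi hj hij bad hbad
    by_contra! hcard
    have hcard' : Fintype.card F ^ (2 * j) < bad.card * Fintype.card F ^ (4 * s) := by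
      exact_mod_cast hcard
    have hne : bad.Nonempty := by
      rw [Finset.nonempty_iff_ne_empty]
      rintro rfl
      simp at hcard'
    obtain ⟨g, hg0, hgd, hg⟩ := exists_card_le_of_forall_exists hne (r := 4 * s)
      (P := fun p g => ∀ x ∈ degreeLT F (2 * i - 1 - 4 * s), b ((p.1 ^ 2 - p.2 ^ 2) * (g * x)) = 0)
      fun p hp => by
        refine exists_ne_zero_of_norm_sum_quadratic hχ hF
          (b := b ∘ₗ LinearMap.mulLeft F (p.1 ^ 2 - p.2 ^ 2))
          (l := l ∘ₗ LinearMap.mulLeft F (p.1 - p.2)) (by omega) ?_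
        convert (hbad p hp).2 using 4
        refine Finset.sum_congr rfl fun a _ => ?_
        rw [conj_coe_addChar, ← coe_addChar_add]
        simp only [LinearMap.comp_apply, LinearMap.mulLeft_apply]
        rw [neg_add, add_add_add_comm, ← sub_eq_add_neg, ← sub_eq_add_neg, ← map_sub, ← map_sub]
        congr 5 <;> ring
    set T := bad.filter fun p => ∀ x ∈ degreeLT F (2 * i - 1 - 4 * s),
      b ((p.1 ^ 2 - p.2 ^ 2) * (g * x)) = 0 with hT
    have h2F : (2 : F) ≠ 0 := Ring.two_ne_zero hF
    have h2F' : (2 : F[X]) ≠ 0 := by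
      rw [← C_ofNat]
      exact C_ne_zero.2 h2F
    have hTle : T.card ≤ ((lows F (j + 1) ×ˢ lows F (j + 1)).filter fun p =>
        ∀ x ∈ degreeLT F (2 * i - 1 - 4 * s),
          (b ∘ₗ LinearMap.mulLeft F g) (p.1 * p.2 * x) = 0).card := by
      refine Finset.card_le_card_of_injOn (fun p => (p.1 - p.2, p.1 + p.2)) (fun p hp => ?_) ?_
      · rw [Finset.mem_coe, hT, Finset.mem_filter] at hp
        have hp' := Finset.mem_product.1 (hbad p hp.1).1
        have hlt : ∀ f ∈ monics F j, f ∈ degreeLT F (j + 1) := fun f hf => by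
          rw [mem_monics] at hf
          rw [mem_degreeLT, degree_eq_natDegree hf.1.ne_zero, hf.2]
          exact_mod_cast Nat.lt_succ_self j
        rw [Finset.mem_coe, Finset.mem_filter, Finset.mem_product, mem_lows, mem_lows,
          ← mem_degreeLT, ← mem_degreeLT]
        refine ⟨⟨sub_mem (hlt _ hp'.1) (hlt _ hp'.2), add_mem (hlt _ hp'.1) (hlt _ hp'.2)⟩,
          fun x hx => ?_⟩
        rw [← hp.2 x hx, LinearMap.comp_apply, LinearMap.mulLeft_apply]
        congr 1
        ring
      · rintro ⟨a, a'⟩ _ ⟨c, c'⟩ _ h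
        simp only [Prod.mk.injEq] at h ⊢
        obtain ⟨h, h'⟩ := h
        refine ⟨mul_left_cancel₀ h2F' ?_, mul_left_cancel₀ h2F' ?_⟩
        · linear_combination h + h'
        · linear_combination h' - h
    obtain ⟨G, hG0, hGd, hG⟩ := exists_ne_zero_of_card_lt (B := b ∘ₗ LinearMap.mulLeft F g)
      (J := j + 1) (N := 2 * i - 1 - 4 * s) (e := 2 * (4 * s) + 3) (by omega) (by omega) (by
        have h3 : bad.card * Fintype.card F ^ (4 * s) ≤ Fintype.card F ^ (4 * s + 1) * T.card *
            Fintype.card F ^ (4 * s) := Nat.mul_le_mul_right _ hg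
        have h4 := hcard'.trans_le (h3.trans (Nat.mul_le_mul_right _ (Nat.mul_le_mul_left _ hTle)))
        have h5 := Nat.mul_lt_mul_of_pos_right h4
          (pow_pos (Fintype.card_pos (α := F)) 2)
        refine lt_of_eq_of_lt ?_ (h5.trans_eq ?_) <;> ring)
    obtain ⟨x, hx, hx0⟩ := h2 (g * G) (mul_ne_zero hg0 hG0) (natDegree_mul_le.trans (by omega))
    refine hx0 ?_
    rw [mul_assoc]
    exact hG x (degreeLT_mono (by omega) hx)

end QuadraticPhase

section MajorArc

variable {F : Type*} [Field F]

theorem map_sq_eq_of_sub_eq_mul {b : F[X] →ₗ[F] F} {G : F[X]} {m r : ℕ} (hr : r < m)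
    (hG : ∀ x ∈ degreeLT F (2 * m - 1 - r), b (G * x) = 0) {v w y : F[X]}
    (hv : v ∈ degreeLT F m) (hw : w ∈ degreeLT F m) (hy : y ∈ degreeLT F (m - r))
    (h : G * y = v - w) : b (v ^ 2) = b (w ^ 2) := by
  rw [← sub_eq_zero, ← map_sub, ← hG (y * (v + w)) ?_]
  · congr 1
    linear_combination (-(v + w)) * h
  · have hvw := add_mem hv hw
    rcases eq_or_ne (y * (v + w)) 0 with h0 | h0
    · rw [h0]
      exact zero_mem _
    · rw [mem_degreeLT, ← natDegree_lt_iff_degree_lt (left_ne_zero_of_mul h0)] at hy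
      rw [mem_degreeLT, ← natDegree_lt_iff_degree_lt (right_ne_zero_of_mul h0)] at hvw
      rw [mem_degreeLT, ← natDegree_lt_iff_degree_lt h0,
        natDegree_mul (left_ne_zero_of_mul h0) (right_ne_zero_of_mul h0)]
      omega

variable [Fintype F]

theorem norm_sum_polyMu_quadratic_le {χ : AddChar F Circle} (hχ : χ ≠ 1) (hF : ringChar F ≠ 2)
    (b l : F[X] →ₗ[F] F) {m s : ℕ} (hm : 53352 * s + 36552 ≤ m) :
    ‖∑ f ∈ monics F m, (polyMu f : ℂ) * χ (b (f ^ 2) + l f)‖ * (Fintype.card F : ℝ) ^ s ≤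
      3 * (m + 1) ^ 3 * (Fintype.card F : ℝ) ^ m := by
  classical
  obtain h | ⟨G, hG0, hGd, hG⟩ := bound_or_exists_of_quadratic hχ hF b l (m := m) (s :=
      s) (by omega)
  · exact h
  obtain ⟨r, hr⟩ : ∃ r, r = 116 * s + 80 := ⟨_, rfl⟩
  rw [← hr] at hGd hG
  have hrm : r < m := by omega
  have hfin := finiteDimensional_degreeLT (F := F) m
  set S' : Submodule F F[X] := (degreeLT F (m - r)).map (LinearMap.mulLeft F G) with hS'
  have hS'le : S' ≤ degreeLT F m := by
    rintro _ ⟨y, hy, rfl⟩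
    rw [SetLike.mem_coe] at hy
    rw [LinearMap.mulLeft_apply]
    rcases eq_or_ne y 0 with rfl | hy0
    · simp
    · rw [mem_degreeLT, ← natDegree_lt_iff_degree_lt hy0] at hy
      rw [mem_degreeLT, ← natDegree_lt_iff_degree_lt (mul_ne_zero hG0 hy0),
        natDegree_mul hG0 hy0]
      omega
  have hS'rank : Module.finrank F S' = m - r := by
    rw [hS', ← (Submodule.equivMapOfInjective _ (mul_right_injective₀ hG0) _).finrank_eq,
      finrank_degreeLT]
  set S : Submodule F (degreeLT F m) := S'.comap (degreeLT F m).subtype with hS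
  have hSrank : Module.finrank F S = m - r := by
    rw [← hS'rank]
    exact (Submodule.comapSubtypeEquivOfLe hS'le).finrank_eq
  have hWrank : Module.finrank F (degreeLT F m ⧸ S) = r := by
    have := S.finrank_quotient_add_finrank
    rw [hSrank, finrank_degreeLT] at this
    omega
  set π : F[X] → degreeLT F m ⧸ S := fun v =>
    if h : v ∈ degreeLT F m then S.mkQ ⟨v, h⟩ else 0 with hπ
  set Φ : degreeLT F m ⧸ S → ℂ := fun w =>
    χ (b (((Quotient.out w : degreeLT F m) : F[X]) ^ 2)) with hΦ
  have hπv : ∀ v (hv : v ∈ degreeLT F m), π v = S.mkQ ⟨v, hv⟩ := fun v hv => by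
    rw [hπ]
    exact dif_pos hv
  have hΦπ : ∀ v ∈ degreeLT F m, Φ (π v) = χ (b (v ^ 2)) := by
    intro v hv
    have h1 : S.mkQ (Quotient.out (π v)) = S.mkQ ⟨v, hv⟩ := by
      rw [← hπv v hv]
      exact Quotient.out_eq (π v)
    rw [← sub_eq_zero, ← map_sub, Submodule.mkQ_apply, Submodule.Quotient.mk_eq_zero] at h1
    obtain ⟨y, hy, hyv⟩ := h1
    rw [hΦ]
    exact congrArg (fun z => (χ z : ℂ)) (map_sq_eq_of_sub_eq_mul hrm hG (Subtype.prop _) hv hy hyv)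
  set l₁ : F[X] →ₗ[F] F := (2 : F) • (b ∘ₗ LinearMap.mulLeft F (X ^ m)) + l with hl₁
  set κ : F := b ((X ^ m) ^ 2) + l (X ^ m) with hκ
  set a : F[X] → ℂ := fun v => (polyMu (X ^ m + v) : ℂ) * (χ κ * χ (l₁ v)) with ha
  have hq : (0 : ℝ) < (Fintype.card F : ℝ) := by exact_mod_cast Fintype.card_pos
  have hB : ∀ d : Module.Dual F (degreeLT F m ⧸ S), ‖∑ v ∈ lows F m, a v * χ (d (π v))‖ ≤
      3 * (m + 1) ^ 3 * (Fintype.card F : ℝ) ^ m / (Fintype.card F : ℝ) ^ (r + s) := by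
    intro d
    obtain ⟨l₂, hl₂⟩ := LinearMap.exists_extend (d ∘ₗ S.mkQ)
    have hl : ∀ v ∈ degreeLT F m, d (π v) = l₂ v := fun v hv => by
      rw [hπv v hv]
      exact (LinearMap.congr_fun hl₂ ⟨v, hv⟩).symm
    have h1 := norm_sum_polyMu_linear_le hχ hF (l₁ + l₂) (m := m) (s := r + s) (by omega)
    rw [← le_div_iff₀ (by positivity)] at h1
    refine le_of_eq_of_le ?_ h1
    have h2 : ∑ v ∈ lows F m, a v * χ (d (π v)) = χ (κ - (l₁ + l₂) (X ^ m)) *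
        ∑ f ∈ monics F m, (polyMu f : ℂ) * χ ((l₁ + l₂) f) := by
      rw [sum_monics, Finset.mul_sum]
      refine Finset.sum_congr rfl fun v hv => ?_
      rw [hl v (mem_degreeLT.2 (mem_lows.1 hv)), ha]
      dsimp only
      rw [mul_assoc, mul_left_comm (χ (κ - _) : ℂ), ← coe_addChar_add, ← coe_addChar_add,
        ← coe_addChar_add]
      congr 3
      rw [map_add (l₁ + l₂), LinearMap.add_apply l₁ l₂ v]
      ring
    rw [h2, norm_mul, Circle.norm_coe, one_mul]
  have h3 := norm_sum_comp_le hχ (lows F m) a π Φ (fun w => (Circle.norm_coe _).le) hB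
  rw [hWrank] at h3
  have h4 : ∑ f ∈ monics F m, (polyMu f : ℂ) * χ (b (f ^ 2) + l f) =
      ∑ v ∈ lows F m, a v * Φ (π v) := by
    rw [sum_monics]
    refine Finset.sum_congr rfl fun v hv => ?_
    rw [hΦπ v (mem_degreeLT.2 (mem_lows.1 hv)), ha]
    dsimp only
    rw [mul_assoc, ← coe_addChar_add, ← coe_addChar_add]
    congr 3
    rw [add_sq, mul_assoc, map_add b, map_add b, map_add l, hκ, hl₁, LinearMap.add_apply,
      LinearMap.smul_apply, LinearMap.comp_apply, LinearMap.mulLeft_apply, ← map_smul,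
      smul_eq_C_mul, C_ofNat]
    ring
  rw [h4]
  calc _ ≤ (Fintype.card F : ℝ) ^ r * (3 * (m + 1) ^ 3 * (Fintype.card F : ℝ) ^ m /
        (Fintype.card F : ℝ) ^ (r + s)) * (Fintype.card F : ℝ) ^ s := by gcongr
    _ = _ := by
      rw [pow_add]
      field_simp

end MajorArc

section Assembly

variable {F : Type*} [Field F]

theorem exists_linearMap_hankel {n : ℕ} {M : Matrix (Fin n) (Fin n) F}
    (hM : ∀ i j i' j' : Fin n, (i : ℕ) + (j : ℕ) = (i' : ℕ) + (j' : ℕ) → M i j = M i' j') :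
    ∃ b : F[X] →ₗ[F] F, ∀ x : Fin n → F, b (lowPoly F n x ^ 2) = x ⬝ᵥ M.mulVec x := by
  classical
  set h : ℕ → F := fun k =>
    if hk : ∃ ij : Fin n × Fin n, (ij.1 : ℕ) + (ij.2 : ℕ) = k then
      M hk.choose.1 hk.choose.2 else 0 with hh
  have h1 : ∀ i j : Fin n, h (i + j) = M i j := fun i j => by
    have hk : ∃ ij : Fin n × Fin n, (ij.1 : ℕ) + (ij.2 : ℕ) = i + j := ⟨(i, j), rfl⟩
    rw [hh]
    dsimp only
    rw [dif_pos hk]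
    exact hM _ _ _ _ hk.choose_spec
  refine ⟨(basisMonomials F).constr F h, fun x => ?_⟩
  have h2 : ∀ (a : F) (k : ℕ), (basisMonomials F).constr F h (C a * X ^ k) = a * h k :=
      fun a k => by
    rw [← smul_eq_C_mul, map_smul, smul_eq_mul, ← monomial_one_right_eq_X_pow,
      ← congrFun (coe_basisMonomials (R := F)) k, Module.Basis.constr_basis]
  rw [sq, lowPoly, Finset.sum_mul_sum, map_sum, dotProduct]
  refine Finset.sum_congr rfl fun i _ => ?_
  rw [map_sum, mulVec, dotProduct, Finset.mul_sum]
  refine Finset.sum_congr rfl fun j _ => ?_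
  rw [← h1, mul_mul_mul_comm, ← C_mul, ← pow_add, h2]
  ring

variable [Fintype F]

theorem sum_lowPoly {M : Type*} [AddCommMonoid M] (n : ℕ) (g : F[X] → M) :
    ∑ x : Fin n → F, g (lowPoly F n x) = ∑ f ∈ lows F n, g f := by
  classical
  rw [lows, Finset.sum_image fun _ _ _ _ h => lowPoly_injective n h]

open scoped Classical in
theorem sum_lows_eq_sum_monics {M : Type*} [AddCommMonoid M] (n : ℕ) (g : F[X] → M) (hg : g 0 = 0) :
    ∑ f ∈ lows F n, g f = ∑ m ∈ Finset.range n, ∑ c ∈ Finset.univ.erase (0 : F),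
      ∑ f ∈ monics F m, g (C c * f) := by
  have h1 : ∀ m ∈ Finset.range n, ∑ c ∈ Finset.univ.erase (0 : F), ∑ f ∈ monics F m, g (C c * f) =
      ∑ k ∈ Finset.univ.erase (0 : F) ×ˢ monics F m, g (C k.1 * k.2) := fun m _ =>
    (Finset.sum_product _ _ fun k : F × F[X] => g (C k.1 * k.2)).symm
  rw [Finset.sum_congr rfl h1, Finset.sum_sigma', ← Finset.sum_erase (lows F n) hg]
  refine Finset.sum_bij' (fun f _ => ⟨f.natDegree, f.leadingCoeff, C f.leadingCoeff⁻¹ * f⟩)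
    (fun k _ => C k.2.1 * k.2.2) (fun f hf => ?_) (fun k hk => ?_) (fun f hf => ?_)
    (fun k hk => ?_) fun f hf => ?_
  · rw [Finset.mem_erase, mem_lows] at hf
    have h0 := leadingCoeff_ne_zero.2 hf.1
    rw [← natDegree_lt_iff_degree_lt hf.1] at hf
    simp only [Finset.mem_sigma, Finset.mem_range, Finset.mem_product, Finset.mem_erase,
      Finset.mem_univ, and_true, mem_monics]
    refine ⟨hf.2, h0, ?_, ?_⟩
    · rw [mul_comm]
      exact monic_mul_leadingCoeff_inv hf.1
    · exact natDegree_C_mul (inv_ne_zero h0)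
  · simp only [Finset.mem_sigma, Finset.mem_range, Finset.mem_product, Finset.mem_erase,
      Finset.mem_univ, and_true, mem_monics] at hk
    obtain ⟨hm, hc, hf, hd⟩ := hk
    have h0 := mul_ne_zero (C_ne_zero.2 hc) hf.ne_zero
    rw [Finset.mem_erase, mem_lows, ← natDegree_lt_iff_degree_lt h0, natDegree_C_mul hc, hd]
    exact ⟨h0, hm⟩
  · rw [Finset.mem_erase] at hf
    rw [← mul_assoc, ← C_mul, mul_inv_cancel₀ (leadingCoeff_ne_zero.2 hf.1), C_1, one_mul]
  · obtain ⟨m, c, f⟩ := k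
    simp only [Finset.mem_sigma, Finset.mem_range, Finset.mem_product, Finset.mem_erase,
      Finset.mem_univ, and_true, mem_monics] at hk
    obtain ⟨hm, hc, hf, rfl⟩ := hk
    have h1 : (C c * f).leadingCoeff = c := by rw [leadingCoeff_mul, leadingCoeff_C,
        hf.leadingCoeff, mul_one]
    simp only [h1, natDegree_C_mul hc]
    rw [← mul_assoc, ← C_mul, inv_mul_cancel₀ hc, C_1, one_mul]
  · rw [Finset.mem_erase] at hf
    rw [← mul_assoc, ← C_mul, mul_inv_cancel₀ (leadingCoeff_ne_zero.2 hf.1), C_1, one_mul]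

theorem exists_addChar_circle_ne_one : ∃ χ : AddChar F Circle, χ ≠ 1 := by
  obtain ⟨ψ, hψ⟩ := (AddChar.exists_apply_ne_zero (α := F)).2 one_ne_zero
  refine ⟨AddChar.circleEquivComplex.symm ψ, fun h => hψ ?_⟩
  rw [← AddChar.circleEquivComplex.apply_symm_apply ψ, h]
  rfl

theorem norm_sum_monics_polyMu_le (hF : ringChar F ≠ 2) (χ : AddChar F Circle)
    (b l : F[X] →ₗ[F] F) (m : ℕ) :
    ‖∑ f ∈ monics F m, (polyMu f : ℂ) * χ (b (f ^ 2) + l f)‖ ≤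
      3 * (Fintype.card F : ℝ) ^ 2 * (m + 1) ^ 3 *
        (Fintype.card F : ℝ) ^ ((1 - 1 / 53352 : ℝ) * m) := by
  have hq : (1 : ℝ) ≤ (Fintype.card F : ℝ) := by exact_mod_cast Fintype.card_pos (α := F)
  have hq0 : (0 : ℝ) < (Fintype.card F : ℝ) := by linarith
  obtain ⟨s, hs, hs'⟩ : ∃ s : ℕ, ((m : ℝ) ≤ 53352 * (s + 2)) ∧
      ‖∑ f ∈ monics F m, (polyMu f : ℂ) * χ (b (f ^ 2) + l f)‖ * (Fintype.card F : ℝ) ^ s ≤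
        3 * (m + 1) ^ 3 * (Fintype.card F : ℝ) ^ m := by
    rcases lt_or_ge m 36552 with hm | hm
    · refine ⟨0, ?_, ?_⟩
      · have : (m : ℝ) < 36552 := by exact_mod_cast hm
        push_cast
        linarith
      · rw [pow_zero, mul_one]
        have h1 : ‖∑ f ∈ monics F m, (polyMu f : ℂ) * χ (b (f ^ 2) + l f)‖ ≤
            (Fintype.card F : ℝ) ^ m := by
          refine (norm_sum_le _ _).trans ((Finset.sum_le_card_nsmul _ _ 1 fun f _ => ?_).trans ?_)
          · rw [norm_mul, Circle.norm_coe, mul_one, Complex.norm_intCast]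
            exact_mod_cast abs_polyMu_le f
          · rw [card_monics, nsmul_eq_mul, mul_one]
            push_cast
            rfl
        refine h1.trans (le_mul_of_one_le_left (by positivity) ?_)
        have : (1 : ℝ) ≤ ((m : ℝ) + 1) ^ 3 := one_le_pow₀ (by simp)
        linarith
    · refine ⟨(m - 36552) / 53352, ?_, ?_⟩
      · have h1 : m ≤ 53352 * ((m - 36552) / 53352 + 2) := by omega
        exact_mod_cast h1
      · have hm' : 53352 * ((m - 36552) / 53352) + 36552 ≤ m := by omega
        by_cases hχ : χ = 1
        · obtain ⟨χ', hχ'⟩ := exists_addChar_circle_ne_one (F := F)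
          convert norm_sum_polyMu_quadratic_le hχ' hF 0 0 hm' using 7
          rw [hχ]
          simp
        · exact norm_sum_polyMu_quadratic_le hχ hF b l hm'
  rw [← le_div_iff₀ (by positivity)] at hs'
  refine hs'.trans ?_
  rw [div_le_iff₀ (by positivity)]
  have h1 : (Fintype.card F : ℝ) ^ m ≤ (Fintype.card F : ℝ) ^ 2 *
      (Fintype.card F : ℝ) ^ ((1 - 1 / 53352 : ℝ) * m) * (Fintype.card F : ℝ) ^ s := by
    rw [← Real.rpow_natCast, ← Real.rpow_natCast, ← Real.rpow_natCast, ← Real.rpow_add hq0,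
      ← Real.rpow_add hq0]
    refine Real.rpow_le_rpow_of_exponent_le hq ?_
    push_cast
    linarith
  calc _ ≤ 3 * ((m : ℝ) + 1) ^ 3 * ((Fintype.card F : ℝ) ^ 2 *
      (Fintype.card F : ℝ) ^ ((1 - 1 / 53352 : ℝ) * m) * (Fintype.card F : ℝ) ^ s) := by gcongr
    _ = _ := by ring

theorem norm_sum_lows_polyMu_le (hF : ringChar F ≠ 2) (χ : AddChar F Circle)
    (b l : F[X] →ₗ[F] F) (n : ℕ) :
    ‖∑ f ∈ lows F n, (polyMu f : ℂ) * χ (b (f ^ 2) + l f)‖ ≤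
      3 * (Fintype.card F : ℝ) ^ 3 * n ^ 4 *
        (Fintype.card F : ℝ) ^ ((1 - 1 / 53352 : ℝ) * n) := by
  classical
  have hq : (1 : ℝ) ≤ (Fintype.card F : ℝ) := by exact_mod_cast Fintype.card_pos (α := F)
  rw [sum_lows_eq_sum_monics n _ (by rw [polyMu_of_not_squarefree not_squarefree_zero]; simp)]
  have h1 : ∀ m ∈ Finset.range n, ∀ c ∈ Finset.univ.erase (0 : F),
      ‖∑ f ∈ monics F m, (polyMu (C c * f) : ℂ) * χ (b ((C c * f) ^ 2) + l (C c * f))‖ ≤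
        3 * (Fintype.card F : ℝ) ^ 2 * n ^ 3 *
          (Fintype.card F : ℝ) ^ ((1 - 1 / 53352 : ℝ) * n) := by
    intro m hm c hc
    have hmn : (m : ℝ) + 1 ≤ n := by exact_mod_cast Finset.mem_range.1 hm
    have h2 := norm_sum_monics_polyMu_le hF χ (c ^ 2 • b) (c • l) m
    refine (le_of_eq_of_le ?_ h2).trans ?_
    · congr 1
      refine Finset.sum_congr rfl fun f _ => ?_
      rw [polyMu_C_mul (Finset.ne_of_mem_erase hc), mul_pow, ← C_pow, ← smul_eq_C_mul,
        ← smul_eq_C_mul, map_smul, map_smul, LinearMap.smul_apply, LinearMap.smul_apply]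
    · gcongr
      exact (Finset.mem_range.1 hm).le
  calc _ ≤ ∑ m ∈ Finset.range n, ∑ c ∈ Finset.univ.erase (0 : F),
        3 * (Fintype.card F : ℝ) ^ 2 * n ^ 3 *
          (Fintype.card F : ℝ) ^ ((1 - 1 / 53352 : ℝ) * n) :=
        (norm_sum_le _ _).trans (Finset.sum_le_sum fun m hm =>
          (norm_sum_le _ _).trans (Finset.sum_le_sum (h1 m hm)))
    _ ≤ ∑ m ∈ Finset.range n, Fintype.card F * (3 * (Fintype.card F : ℝ) ^ 2 * n ^ 3 *
          (Fintype.card F : ℝ) ^ ((1 - 1 / 53352 : ℝ) * n)) := by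
        refine Finset.sum_le_sum fun m _ => ?_
        rw [Finset.sum_const, nsmul_eq_mul]
        gcongr
        exact (Finset.univ.erase (0 : F)).card_le_univ
    _ = _ := by
        rw [Finset.sum_const, Finset.card_range, nsmul_eq_mul]
        ring

theorem exists_pow_four_le {r : ℝ} (hr : 1 < r) : ∃ K : ℝ, ∀ n : ℕ, (n : ℝ) ^ 4 ≤ K * r ^ n := by
  obtain ⟨K, hK⟩ := (tendsto_pow_const_div_const_pow_of_one_lt 4 hr).bddAbove_range
  refine ⟨K, fun n => ?_⟩
  rw [← div_le_iff₀ (by positivity)]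
  exact hK ⟨n, rfl⟩

end Assembly

/-- There is an absolute constant `ε > 0` such that for every finite field `F_q` of odd
characteristic there is a constant `C = C(q)` such that for every `n ≥ 1`, every Hankel
matrix `M` (whose `(i,j)`-entry depends only on `i+j`), every affine-linear map
`ℓ(x) = c₀ + ∑ cᵢ xᵢ` and every additive character `χ` of `F_q`,
`|∑_{x ∈ F_q^n} μ(∑ xᵢ tⁱ) χ(xᵀMx + ℓ(x))| ≤ C q^((1-ε)n)`. -/
theorem moebius_hankel_phase_bound :
    ∃ ε : ℝ, 0 < ε ∧
      ∀ (F : Type) [Field F] [Fintype F], ringChar F ≠ 2 →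
        ∃ C : ℝ, ∀ n : ℕ, 1 ≤ n → ∀ M : Matrix (Fin n) (Fin n) F,
          (∀ i j i' j' : Fin n, (i : ℕ) + (j : ℕ) = (i' : ℕ) + (j' : ℕ) → M i j = M i' j') →
          ∀ (c₀ : F) (c : Fin n → F), ∀ χ : AddChar F Circle,
            ‖∑ x : Fin n → F,
                (polyMu (lowPoly F n x) : ℂ) *
                  (χ (x ⬝ᵥ M.mulVec x + (c₀ + ∑ i, c i * x i)) : ℂ)‖ ≤
              C * (Fintype.card F : ℝ) ^ ((1 - ε) * n) := by
  refine ⟨1 / 106704, by norm_num, fun F _ _ hF => ?_⟩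
  have hq : (1 : ℝ) < (Fintype.card F : ℝ) := by exact_mod_cast Fintype.one_lt_card (α := F)
  have hq0 : (0 : ℝ) < (Fintype.card F : ℝ) := by linarith
  obtain ⟨K, hK⟩ := exists_pow_four_le (Real.one_lt_rpow hq (z := 1 / 106704) (by norm_num))
  refine ⟨3 * (Fintype.card F : ℝ) ^ 3 * K, fun n _ M hM c₀ c χ => ?_⟩
  obtain ⟨b, hb⟩ := exists_linearMap_hankel hM
  have h1 : ∀ x : Fin n → F, (polyMu (lowPoly F n x) : ℂ) *
      (χ (x ⬝ᵥ M.mulVec x + (c₀ + ∑ i, c i * x i)) : ℂ) = χ c₀ *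
        ((polyMu (lowPoly F n x) : ℂ) * χ (b (lowPoly F n x ^ 2) +
          (∑ i : Fin n, c i • lcoeff F (i : ℕ)) (lowPoly F n x))) := by
    intro x
    rw [hb, mul_left_comm, ← coe_addChar_add, LinearMap.sum_apply]
    simp only [LinearMap.smul_apply, lcoeff_apply, coeff_lowPoly, smul_eq_mul]
    congr 3
    ring
  rw [Finset.sum_congr rfl fun x _ => h1 x, ← Finset.mul_sum, norm_mul, Circle.norm_coe, one_mul,
    sum_lowPoly n fun f => (polyMu f : ℂ) * χ (b (f ^ 2) +
      (∑ i : Fin n, c i • lcoeff F (i : ℕ)) f)]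
  refine (norm_sum_lows_polyMu_le hF χ b _ n).trans ?_
  calc _ ≤ 3 * (Fintype.card F : ℝ) ^ 3 * (K * ((Fintype.card F : ℝ) ^ (1 / 106704 : ℝ)) ^ n) *
        (Fintype.card F : ℝ) ^ ((1 - 1 / 53352 : ℝ) * n) := by
        gcongr
        exact hK n
    _ = 3 * (Fintype.card F : ℝ) ^ 3 * K * ((Fintype.card F : ℝ) ^ ((1 / 106704 : ℝ) * n) *
        (Fintype.card F : ℝ) ^ ((1 - 1 / 53352 : ℝ) * n)) := by
        rw [Real.rpow_mul_natCast hq0.le (1 / 106704)]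
        ring
    _ = _ := by
        rw [← Real.rpow_add hq0]
        congr 2
        ring
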